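/- arXiv:1410.7212 — 3 statements merged into one kernel-verified Lean document; each statement's English description precedes it below -/
import Mathlib

section
/- Let K be an imaginary quadratic number field with ring of integers 𝓞_K. There is a constant C > 0, depending only on K, such that for every real x ≥ 3 and all μ, α ∈ 𝓞_K generating comaximal ideals (i.e., the ideal generated by μ and α is all of 𝓞_K) with Nm(μ) < x, the number of prime elements π of 𝓞_K with Nm(π) ≤ x and π ≡ α (mod μ) is at most C·x / (Φ(μ)·log(x/Nm(μ))). -/
open NumberField

section QuotientSums

variable {R : Type*} [CommRing R]

theorem sum_quotient_out_add {I : Ideal R} [Fintype (R ⧸ I)] {F : R → ℝ}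
    (hF : ∀ a b, a - b ∈ I → F a = F b) (r : R) :
    ∑ x : R ⧸ I, F (r + Quotient.out x) = ∑ x : R ⧸ I, F (Quotient.out x) := by
  rw [← Equiv.sum_comp (Equiv.addLeft (Ideal.Quotient.mk I r)) fun x => F (Quotient.out x)]
  refine Finset.sum_congr rfl fun x _ => hF _ _ ?_
  rw [← Ideal.Quotient.eq, map_add]
  have h : ∀ y : R ⧸ I, Ideal.Quotient.mk I (Quotient.out y) = y := fun y => Quotient.out_eq y
  simp [h]

theorem sum_quotient_out_mul {I : Ideal R} [Fintype (R ⧸ I)] {F : R → ℝ}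
    (hF : ∀ a b, a - b ∈ I → F a = F b) {m : R} (hm : IsUnit (Ideal.Quotient.mk I m)) :
    ∑ x : R ⧸ I, F (m * Quotient.out x) = ∑ x : R ⧸ I, F (Quotient.out x) := by
  rw [← Equiv.sum_comp hm.unit.mulLeft fun x => F (Quotient.out x)]
  refine Finset.sum_congr rfl fun x _ => hF _ _ ?_
  rw [← Ideal.Quotient.eq, map_mul]
  have h : ∀ y : R ⧸ I, Ideal.Quotient.mk I (Quotient.out y) = y := fun y => Quotient.out_eq y
  simp [h]

variable [IsDedekindDomain R]

theorem finset_inf_eq_prod_of_isPrime {T : Finset (Ideal R)} (hT : ∀ p ∈ T, p.IsPrime ∧ p ≠ ⊥) :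
    T.inf id = ∏ p ∈ T, p := by
  have := IsDedekindDomain.inf_pow_eq_prod_of_prime T (fun p => p) (fun _ => 1)
    (fun p hp => Ideal.prime_of_isPrime (hT p hp).2 (hT p hp).1) (fun p _ q _ h => h)
  simp only [pow_one] at this
  exact this

variable [Module.Free ℤ R]

theorem absNorm_eq_card (I : Ideal R) [Fintype (R ⧸ I)] :
    Ideal.absNorm I = Fintype.card (R ⧸ I) := by
  rw [Ideal.absNorm_apply, Submodule.cardQuot_apply, Nat.card_eq_fintype_card]

open Classical in
theorem sum_quotient_indicator_mul_absNorm {I J : Ideal R} (hIJ : I ≤ J) [Fintype (R ⧸ I)] :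
    (∑ x : R ⧸ I, if Quotient.out x ∈ J then (1 : ℝ) else 0) * Ideal.absNorm J =
      Ideal.absNorm I := by
  have h : ∀ y : R ⧸ I, Ideal.Quotient.mk I (Quotient.out y) = y := fun y => Quotient.out_eq y
  have key := AddSubgroup.card_eq_card_quotient_mul_card_addSubgroup
    (J.map (Ideal.Quotient.mk I)).toAddSubgroup
  have e := Nat.card_congr (DoubleQuot.quotQuotEquivQuotOfLE hIJ).toEquiv
  have h1 : (∑ x : R ⧸ I, if Quotient.out x ∈ J then (1 : ℝ) else 0) =
      Nat.card (J.map (Ideal.Quotient.mk I)).toAddSubgroup := by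
    rw [Finset.sum_boole, Nat.card_eq_fintype_card, Fintype.card_subtype]
    congr 2
    ext x
    simp only [Finset.mem_filter, Finset.mem_univ, true_and, Submodule.mem_toAddSubgroup]
    rw [← Ideal.mem_quotient_iff_mem hIJ, h]
  rw [h1, Ideal.absNorm_apply, Ideal.absNorm_apply, Submodule.cardQuot_apply,
    Submodule.cardQuot_apply, ← e, key]
  push_cast
  rw [mul_comm]
  rfl

variable [Module.Finite ℤ R]

open Classical in
/-- Chinese remainder theorem for averages of products of two-valued local functions. -/
theorem sum_quotient_prod_primes {T : Finset (Ideal R)} (hT : ∀ p ∈ T, p.IsPrime ∧ p ≠ ⊥)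
    {I : Ideal R} (hI : ∀ p ∈ T, I ≤ p) [Fintype (R ⧸ I)] (u v : Ideal R → ℝ) :
    ∑ x : R ⧸ I, ∏ p ∈ T, (if Quotient.out x ∈ p then u p else v p) =
      Ideal.absNorm I * ∏ p ∈ T, ((u p - v p) / Ideal.absNorm p + v p) := by
  have h1 : ∀ x : R ⧸ I, ∏ p ∈ T, (if Quotient.out x ∈ p then u p else v p) =
      ∑ S ∈ T.powerset, (if Quotient.out x ∈ S.inf id then (1 : ℝ) else 0) *
        ((∏ p ∈ S, (u p - v p)) * ∏ p ∈ T \ S, v p) := by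
    intro x
    have : ∀ p ∈ T, (if Quotient.out x ∈ p then u p else v p) =
      (if Quotient.out x ∈ p then u p - v p else 0) + v p := by
      intro p _; split_ifs <;> ring
    rw [Finset.prod_congr rfl this, Finset.prod_add]
    refine Finset.sum_congr rfl fun S _ => ?_
    rw [← mul_assoc, Finset.prod_ite_zero]
    simp [Submodule.mem_finsetInf]
  simp_rw [h1]
  rw [Finset.sum_comm, Finset.prod_add, Finset.mul_sum]
  refine Finset.sum_congr rfl fun S hS => ?_
  rw [Finset.mem_powerset] at hS
  rw [← Finset.sum_mul, ← mul_assoc, ← mul_assoc]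
  congr 1
  have hS' : ∀ p ∈ S, p.IsPrime ∧ p ≠ ⊥ := fun p hp => hT p (hS hp)
  rw [← sum_quotient_indicator_mul_absNorm (I := I) (J := S.inf id)
    (Finset.le_inf fun p hp => hI p (hS hp)), Finset.prod_div_distrib, mul_assoc]
  congr 1
  rw [finset_inf_eq_prod_of_isPrime hS', map_prod, Nat.cast_prod]
  have : ∏ p ∈ S, (Ideal.absNorm p : ℝ) ≠ 0 := by
    refine Finset.prod_ne_zero_iff.2 fun p hp => ?_
    rw [Nat.cast_ne_zero, Ne, Ideal.absNorm_eq_zero_iff]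
    exact (hS' p hp).2
  field_simp

end QuotientSums

section Box

theorem abs_sum_range_shift_sub_le {h : ℤ → ℝ} (hh : ∀ a, |h a| ≤ 1) (L s : ℕ) :
    |∑ i ∈ Finset.range L, h (i + s) - ∑ i ∈ Finset.range L, h i| ≤ 2 * s := by
  induction s with
  | zero => simp
  | succ s ih =>
    have key : ∑ i ∈ Finset.range L, h (i + (s + 1 : ℕ)) - ∑ i ∈ Finset.range L, h (i + s) =
        h (L + s) - h s := by
      rw [← Finset.sum_sub_distrib]
      have := Finset.sum_range_sub (fun i : ℕ => h (i + s)) L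
      simp only [Nat.cast_zero, zero_add] at this
      rw [← this]
      refine Finset.sum_congr rfl fun i _ => ?_
      congr 2
      push_cast
      ring
    have h1 := abs_sub (h (L + s)) (h s)
    have h2 := abs_add_le (∑ i ∈ Finset.range L, h (i + (s + 1 : ℕ)) -
      ∑ i ∈ Finset.range L, h (i + s))
      (∑ i ∈ Finset.range L, h (i + s) - ∑ i ∈ Finset.range L, h i)
    rw [sub_add_sub_cancel] at h2
    rw [key] at h2
    push_cast at *
    linarith [hh (L + s), hh s]

variable {R : Type*} [CommRing R]

theorem abs_sum_box_shift_sub_le {F : R → ℝ} (hF : ∀ a, |F a| ≤ 1) (ω₁ ω₂ r : R) (L s t : ℕ) :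
    |∑ i ∈ Finset.range L, ∑ j ∈ Finset.range L, F (r + i * ω₁ + j * ω₂ + (s * ω₁ + t * ω₂)) -
      ∑ i ∈ Finset.range L, ∑ j ∈ Finset.range L, F (r + i * ω₁ + j * ω₂)| ≤
      2 * (s + t) * L := by
  have h1 : ∀ i : ℕ, |∑ j ∈ Finset.range L, F (r + i * ω₁ + j * ω₂ + (s * ω₁ + t * ω₂)) -
      ∑ j ∈ Finset.range L, F (r + i * ω₁ + j * ω₂ + s * ω₁)| ≤ 2 * t := by
    intro i
    convert abs_sum_range_shift_sub_le (h := fun a : ℤ => F (r + i * ω₁ + a * ω₂ + s * ω₁))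
      (fun _ => hF _) L t using 5
    · push_cast; ring_nf
    · push_cast; ring_nf
  have h2 : ∀ j : ℕ, |∑ i ∈ Finset.range L, F (r + i * ω₁ + j * ω₂ + s * ω₁) -
      ∑ i ∈ Finset.range L, F (r + i * ω₁ + j * ω₂)| ≤ 2 * s := by
    intro j
    convert abs_sum_range_shift_sub_le (h := fun a : ℤ => F (r + a * ω₁ + j * ω₂))
      (fun _ => hF _) L s using 5
    · push_cast; ring_nf
    · push_cast; ring_nf
  have h3 : |∑ i ∈ Finset.range L, ∑ j ∈ Finset.range L,
        F (r + i * ω₁ + j * ω₂ + (s * ω₁ + t * ω₂)) -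
      ∑ i ∈ Finset.range L, ∑ j ∈ Finset.range L, F (r + i * ω₁ + j * ω₂ + s * ω₁)| ≤
      L * (2 * t) := by
    rw [← Finset.sum_sub_distrib]
    refine (Finset.abs_sum_le_sum_abs _ _).trans ((Finset.sum_le_sum fun i _ => h1 i).trans ?_)
    simp
  have h4 : |∑ i ∈ Finset.range L, ∑ j ∈ Finset.range L, F (r + i * ω₁ + j * ω₂ + s * ω₁) -
      ∑ i ∈ Finset.range L, ∑ j ∈ Finset.range L, F (r + i * ω₁ + j * ω₂)| ≤ L * (2 * s) := by
    rw [Finset.sum_comm, Finset.sum_comm (s := Finset.range L) (t := Finset.range L)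
      (f := fun i j : ℕ => F (r + i * ω₁ + j * ω₂)), ← Finset.sum_sub_distrib]
    refine (Finset.abs_sum_le_sum_abs _ _).trans ((Finset.sum_le_sum fun i _ => h2 i).trans ?_)
    simp
  have h5 := abs_sub_le _ _ _ |>.trans (add_le_add h3 h4)
  linarith

variable [IsDedekindDomain R] [Module.Free ℤ R]

theorem exists_box_representative {ω₁ ω₂ : R} (hω : ∀ r : R, ∃ a b : ℤ, r = a * ω₁ + b * ω₂)
    {I : Ideal R} (hI : Ideal.absNorm I ≠ 0) (r : R) :
    ∃ s t : ℕ, s ≤ Ideal.absNorm I ∧ t ≤ Ideal.absNorm I ∧ (s * ω₁ + t * ω₂) - r ∈ I := by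
  obtain ⟨a, b, rfl⟩ := hω r
  set D := Ideal.absNorm I with hD
  have hD' : (0 : ℤ) < D := by positivity
  have hmem : ((D : ℤ) : R) ∈ I := by
    rw [Int.cast_natCast]; exact Ideal.absNorm_mem I
  have hcast : ∀ c : ℤ, (((c % D).toNat : ℕ) : R) = (c : R) - ((D : ℤ) : R) * ((c / D : ℤ) : R) := by
    intro c
    rw [← Int.cast_natCast, Int.toNat_of_nonneg (Int.emod_nonneg _ hD'.ne'), Int.emod_def]
    push_cast
    ring
  have hle : ∀ c : ℤ, (c % D).toNat ≤ D := by
    intro c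
    have := Int.emod_lt_of_pos c hD'
    omega
  refine ⟨(a % D).toNat, (b % D).toNat, hle a, hle b, ?_⟩
  rw [hcast, hcast]
  have : ((a : R) - ((D : ℤ) : R) * ((a / D : ℤ) : R)) * ω₁ +
      ((b : R) - ((D : ℤ) : R) * ((b / D : ℤ) : R)) * ω₂ - (a * ω₁ + b * ω₂) =
      -(((a / D : ℤ) : R) * ω₁ + ((b / D : ℤ) : R) * ω₂) * ((D : ℤ) : R) := by ring
  rw [this]
  exact I.mul_mem_left _ hmem

theorem abs_sum_box_sub_average_le {ω₁ ω₂ : R}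
    (hω : ∀ r : R, ∃ a b : ℤ, r = a * ω₁ + b * ω₂) {I : Ideal R} [Fintype (R ⧸ I)]
    {F : R → ℝ} (hF : ∀ a, |F a| ≤ 1) (hper : ∀ a b, a - b ∈ I → F a = F b) (r : R) (L : ℕ) :
    |∑ i ∈ Finset.range L, ∑ j ∈ Finset.range L, F (r + i * ω₁ + j * ω₂) -
      L ^ 2 * ((∑ x : R ⧸ I, F (Quotient.out x)) / Ideal.absNorm I)| ≤
      4 * Ideal.absNorm I * L := by
  have hcard := absNorm_eq_card I
  have hI0 : Ideal.absNorm I ≠ 0 := by rw [hcard]; exact Fintype.card_ne_zero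
  have hpos : (0 : ℝ) < Ideal.absNorm I := by positivity
  set B := ∑ i ∈ Finset.range L, ∑ j ∈ Finset.range L, F (r + i * ω₁ + j * ω₂) with hB
  have hx : ∀ x : R ⧸ I, |∑ i ∈ Finset.range L, ∑ j ∈ Finset.range L,
      F (r + i * ω₁ + j * ω₂ + Quotient.out x) - B| ≤ 4 * Ideal.absNorm I * L := by
    intro x
    obtain ⟨s, t, hs, ht, hst⟩ := exists_box_representative hω hI0 (Quotient.out x)
    have h1 := abs_sum_box_shift_sub_le hF ω₁ ω₂ r L s t
    have h2 : ∀ y, F (y + (s * ω₁ + t * ω₂)) = F (y + Quotient.out x) := by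
      intro y
      apply hper
      rwa [add_sub_add_left_eq_sub]
    simp_rw [h2] at h1
    refine h1.trans ?_
    have hs' : (s : ℝ) ≤ Ideal.absNorm I := by exact_mod_cast hs
    have ht' : (t : ℝ) ≤ Ideal.absNorm I := by exact_mod_cast ht
    have : (0 : ℝ) ≤ L := by positivity
    nlinarith
  have hsum : ∑ x : R ⧸ I, ∑ i ∈ Finset.range L, ∑ j ∈ Finset.range L,
      F (r + i * ω₁ + j * ω₂ + Quotient.out x) = L ^ 2 * ∑ x : R ⧸ I, F (Quotient.out x) := by
    rw [Finset.sum_comm]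
    simp_rw [Finset.sum_comm (s := (Finset.univ : Finset (R ⧸ I)))]
    simp_rw [sum_quotient_out_add hper]
    simp
    ring
  have htot : |L ^ 2 * ∑ x : R ⧸ I, F (Quotient.out x) - Ideal.absNorm I * B| ≤
      Ideal.absNorm I * (4 * Ideal.absNorm I * L) := by
    have : L ^ 2 * ∑ x : R ⧸ I, F (Quotient.out x) - Ideal.absNorm I * B =
        ∑ x : R ⧸ I, (∑ i ∈ Finset.range L, ∑ j ∈ Finset.range L,
          F (r + i * ω₁ + j * ω₂ + Quotient.out x) - B) := by
      rw [Finset.sum_sub_distrib, hsum]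
      simp [hcard]
    rw [this]
    refine (Finset.abs_sum_le_sum_abs _ _).trans ((Finset.sum_le_sum fun x _ => hx x).trans ?_)
    simp [hcard]
  have h6 : B - L ^ 2 * ((∑ x : R ⧸ I, F (Quotient.out x)) / Ideal.absNorm I) =
      -(L ^ 2 * ∑ x : R ⧸ I, F (Quotient.out x) - Ideal.absNorm I * B) / Ideal.absNorm I := by
    field_simp
    ring
  rw [h6, abs_div, abs_neg, abs_of_pos hpos, div_le_iff₀ hpos]
  linarith

end Box

section Sieve

variable {R : Type*} [CommRing R] [IsDedekindDomain R] [Module.Free ℤ R]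

/-- The density ratio `ν / (1 - ν)` at a prime ideal, where `ν` is the inverse of its norm. -/
noncomputable def sieveRatio (p : Ideal R) : ℝ := ((Ideal.absNorm p : ℝ) - 1)⁻¹

/-- The multiplicative extension of `sieveRatio` to squarefree ideals, given as sets of primes. -/
noncomputable def sieveTerm (d : Finset (Ideal R)) : ℝ := ∏ p ∈ d, sieveRatio p

open Classical in
/-- The components of the Selberg weights: these are orthogonal functions on `R` which are constant
on the elements lying in none of the primes in `d`. -/
noncomputable def sieveWeight (d : Finset (Ideal R)) (y : R) : ℝ :=
  ∏ p ∈ d, if y ∈ p then -1 else sieveRatio p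

theorem sieveWeight_congr {d : Finset (Ideal R)} {I : Ideal R} (hI : ∀ p ∈ d, I ≤ p) {a b : R}
    (hab : a - b ∈ I) : sieveWeight d a = sieveWeight d b := by
  unfold sieveWeight
  refine Finset.prod_congr rfl fun p hp => ?_
  have : a ∈ p ↔ b ∈ p := by
    have h := hI p hp hab
    exact ⟨fun ha => by simpa using p.sub_mem ha h, fun hb => by simpa using p.add_mem h hb⟩
  by_cases hb : b ∈ p
  · rw [if_pos hb, if_pos (this.2 hb)]
  · rw [if_neg hb, if_neg fun ha => hb (this.1 ha)]

variable [Module.Finite ℤ R]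

theorem two_le_absNorm {p : Ideal R} (hp : p.IsPrime ∧ p ≠ ⊥) : 2 ≤ Ideal.absNorm p := by
  have h0 : Ideal.absNorm p ≠ 0 := by rw [Ne, Ideal.absNorm_eq_zero_iff]; exact hp.2
  have h1 : Ideal.absNorm p ≠ 1 := by rw [Ne, Ideal.absNorm_eq_one_iff]; exact hp.1.ne_top
  omega

theorem sieveRatio_pos {p : Ideal R} (hp : p.IsPrime ∧ p ≠ ⊥) : 0 < sieveRatio p := by
  have : (2 : ℝ) ≤ Ideal.absNorm p := by exact_mod_cast two_le_absNorm hp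
  exact inv_pos.2 (by linarith)

theorem sieveRatio_le_one {p : Ideal R} (hp : p.IsPrime ∧ p ≠ ⊥) : sieveRatio p ≤ 1 := by
  have : (2 : ℝ) ≤ Ideal.absNorm p := by exact_mod_cast two_le_absNorm hp
  exact inv_le_one_of_one_le₀ (by linarith)

theorem abs_sieveWeight_le_one {d : Finset (Ideal R)} (hd : ∀ p ∈ d, p.IsPrime ∧ p ≠ ⊥) (y : R) :
    |sieveWeight d y| ≤ 1 := by
  rw [sieveWeight, Finset.abs_prod]
  refine Finset.prod_le_one (fun _ _ => abs_nonneg _) fun p hp => ?_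
  split_ifs
  · simp
  · rw [abs_of_pos (sieveRatio_pos (hd p hp))]
    exact sieveRatio_le_one (hd p hp)

open Classical in
theorem sum_sieveWeight_mul {d e : Finset (Ideal R)} (hd : ∀ p ∈ d, p.IsPrime ∧ p ≠ ⊥)
    (he : ∀ p ∈ e, p.IsPrime ∧ p ≠ ⊥) {I : Ideal R} (hI : ∀ p ∈ d ∪ e, I ≤ p)
    [Fintype (R ⧸ I)] :
    ∑ x : R ⧸ I, sieveWeight d (Quotient.out x) * sieveWeight e (Quotient.out x) =
      Ideal.absNorm I * if d = e then sieveTerm d else 0 := by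
  have hde : ∀ p ∈ d ∪ e, p.IsPrime ∧ p ≠ ⊥ := fun p hp =>
    (Finset.mem_union.1 hp).elim (hd p) (he p)
  let u : Ideal R → ℝ := fun p => (if p ∈ d then -1 else 1) * (if p ∈ e then -1 else 1)
  let v : Ideal R → ℝ := fun p => (if p ∈ d then sieveRatio p else 1) *
    (if p ∈ e then sieveRatio p else 1)
  have h1 : ∀ y : R, sieveWeight d y * sieveWeight e y =
      ∏ p ∈ d ∪ e, if y ∈ p then u p else v p := by
    intro y
    have ext : ∀ s ⊆ d ∪ e, sieveWeight s y =
        ∏ p ∈ d ∪ e, if p ∈ s then (if y ∈ p then -1 else sieveRatio p) else 1 := by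
      intro s hs
      rw [Finset.prod_ite_mem, Finset.inter_eq_right.2 hs]
      rfl
    rw [ext d Finset.subset_union_left, ext e Finset.subset_union_right,
      ← Finset.prod_mul_distrib]
    refine Finset.prod_congr rfl fun p _ => ?_
    by_cases h1 : p ∈ d <;> by_cases h2 : p ∈ e <;> by_cases h3 : y ∈ p <;> simp [u, v, h1, h2, h3]
  simp_rw [h1]
  rw [sum_quotient_prod_primes hde hI]
  congr 1
  have hN : ∀ p ∈ d ∪ e, (Ideal.absNorm p : ℝ) ≠ 0 ∧ (Ideal.absNorm p : ℝ) - 1 ≠ 0 := by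
    intro p hp
    have : (2 : ℝ) ≤ Ideal.absNorm p := by exact_mod_cast two_le_absNorm (hde p hp)
    constructor <;> linarith
  split_ifs with h
  · subst h
    rw [Finset.union_self] at hN ⊢
    refine Finset.prod_congr rfl fun p hp => ?_
    obtain ⟨hN1, hN2⟩ := hN p hp
    simp only [u, v, hp, if_true, sieveRatio]
    field_simp
    ring
  · obtain ⟨p, hp⟩ : ∃ p, (p ∈ d ∧ p ∉ e) ∨ (p ∈ e ∧ p ∉ d) := by
      by_contra! hcon
      exact h (Finset.ext fun p => ⟨(hcon p).1, (hcon p).2⟩)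
    have hpu : p ∈ d ∪ e := by
      rw [Finset.mem_union]; tauto
    refine Finset.prod_eq_zero hpu ?_
    obtain ⟨hN1, hN2⟩ := hN p hpu
    rcases hp with ⟨h1, h2⟩ | ⟨h1, h2⟩ <;>
    · simp only [u, v, h1, h2, if_true, if_false, sieveRatio]
      field_simp
      ring

open Classical in
theorem prod_absNorm_union_le {d e : Finset (Ideal R)} (hd : ∀ p ∈ d, p.IsPrime ∧ p ≠ ⊥) :
    ∏ p ∈ d ∪ e, Ideal.absNorm p ≤ (∏ p ∈ d, Ideal.absNorm p) * ∏ p ∈ e, Ideal.absNorm p := by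
  rw [← Finset.prod_union_inter]
  refine Nat.le_mul_of_pos_right _ (Finset.prod_pos fun p hp => ?_)
  have := two_le_absNorm (hd p (Finset.mem_inter.1 hp).1)
  omega

open Classical in
theorem sum_box_sieveWeight_mul_le {ω₁ ω₂ : R} (hω : ∀ r : R, ∃ a b : ℤ, r = a * ω₁ + b * ω₂)
    {d e : Finset (Ideal R)} (hd : ∀ p ∈ d, p.IsPrime ∧ p ≠ ⊥)
    (he : ∀ p ∈ e, p.IsPrime ∧ p ≠ ⊥) {z : ℕ} (hdz : ∏ p ∈ d, Ideal.absNorm p ≤ z)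
    (hez : ∏ p ∈ e, Ideal.absNorm p ≤ z) {m : R} (hm : ∀ p ∈ d ∪ e, m ∉ p) (α r : R) (L : ℕ) :
    ∑ i ∈ Finset.range L, ∑ j ∈ Finset.range L,
      sieveWeight d (α + m * (r + i * ω₁ + j * ω₂)) *
        sieveWeight e (α + m * (r + i * ω₁ + j * ω₂)) ≤
      L ^ 2 * (if d = e then sieveTerm d else 0) + 4 * z ^ 2 * L := by
  have hde : ∀ p ∈ d ∪ e, p.IsPrime ∧ p ≠ ⊥ := fun p hp =>
    (Finset.mem_union.1 hp).elim (hd p) (he p)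
  set I : Ideal R := ∏ p ∈ d ∪ e, p with hI
  have hIp : ∀ p ∈ d ∪ e, I ≤ p := fun p hp => Ideal.le_of_dvd (Finset.dvd_prod_of_mem _ hp)
  have hI0 : I ≠ ⊥ := by
    rw [hI, ← Ideal.zero_eq_bot, Finset.prod_ne_zero_iff]
    exact fun p hp => (hde p hp).2
  have hIN : Ideal.absNorm I ≤ z ^ 2 := by
    rw [hI, map_prod, sq]
    exact (prod_absNorm_union_le hd).trans (Nat.mul_le_mul hdz hez)
  have hfin : Finite (R ⧸ I) := by
    rw [← Ideal.absNorm_ne_zero_iff, Ne, Ideal.absNorm_eq_zero_iff]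
    exact hI0
  have := Fintype.ofFinite (R ⧸ I)
  have hcop : IsUnit (Ideal.Quotient.mk I m) := by
    have : IsCoprime (Ideal.span {m}) I := by
      rw [hI]
      refine IsCoprime.prod_right fun p hp => ?_
      have := (hde p hp).1.isMaximal (hde p hp).2
      rw [Ideal.isCoprime_iff_sup_eq, sup_comm]
      exact this.1.2 _ (lt_of_le_of_ne le_sup_left fun h => hm p hp (by
        rw [h]; exact Ideal.mem_sup_right (Ideal.mem_span_singleton_self m)))
    rw [Ideal.isCoprime_iff_exists] at this
    obtain ⟨a, ha, b, hb, hab⟩ := this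
    obtain ⟨c, rfl⟩ := Ideal.mem_span_singleton'.1 ha
    refine IsUnit.of_mul_eq_one (Ideal.Quotient.mk I c) ?_
    rw [← map_mul, ← map_one (Ideal.Quotient.mk I), Ideal.Quotient.eq, ← hab]
    have : m * c - (c * m + b) = -b := by ring
    rw [this]
    exact I.neg_mem hb
  let F₀ : R → ℝ := fun y => sieveWeight d y * sieveWeight e y
  have hper₀ : ∀ a b, a - b ∈ I → F₀ a = F₀ b := fun a b hab => by
    simp only [F₀]
    rw [sieveWeight_congr (fun p hp => hIp p (Finset.mem_union_left _ hp)) hab,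
      sieveWeight_congr (fun p hp => hIp p (Finset.mem_union_right _ hp)) hab]
  have hper₁ : ∀ a b, a - b ∈ I → F₀ (α + a) = F₀ (α + b) := fun a b hab =>
    hper₀ _ _ (by rwa [add_sub_add_left_eq_sub])
  have hper : ∀ a b, a - b ∈ I → F₀ (α + m * a) = F₀ (α + m * b) := fun a b hab =>
    hper₁ _ _ (by rw [← mul_sub]; exact I.mul_mem_left _ hab)
  have hF : ∀ a, |F₀ a| ≤ 1 := fun a => by
    rw [abs_mul]
    exact mul_le_one₀ (abs_sieveWeight_le_one hd _) (abs_nonneg _) (abs_sieveWeight_le_one he _)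
  have key := abs_sum_box_sub_average_le hω (I := I) (F := fun y => F₀ (α + m * y))
    (fun _ => hF _) hper r L
  have hmean : ∑ x : R ⧸ I, F₀ (α + m * Quotient.out x) =
      Ideal.absNorm I * if d = e then sieveTerm d else 0 := by
    rw [sum_quotient_out_mul (F := fun y => F₀ (α + y)) hper₁ hcop, sum_quotient_out_add hper₀]
    exact sum_sieveWeight_mul hd he hIp
  rw [hmean] at key
  have hN0 : (Ideal.absNorm I : ℝ) ≠ 0 := by
    rw [Nat.cast_ne_zero, Ne, Ideal.absNorm_eq_zero_iff]
    exact hI0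
  rw [mul_div_cancel_left₀ _ hN0] at key
  have h1 := (abs_le.1 key).2
  have h2 : (Ideal.absNorm I : ℝ) ≤ z ^ 2 := by exact_mod_cast hIN
  have h3 : 4 * (Ideal.absNorm I : ℝ) * L ≤ 4 * z ^ 2 * L := by gcongr
  simp only [F₀] at h1
  linarith

/-- Selberg's upper bound sieve for the values of `α + m * γ`, with `γ` in a box. -/
theorem selberg_sieve_box {ω₁ ω₂ : R} (hω : ∀ r : R, ∃ a b : ℤ, r = a * ω₁ + b * ω₂)
    {D : Finset (Finset (Ideal R))} (hD : ∀ d ∈ D, ∀ p ∈ d, p.IsPrime ∧ p ≠ ⊥) {z : ℕ}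
    (hz : ∀ d ∈ D, ∏ p ∈ d, Ideal.absNorm p ≤ z) {m : R} (hm : ∀ d ∈ D, ∀ p ∈ d, m ∉ p)
    (α r : R) (L : ℕ) {S : Finset (ℕ × ℕ)} (hS : S ⊆ Finset.range L ×ˢ Finset.range L)
    (hsift : ∀ s ∈ S, ∀ d ∈ D, ∀ p ∈ d, α + m * (r + s.1 * ω₁ + s.2 * ω₂) ∉ p) :
    (∑ d ∈ D, sieveTerm d) ^ 2 * S.card ≤
      L ^ 2 * ∑ d ∈ D, sieveTerm d + (D.card : ℝ) ^ 2 * (4 * z ^ 2 * L) := by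
  classical
  let W : ℕ × ℕ → ℝ := fun s => ∑ d ∈ D, sieveWeight d (α + m * (r + s.1 * ω₁ + s.2 * ω₂))
  have h1 : ∀ s ∈ S, W s = ∑ d ∈ D, sieveTerm d := by
    intro s hs
    refine Finset.sum_congr rfl fun d hd => Finset.prod_congr rfl fun p hp => ?_
    rw [if_neg (hsift s hs d hd p hp)]
  calc (∑ d ∈ D, sieveTerm d) ^ 2 * S.card = ∑ s ∈ S, W s ^ 2 := by
        rw [Finset.sum_congr (s₁ := S) rfl fun s hs => congrArg (· ^ 2) (h1 s hs),
          Finset.sum_const, nsmul_eq_mul, mul_comm]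
    _ ≤ ∑ s ∈ Finset.range L ×ˢ Finset.range L, W s ^ 2 :=
        Finset.sum_le_sum_of_subset_of_nonneg hS fun _ _ _ => sq_nonneg _
    _ = ∑ d ∈ D, ∑ e ∈ D, ∑ i ∈ Finset.range L, ∑ j ∈ Finset.range L,
          sieveWeight d (α + m * (r + i * ω₁ + j * ω₂)) *
            sieveWeight e (α + m * (r + i * ω₁ + j * ω₂)) := by
        simp_rw [W, sq, Finset.sum_mul_sum]
        rw [Finset.sum_comm]
        refine Finset.sum_congr rfl fun d _ => ?_
        rw [Finset.sum_comm]
        refine Finset.sum_congr rfl fun e _ => ?_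
        rw [Finset.sum_product]
    _ ≤ ∑ d ∈ D, ∑ e ∈ D, (L ^ 2 * (if d = e then sieveTerm d else 0) + 4 * z ^ 2 * L) := by
        refine Finset.sum_le_sum fun d hd => Finset.sum_le_sum fun e he => ?_
        refine sum_box_sieveWeight_mul_le hω (hD d hd) (hD e he) (hz d hd) (hz e he) ?_ α r L
        intro p hp
        exact (Finset.mem_union.1 hp).elim (hm d hd p) (hm e he p)
    _ = _ := by
        simp only [Finset.sum_add_distrib, ← Finset.mul_sum, Finset.sum_ite_eq,
          Finset.sum_const, nsmul_eq_mul]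
        rw [Finset.sum_congr rfl fun d hd => if_pos hd]
        ring

end Sieve

section LowerBound

open UniqueFactorizationMonoid

variable {R : Type*} [CommRing R] [IsDedekindDomain R]

theorem finset_primes_prod_injOn :
    Set.InjOn (fun d : Finset (Ideal R) => ∏ p ∈ d, p)
      {d | ∀ p ∈ d, p.IsPrime ∧ p ≠ ⊥} := by
  classical
  have h : ∀ d : Finset (Ideal R), (∀ p ∈ d, p.IsPrime ∧ p ≠ ⊥) →
      normalizedFactors (∏ p ∈ d, p) = d.val := by
    intro d hd
    have := normalizedFactors_prod_of_prime (m := d.val)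
      fun p hp => Ideal.prime_of_isPrime (hd p hp).2 (hd p hp).1
    rw [Finset.prod_val] at this
    exact this
  intro d hd e he hde
  rw [← Finset.val_inj, ← h d hd, ← h e he]
  exact congrArg _ hde

variable [Module.Free ℤ R]

/-- Squarefree ideals of norm at most `z` coprime to `m`, given as sets of primes. -/
def sieveSupport (m : R) (z : ℕ) : Set (Finset (Ideal R)) :=
  {d | (∀ p ∈ d, p.IsPrime ∧ p ≠ ⊥) ∧ (∀ p ∈ d, m ∉ p) ∧ ∏ p ∈ d, Ideal.absNorm p ≤ z}

theorem sieveSupport_mapsTo (m : R) (z : ℕ) :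
    Set.MapsTo (fun d : Finset (Ideal R) => ∏ p ∈ d, p) (sieveSupport m z)
      {I | Ideal.absNorm I ≤ z} := fun d hd => by
  simpa [map_prod] using hd.2.2

theorem geom_sum_range_le {x : ℝ} (hx0 : 0 ≤ x) (hx1 : x < 1) (n : ℕ) :
    ∑ k ∈ Finset.range n, x ^ k ≤ (1 - x)⁻¹ := by
  rw [← one_div, le_div_iff₀ (by linarith), mul_comm, mul_neg_geom_sum]
  linarith [pow_nonneg hx0 n]

variable [Module.Finite ℤ R]

open Classical in
/-- Nonzero ideals are determined by their exponents, so a sum over ideals with given support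
is bounded by a product of geometric series. -/
theorem sum_inv_absNorm_le_of_support {d Q : Finset (Ideal R)}
    (hd : ∀ p ∈ d, p.IsPrime ∧ p ≠ ⊥) (hQ : ∀ p ∈ Q, p.IsPrime ∧ p ≠ ⊥) (hdQ : Disjoint d Q)
    (A : Finset (Ideal R)) (hA : ∀ a ∈ A, a ≠ ⊥)
    (hsupp : ∀ a ∈ A, (normalizedFactors a).toFinset \ Q = d) :
    ∑ a ∈ A, (Ideal.absNorm a : ℝ)⁻¹ ≤
      sieveTerm d * ∏ p ∈ Q, (1 - (Ideal.absNorm p : ℝ)⁻¹)⁻¹ := by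
  set k : ℕ := A.sup fun a => (normalizedFactors a).card with hk
  let t : Ideal R → Finset ℕ := fun p => if p ∈ Q then Finset.range (k + 1) else Finset.Icc 1 k
  let φ : Ideal R → ∀ p ∈ d ∪ Q, ℕ := fun a p _ => (normalizedFactors a).count p
  have hsub : ∀ a ∈ A, (normalizedFactors a).toFinset ⊆ d ∪ Q := by
    intro a ha p hp
    by_cases hpQ : p ∈ Q
    · exact Finset.mem_union_right _ hpQ
    · exact Finset.mem_union_left _ (hsupp a ha ▸ Finset.mem_sdiff.2 ⟨hp, hpQ⟩)
  have hprod : ∀ a ∈ A, a = ∏ p ∈ d ∪ Q, p ^ (normalizedFactors a).count p := by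
    intro a ha
    conv_lhs => rw [← Ideal.prod_normalizedFactors_eq_self (hA a ha)]
    exact Finset.prod_multiset_count_of_subset _ _ (hsub a ha)
  have hmem : ∀ a ∈ A, φ a ∈ (d ∪ Q).pi t := by
    intro a ha
    rw [Finset.mem_pi]
    intro p hp
    have hle : (normalizedFactors a).count p ≤ k :=
      (Multiset.count_le_card p _).trans
        (Finset.le_sup (f := fun a => (normalizedFactors a).card) ha)
    by_cases hpQ : p ∈ Q
    · simp only [φ, t, hpQ, if_true, Finset.mem_range]
      omega
    · simp only [φ, t, hpQ, if_false, Finset.mem_Icc]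
      refine ⟨Multiset.one_le_count_iff_mem.2 ?_, hle⟩
      have hpd : p ∈ d := (Finset.mem_union.1 hp).resolve_right hpQ
      rw [← hsupp a ha] at hpd
      exact Multiset.mem_toFinset.1 (Finset.mem_sdiff.1 hpd).1
  have hinj : Set.InjOn φ A := by
    intro a ha b hb hab
    rw [hprod a ha, hprod b hb]
    refine Finset.prod_congr rfl fun p hp => ?_
    congr 1
    exact congrFun (congrFun hab p) hp
  have hval : ∀ a ∈ A, (Ideal.absNorm a : ℝ)⁻¹ =
      ∏ x ∈ (d ∪ Q).attach, ((Ideal.absNorm x.1 : ℝ)⁻¹) ^ (φ a x.1 x.2) := by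
    intro a ha
    conv_lhs => rw [hprod a ha]
    rw [Finset.prod_attach (d ∪ Q)
      (fun p => ((Ideal.absNorm p : ℝ)⁻¹) ^ ((normalizedFactors a).count p)), map_prod,
      Nat.cast_prod, ← Finset.prod_inv_distrib]
    simp
  have hN : ∀ p : Ideal R, (p.IsPrime ∧ p ≠ ⊥) → (2 : ℝ) ≤ Ideal.absNorm p := fun p hp => by
    exact_mod_cast two_le_absNorm hp
  have hinv : ∀ p : Ideal R, (p.IsPrime ∧ p ≠ ⊥) → (Ideal.absNorm p : ℝ)⁻¹ < 1 := fun p hp =>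
    inv_lt_one_of_one_lt₀ (by linarith [hN p hp])
  calc ∑ a ∈ A, (Ideal.absNorm a : ℝ)⁻¹
      = ∑ g ∈ A.image φ, ∏ x ∈ (d ∪ Q).attach, ((Ideal.absNorm x.1 : ℝ)⁻¹) ^ (g x.1 x.2) := by
        rw [Finset.sum_image hinj]
        exact Finset.sum_congr rfl hval
    _ ≤ ∑ g ∈ (d ∪ Q).pi t, ∏ x ∈ (d ∪ Q).attach, ((Ideal.absNorm x.1 : ℝ)⁻¹) ^ (g x.1 x.2) := by
        refine Finset.sum_le_sum_of_subset_of_nonneg (Finset.image_subset_iff.2 hmem) ?_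
        intro g _ _
        positivity
    _ = ∏ p ∈ d ∪ Q, ∑ j ∈ t p, ((Ideal.absNorm p : ℝ)⁻¹) ^ j := by
        rw [Finset.prod_sum]
    _ = (∏ p ∈ d, ∑ j ∈ t p, ((Ideal.absNorm p : ℝ)⁻¹) ^ j) *
          ∏ p ∈ Q, ∑ j ∈ t p, ((Ideal.absNorm p : ℝ)⁻¹) ^ j := Finset.prod_union hdQ
    _ ≤ _ := by
        refine mul_le_mul ?_ ?_ ?_ ?_
        · refine Finset.prod_le_prod (fun p _ => by positivity) fun p hp => ?_
          have hpQ : p ∉ Q := Finset.disjoint_left.1 hdQ hp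
          simp only [t, hpQ, if_false]
          have h1 : ∑ j ∈ Finset.Icc 1 k, ((Ideal.absNorm p : ℝ)⁻¹) ^ j =
              (Ideal.absNorm p : ℝ)⁻¹ * ∑ j ∈ Finset.range k, ((Ideal.absNorm p : ℝ)⁻¹) ^ j := by
            rw [← Finset.Ico_add_one_right_eq_Icc, Finset.sum_Ico_eq_sum_range, Finset.mul_sum]
            refine Finset.sum_congr (by simp) fun j _ => ?_
            rw [pow_add, pow_one]
          have h2 := hN p (hd p hp)
          have h3 := geom_sum_range_le (x := (Ideal.absNorm p : ℝ)⁻¹) (by positivity)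
            (hinv p (hd p hp)) k
          rw [h1, sieveRatio]
          refine (mul_le_mul_of_nonneg_left h3 (by positivity)).trans_eq ?_
          rw [← mul_inv, mul_sub, mul_inv_cancel₀ (by linarith), mul_one]
        · refine Finset.prod_le_prod (fun p _ => by positivity) fun p hp => ?_
          simp only [t, hp, if_true]
          exact geom_sum_range_le (by positivity) (hinv p (hQ p hp)) _
        · exact Finset.prod_nonneg fun p _ => by positivity
        · exact Finset.prod_nonneg fun p hp => (sieveRatio_pos (hd p hp)).le

open Classical in
theorem card_units_quotient_le {m : R} (hm : m ≠ 0) :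
    (Nat.card (R ⧸ Ideal.span {m})ˣ : ℝ) ≤ Ideal.absNorm (Ideal.span {m}) *
      ∏ p ∈ (normalizedFactors (Ideal.span {m})).toFinset, (1 - (Ideal.absNorm p : ℝ)⁻¹) := by
  set I := Ideal.span {m} with hI
  set Q := (normalizedFactors I).toFinset with hQ
  have hI0 : I ≠ ⊥ := by rwa [hI, Ne, Ideal.span_singleton_eq_bot]
  have hfin : Finite (R ⧸ I) := by
    rw [← Ideal.absNorm_ne_zero_iff, Ne, Ideal.absNorm_eq_zero_iff]
    exact hI0
  have := Fintype.ofFinite (R ⧸ I)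
  have hQp : ∀ p ∈ Q, (p.IsPrime ∧ p ≠ ⊥) ∧ I ≤ p := by
    intro p hp
    rw [hQ, Multiset.mem_toFinset] at hp
    have h1 := prime_of_normalized_factor p hp
    exact ⟨⟨Ideal.isPrime_of_prime h1, h1.ne_zero⟩, Ideal.le_of_dvd (dvd_of_mem_normalizedFactors hp)⟩
  have key := sum_quotient_prod_primes (T := Q) (fun p hp => (hQp p hp).1)
    (fun p hp => (hQp p hp).2) (fun _ => 0) (fun _ => 1)
  have hrw : ∏ p ∈ Q, (1 - (Ideal.absNorm p : ℝ)⁻¹) =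
      ∏ p ∈ Q, ((0 - 1) / (Ideal.absNorm p : ℝ) + 1) :=
    Finset.prod_congr rfl fun p _ => by ring
  rw [hrw, ← key]
  have hcard : (Nat.card (R ⧸ I)ˣ : ℝ) =
      ∑ x ∈ Finset.univ.image (Units.val : (R ⧸ I)ˣ → R ⧸ I), (1 : ℝ) := by
    rw [Finset.sum_const, nsmul_eq_mul, mul_one, Finset.card_image_of_injective _ Units.val_injective,
      Finset.card_univ, Nat.card_eq_fintype_card]
  have hnn : ∀ x : R ⧸ I, 0 ≤ ∏ p ∈ Q, (if Quotient.out x ∈ p then (0 : ℝ) else 1) := fun x =>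
    Finset.prod_nonneg fun p _ => by split_ifs <;> norm_num
  rw [hcard]
  refine (Finset.sum_le_sum fun x hx => ?_).trans
    (Finset.sum_le_sum_of_subset_of_nonneg (Finset.subset_univ _) fun x _ _ => hnn x)
  obtain ⟨w, -, rfl⟩ := Finset.mem_image.1 hx
  refine le_of_eq (Finset.prod_eq_one fun p hp => if_neg fun hmem => ?_).symm
  have h1 : Ideal.Quotient.mk I (Quotient.out (w : R ⧸ I)) = w := Quotient.out_eq _
  have h2 : (w : R ⧸ I) ∈ p.map (Ideal.Quotient.mk I) := by
    rw [← h1]; exact Ideal.mem_map_of_mem _ hmem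
  have h3 := Ideal.eq_top_of_isUnit_mem _ h2 w.isUnit
  have h4 := Ideal.mem_quotient_iff_mem (hQp p hp).2 (x := (1 : R))
  rw [h3] at h4
  exact (hQp p hp).1.1.ne_top ((Ideal.eq_top_iff_one p).2 (h4.1 trivial))

variable [CharZero R]

theorem sieveSupport_finite (m : R) (z : ℕ) : (sieveSupport m z).Finite :=
  Set.Finite.of_injOn (sieveSupport_mapsTo m z) (finset_primes_prod_injOn.mono fun _ hd => hd.1)
    (Ideal.finite_setOfPred_absNorm_le z)

theorem card_sieveSupport_le (m : R) (z : ℕ) :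
    (sieveSupport_finite m z).toFinset.card ≤ Nat.card {I : Ideal R // Ideal.absNorm I ≤ z} := by
  rw [← Set.ncard_eq_toFinset_card _ (sieveSupport_finite m z)]
  exact Set.ncard_le_ncard_of_injOn _ (sieveSupport_mapsTo m z)
    (finset_primes_prod_injOn.mono fun _ hd => hd.1) (Ideal.finite_setOfPred_absNorm_le z)

/-- The nonzero ideals of norm at most `z`. -/
noncomputable def idealsNormLE (R : Type*) [CommRing R] [IsDedekindDomain R] [Module.Free ℤ R]
    [Module.Finite ℤ R] [CharZero R] (z : ℕ) : Finset (Ideal R) :=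
  ((Ideal.finite_setOfPred_absNorm_le z).subset fun _ h => h.2 :
    {I : Ideal R | I ≠ ⊥ ∧ Ideal.absNorm I ≤ z}.Finite).toFinset

theorem mem_idealsNormLE {z : ℕ} {I : Ideal R} :
    I ∈ idealsNormLE R z ↔ I ≠ ⊥ ∧ Ideal.absNorm I ≤ z := by
  simp [idealsNormLE]

theorem card_units_mul_sum_inv_absNorm_le {m : R} (hm : m ≠ 0) (z : ℕ) :
    (Nat.card (R ⧸ Ideal.span {m})ˣ : ℝ) * ∑ a ∈ idealsNormLE R z, (Ideal.absNorm a : ℝ)⁻¹ ≤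
      Ideal.absNorm (Ideal.span {m}) *
        ∑ d ∈ (sieveSupport_finite m z).toFinset, sieveTerm d := by
  classical
  set I := Ideal.span {m} with hI
  set Q := (normalizedFactors I).toFinset with hQ
  have hI0 : I ≠ ⊥ := by rwa [hI, Ne, Ideal.span_singleton_eq_bot]
  have hQp : ∀ p ∈ Q, p.IsPrime ∧ p ≠ ⊥ := by
    intro p hp
    have h1 := prime_of_normalized_factor p (Multiset.mem_toFinset.1 hp)
    exact ⟨Ideal.isPrime_of_prime h1, h1.ne_zero⟩
  have hmQ : ∀ p : Ideal R, p.IsPrime ∧ p ≠ ⊥ → (m ∈ p ↔ p ∈ Q) := by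
    intro p hp
    rw [hQ, Multiset.mem_toFinset, Ideal.mem_normalizedFactors_iff hI0, hI,
      Ideal.span_singleton_le_iff_mem]
    exact ⟨fun h => ⟨hp.1, h⟩, fun h => h.2⟩
  have hmaps : ∀ a ∈ idealsNormLE R z,
      (normalizedFactors a).toFinset \ Q ∈ (sieveSupport_finite m z).toFinset := by
    intro a ha
    rw [mem_idealsNormLE] at ha
    rw [Set.Finite.mem_toFinset]
    have hpr : ∀ p ∈ (normalizedFactors a).toFinset \ Q, p.IsPrime ∧ p ≠ ⊥ := by
      intro p hp
      have h1 := prime_of_normalized_factor p (Multiset.mem_toFinset.1 (Finset.mem_sdiff.1 hp).1)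
      exact ⟨Ideal.isPrime_of_prime h1, h1.ne_zero⟩
    refine ⟨hpr, fun p hp hmp => (Finset.mem_sdiff.1 hp).2 ((hmQ p (hpr p hp)).1 hmp), ?_⟩
    rw [← map_prod]
    refine (Nat.le_of_dvd (Nat.pos_of_ne_zero ?_) ?_).trans ha.2
    · rw [Ne, Ideal.absNorm_eq_zero_iff]; exact ha.1
    · refine Ideal.absNorm_dvd_absNorm_of_le (Ideal.le_of_dvd ?_)
      conv_rhs => rw [← Ideal.prod_normalizedFactors_eq_self ha.1]
      rw [show ∏ p ∈ (normalizedFactors a).toFinset \ Q, p =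
        ((normalizedFactors a).toFinset \ Q).val.prod from (Finset.prod_val _).symm]
      refine Multiset.prod_dvd_prod_of_le (le_trans ?_ (Multiset.dedup_le _))
      rw [← Multiset.toFinset_val]
      exact Finset.val_le_iff.2 Finset.sdiff_subset
  have hprodpos : ∀ p ∈ Q, 0 < 1 - (Ideal.absNorm p : ℝ)⁻¹ := by
    intro p hp
    have : (2 : ℝ) ≤ Ideal.absNorm p := by exact_mod_cast two_le_absNorm (hQp p hp)
    have := inv_lt_one_of_one_lt₀ (show (1 : ℝ) < Ideal.absNorm p by linarith)
    linarith
  have hsum : ∑ a ∈ idealsNormLE R z, (Ideal.absNorm a : ℝ)⁻¹ ≤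
      (∑ d ∈ (sieveSupport_finite m z).toFinset, sieveTerm d) *
        ∏ p ∈ Q, (1 - (Ideal.absNorm p : ℝ)⁻¹)⁻¹ := by
    rw [← Finset.sum_fiberwise_of_maps_to hmaps, Finset.sum_mul]
    refine Finset.sum_le_sum fun d hd => ?_
    rw [Set.Finite.mem_toFinset] at hd
    refine sum_inv_absNorm_le_of_support hd.1 hQp ?_ _ ?_ ?_
    · exact Finset.disjoint_left.2 fun p hp hpQ =>
        hd.2.1 p hp ((hmQ p (hd.1 p hp)).2 hpQ)
    · exact fun a ha => (mem_idealsNormLE.1 (Finset.mem_filter.1 ha).1).1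
    · exact fun a ha => (Finset.mem_filter.1 ha).2
  have hG : 0 ≤ ∑ d ∈ (sieveSupport_finite m z).toFinset, sieveTerm d :=
    Finset.sum_nonneg fun d hd => Finset.prod_nonneg fun p hp =>
      (sieveRatio_pos (((Set.Finite.mem_toFinset _).1 hd).1 p hp)).le
  have hsum0 : 0 ≤ ∑ a ∈ idealsNormLE R z, (Ideal.absNorm a : ℝ)⁻¹ :=
    Finset.sum_nonneg fun _ _ => by positivity
  have hP : 0 < ∏ p ∈ Q, (1 - (Ideal.absNorm p : ℝ)⁻¹) := Finset.prod_pos hprodpos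
  have hunits := card_units_quotient_le hm
  rw [← hI, ← hQ] at hunits
  refine (mul_le_mul hunits hsum hsum0 (by positivity)).trans_eq ?_
  rw [Finset.prod_inv_distrib, mul_mul_mul_comm, mul_inv_cancel₀ hP.ne', mul_one]

end LowerBound

section IdealCount

open NumberField.InfinitePlace NumberField.Units in
/-- The number of ideals of norm at most `n` has exact order `n`. -/
theorem exists_card_absNorm_le_bounds (K : Type*) [Field K] [NumberField K] :
    ∃ c C : ℝ, 0 < c ∧ 0 < C ∧ ∀ n : ℕ, 1 ≤ n →
      c * n ≤ (idealsNormLE (𝓞 K) n).card ∧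
      (Nat.card {I : Ideal (𝓞 K) // Ideal.absNorm I ≤ n} : ℝ) ≤ C * n := by
  have hlim := (NumberField.Ideal.tendsto_norm_le_div_atTop K).comp tendsto_natCast_atTop_atTop
  set κ : ℝ := 2 ^ nrRealPlaces K * (2 * Real.pi) ^ nrComplexPlaces K * regulator K *
    classNumber K / (torsionOrder K * Real.sqrt |discr K|) with hκ
  have hκ0 : 0 < κ := by
    have h1 := regulator_pos K
    have h2 : (0 : ℝ) < classNumber K := by
      exact_mod_cast Fintype.card_pos (α := ClassGroup (𝓞 K))
    have h3 : (0 : ℝ) < torsionOrder K := by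
      exact_mod_cast torsionOrder_pos K
    have h4 : (0 : ℝ) < Real.sqrt |discr K| :=
      Real.sqrt_pos.2 (by exact_mod_cast abs_pos.2 (discr_ne_zero K))
    positivity
  obtain ⟨C, hC⟩ := hlim.bddAbove_range
  obtain ⟨c, hc⟩ := (hlim.inv₀ hκ0.ne').bddAbove_range
  have hcard : ∀ n : ℕ, Nat.card {I : Ideal (𝓞 K) // Ideal.absNorm I ≤ n} =
      (idealsNormLE (𝓞 K) n).card + 1 := by
    intro n
    rw [Ideal.card_norm_le_eq_card_norm_le_add_one, add_left_inj, idealsNormLE,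
      ← Nat.card_eq_card_finite_toFinset, Nat.card_congr (Equiv.subtypeSubtypeEquivSubtypeInter
      (fun I : Ideal (𝓞 K) => I ∈ nonZeroDivisors (Ideal (𝓞 K))) fun I => Ideal.absNorm I ≤ n)]
    simp only [mem_nonZeroDivisors_iff_ne_zero]
    rfl
  have hone : ∀ n : ℕ, 1 ≤ n → 1 ≤ (idealsNormLE (𝓞 K) n).card := fun n hn =>
    Finset.card_pos.2 ⟨⊤, mem_idealsNormLE.2 ⟨top_ne_bot, by simpa using hn⟩⟩
  refine ⟨(2 * (|c| + 1))⁻¹, |C| + 1, by positivity, by positivity, fun n hn => ?_⟩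
  have hn0 : (0 : ℝ) < n := by exact_mod_cast hn
  have h1 := hC ⟨n, rfl⟩
  have h2 := hc ⟨n, rfl⟩
  simp only [Function.comp_apply, Nat.cast_le] at h1 h2
  have h3 : (1 : ℝ) ≤ (idealsNormLE (𝓞 K) n).card := by exact_mod_cast hone n hn
  constructor
  · rw [hcard, inv_div, div_le_iff₀ (by positivity)] at h2
    push_cast at h2
    rw [inv_mul_le_iff₀ (by positivity)]
    nlinarith [le_abs_self c, abs_nonneg c]
  · rw [div_le_iff₀ hn0] at h1
    nlinarith [le_abs_self C]

/-- Partial summation: a set of ideals of positive lower density has logarithmically large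
sum of inverse norms. -/
theorem le_sum_inv_absNorm {R : Type*} [CommRing R] [IsDedekindDomain R] [Module.Free ℤ R]
    [Module.Finite ℤ R] [CharZero R] {c : ℝ} (hc : 0 < c)
    (h : ∀ n : ℕ, 1 ≤ n → c * n ≤ (idealsNormLE R n).card) (z : ℕ) :
    c / 2 * Real.log (z + 1) ≤ ∑ a ∈ idealsNormLE R z, (Ideal.absNorm a : ℝ)⁻¹ := by
  have htel : ∀ a b : ℕ, a ≤ b + 1 → 1 ≤ a → ∑ n ∈ Finset.Icc a b, ((n : ℝ) * (n + 1))⁻¹ =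
      (a : ℝ)⁻¹ - ((b : ℝ) + 1)⁻¹ := by
    intro a b hab ha
    have ha0 : (a : ℝ) ≠ 0 := by positivity
    induction b with
    | zero =>
      obtain rfl : a = 1 := by omega
      simp
    | succ b ih =>
      rcases Nat.lt_or_ge (b + 1) a with h1 | h1
      · obtain rfl : a = b + 1 + 1 := by omega
        simp
      · rw [Finset.sum_Icc_succ_top h1, ih h1]
        push_cast
        field_simp
        ring
  have hpos : ∀ a : Ideal R, a ≠ ⊥ → 1 ≤ Ideal.absNorm a := fun a ha =>
    Nat.one_le_iff_ne_zero.2 fun h0 => ha (Ideal.absNorm_eq_zero_iff.1 h0)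
  have hmain : ∑ n ∈ Finset.Icc 1 z, ((n : ℝ) * (n + 1))⁻¹ * (idealsNormLE R n).card ≤
      ∑ a ∈ idealsNormLE R z, (Ideal.absNorm a : ℝ)⁻¹ := by
    calc ∑ n ∈ Finset.Icc 1 z, ((n : ℝ) * (n + 1))⁻¹ * (idealsNormLE R n).card
        = ∑ n ∈ Finset.Icc 1 z, ∑ _a ∈ idealsNormLE R n, ((n : ℝ) * (n + 1))⁻¹ :=
          Finset.sum_congr rfl fun n _ => by rw [Finset.sum_const, nsmul_eq_mul, mul_comm]
      _ = ∑ a ∈ idealsNormLE R z, ∑ n ∈ Finset.Icc (Ideal.absNorm a) z,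
            ((n : ℝ) * (n + 1))⁻¹ := by
          refine Finset.sum_comm' fun n a => ?_
          simp only [Finset.mem_Icc, mem_idealsNormLE]
          constructor
          · rintro ⟨⟨h1, h2⟩, h3, h4⟩
            exact ⟨⟨h4, h2⟩, h3, h4.trans h2⟩
          · rintro ⟨⟨h1, h2⟩, h3, h4⟩
            exact ⟨⟨(hpos a h3).trans h1, h2⟩, h3, h1⟩
      _ ≤ _ := by
          refine Finset.sum_le_sum fun a ha => ?_
          rw [mem_idealsNormLE] at ha
          rw [htel _ _ (by omega) (hpos a ha.1)]
          exact sub_le_self _ (by positivity)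
  refine le_trans ?_ hmain
  have hlog := log_add_one_le_harmonic z
  rw [harmonic_eq_sum_Icc] at hlog
  push_cast at hlog
  refine (mul_le_mul_of_nonneg_left hlog (by positivity)).trans ?_
  rw [Finset.mul_sum]
  refine Finset.sum_le_sum fun n hn => ?_
  have hn1 : 1 ≤ n := (Finset.mem_Icc.1 hn).1
  have hn' : (1 : ℝ) ≤ n := by exact_mod_cast hn1
  refine le_trans ?_ (mul_le_mul_of_nonneg_left (h n hn1) (by positivity))
  have : ((n : ℝ) * (n + 1))⁻¹ * (c * n) = c * ((n : ℝ) + 1)⁻¹ := by field_simp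
  rw [this, div_mul_eq_mul_div, mul_div_assoc]
  gcongr
  rw [div_eq_mul_inv, ← mul_inv]
  gcongr
  linarith

end IdealCount

section ImaginaryQuadratic

variable {K : Type*} [Field K] [NumberField K]

theorem norm_embedding_sq (hdeg : Module.finrank ℚ K = 2)
    (himag : ∀ v : InfinitePlace K, v.IsComplex)
    (σ : K →+* ℂ) (γ : 𝓞 K) : ‖σ γ‖ ^ 2 = Ideal.absNorm (Ideal.span {γ}) := by
  have hsub : Subsingleton (InfinitePlace K) := by
    rw [← Fintype.card_le_one_iff_subsingleton,
      InfinitePlace.card_eq_nrRealPlaces_add_nrComplexPlaces]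
    have h1 := InfinitePlace.card_add_two_mul_card_eq_rank K
    have h2 := nrRealPlaces_eq_zero_iff.2 ⟨himag⟩
    omega
  have hprod := InfinitePlace.prod_eq_abs_norm (γ : K)
  rw [Fintype.prod_subsingleton _ (InfinitePlace.mk σ), InfinitePlace.mult_isComplex
    ⟨_, himag (InfinitePlace.mk σ)⟩, InfinitePlace.apply] at hprod
  rw [hprod, Ideal.absNorm_span_singleton, ← Algebra.coe_norm_int, Nat.cast_natAbs]
  push_cast
  rfl

theorem norm_embedding (hdeg : Module.finrank ℚ K = 2)
    (himag : ∀ v : InfinitePlace K, v.IsComplex)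
    (σ : K →+* ℂ) (γ : 𝓞 K) : ‖σ γ‖ = Real.sqrt (Ideal.absNorm (Ideal.span {γ})) := by
  rw [← norm_embedding_sq hdeg himag σ, Real.sqrt_sq (norm_nonneg _)]

/-- The square root of the norm is subadditive. -/
theorem sqrt_absNorm_sub_le (hdeg : Module.finrank ℚ K = 2)
    (himag : ∀ v : InfinitePlace K, v.IsComplex) (γ δ : 𝓞 K) :
    Real.sqrt (Ideal.absNorm (Ideal.span {γ - δ})) ≤
      Real.sqrt (Ideal.absNorm (Ideal.span {γ})) + Real.sqrt (Ideal.absNorm (Ideal.span {δ})) := by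
  obtain ⟨σ⟩ : Nonempty (K →+* ℂ) := inferInstance
  simp only [← norm_embedding hdeg himag σ]
  push_cast
  rw [map_sub]
  exact norm_sub_le _ _

/-- Coordinates of an integer with respect to an integral basis are bounded by a constant
multiple of the square root of the norm. -/
theorem exists_integralBasis_coord_bound (hdeg : Module.finrank ℚ K = 2)
    (himag : ∀ v : InfinitePlace K, v.IsComplex) :
    ∃ (ω₁ ω₂ : 𝓞 K) (c : ℝ), 0 ≤ c ∧ ∀ γ : 𝓞 K, ∃ a b : ℤ, γ = a * ω₁ + b * ω₂ ∧
      |(a : ℝ)| ≤ c * Real.sqrt (Ideal.absNorm (Ideal.span {γ})) ∧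
      |(b : ℝ)| ≤ c * Real.sqrt (Ideal.absNorm (Ideal.span {γ})) := by
  classical
  let B := RingOfIntegers.basis K
  let D := (integralBasis K).traceDual
  have hcoord : ∀ (γ : 𝓞 K) i, |((B.repr γ i : ℤ) : ℝ)| ≤
      (∑ σ : K →ₐ[ℚ] ℂ, ‖σ (D i)‖) * Real.sqrt (Ideal.absNorm (Ideal.span {γ})) := by
    intro γ i
    have h1 : ((B.repr γ i : ℤ) : ℚ) = Algebra.trace ℚ K (γ * D i) := by
      have h2 := integralBasis_repr_apply K γ i
      rw [← Module.Basis.traceDual_traceDual (integralBasis K),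
        Module.Basis.traceDual_repr_apply] at h2
      exact h2.symm
    have h3 : ((B.repr γ i : ℤ) : ℂ) = ∑ σ : K →ₐ[ℚ] ℂ, σ (γ * D i) := by
      rw [← trace_eq_sum_embeddings ℂ, ← h1]
      simp
    have h4 : |((B.repr γ i : ℤ) : ℝ)| = ‖((B.repr γ i : ℤ) : ℂ)‖ := by
      rw [Complex.norm_intCast]
    rw [h4, h3, Finset.sum_mul]
    refine (norm_sum_le _ _).trans (Finset.sum_le_sum fun σ _ => ?_)
    rw [map_mul, norm_mul, mul_comm]
    exact mul_le_mul_of_nonneg_left (norm_embedding hdeg himag (σ : K →+* ℂ) γ).le (norm_nonneg _)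
  have hcard : Fintype.card (Module.Free.ChooseBasisIndex ℤ (𝓞 K)) = 2 := by
    rw [← Module.finrank_eq_card_basis B, RingOfIntegers.rank, hdeg]
  let e := Fintype.equivFinOfCardEq hcard
  refine ⟨B (e.symm 0), B (e.symm 1), ∑ i, ∑ σ : K →ₐ[ℚ] ℂ, ‖σ (D i)‖, by positivity,
    fun γ => ⟨B.repr γ (e.symm 0), B.repr γ (e.symm 1), ?_, ?_, ?_⟩⟩
  · conv_lhs => rw [← B.sum_repr γ, ← e.symm.sum_comp, Fin.sum_univ_two]
    simp only [zsmul_eq_mul]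
  all_goals
    refine (hcoord γ _).trans (mul_le_mul_of_nonneg_right ?_ (Real.sqrt_nonneg _))
    exact Finset.single_le_sum (f := fun i => ∑ σ : K →ₐ[ℚ] ℂ, ‖σ (D i)‖)
      (fun _ _ => by positivity) (Finset.mem_univ _)

/-- Sets of integers of bounded diameter are contained in boxes. -/
theorem exists_box_cover (hdeg : Module.finrank ℚ K = 2)
    (himag : ∀ v : InfinitePlace K, v.IsComplex) :
    ∃ (ω₁ ω₂ : 𝓞 K) (c : ℝ), 0 ≤ c ∧ (∀ γ : 𝓞 K, ∃ a b : ℤ, γ = a * ω₁ + b * ω₂) ∧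
      ∀ (T : Set (𝓞 K)) (Y : ℝ), (∀ γ ∈ T, ∀ δ ∈ T,
        Real.sqrt (Ideal.absNorm (Ideal.span {γ - δ})) ≤ Y) → T.Nonempty →
        ∃ (r : 𝓞 K) (L : ℕ), (L : ℝ) ≤ c * Y + 1 ∧ ∀ γ ∈ T,
          ∃ s ∈ Finset.range L ×ˢ Finset.range L, γ = r + s.1 * ω₁ + s.2 * ω₂ := by
  obtain ⟨ω₁, ω₂, c, hc, h⟩ := exists_integralBasis_coord_bound hdeg himag
  refine ⟨ω₁, ω₂, 2 * c, by positivity, fun γ => ?_, fun T Y hT hne => ?_⟩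
  · obtain ⟨a, b, hab, -⟩ := h γ
    exact ⟨a, b, hab⟩
  obtain ⟨γ₀, hγ₀⟩ := hne
  have hY : 0 ≤ Y := (Real.sqrt_nonneg _).trans (hT γ₀ hγ₀ γ₀ hγ₀)
  set M := ⌊c * Y⌋₊ with hM
  have hMle : (M : ℝ) ≤ c * Y := Nat.floor_le (by positivity)
  refine ⟨γ₀ - M * ω₁ - M * ω₂, 2 * M + 1, by push_cast; linarith, fun γ hγ => ?_⟩
  obtain ⟨a, b, hab, ha, hb⟩ := h (γ - γ₀)
  have hbd : ∀ a : ℤ, |(a : ℝ)| ≤ c * Real.sqrt (Ideal.absNorm (Ideal.span {γ - γ₀})) →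
      |a| ≤ M := by
    intro a ha
    have h1 : |(a : ℝ)| ≤ c * Y := ha.trans (mul_le_mul_of_nonneg_left (hT γ hγ γ₀ hγ₀) hc)
    rw [← Int.cast_abs, Int.abs_eq_natAbs, Int.cast_natCast] at h1
    rw [Int.abs_eq_natAbs]
    exact_mod_cast Nat.le_floor h1
  have ha' := abs_le.1 (hbd a ha)
  have hb' := abs_le.1 (hbd b hb)
  refine ⟨((a + M).toNat, (b + M).toNat), ?_, ?_⟩
  · simp only [Finset.mem_product, Finset.mem_range]
    omega
  have h1 : (((a + M).toNat : ℤ) : 𝓞 K) = a + M := by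
    rw [Int.toNat_of_nonneg (by omega)]; push_cast; rfl
  have h2 : (((b + M).toNat : ℤ) : 𝓞 K) = b + M := by
    rw [Int.toNat_of_nonneg (by omega)]; push_cast; rfl
  rw [Int.cast_natCast] at h1 h2
  rw [h1, h2, ← sub_add_cancel γ γ₀, hab]
  ring

/-- The members of norm at most `x` of a residue class modulo `m` are contained in a box of side
`O(√(x / N(m)) + 1)`. -/
theorem exists_box_cover_residue_class (hdeg : Module.finrank ℚ K = 2)
    (himag : ∀ v : InfinitePlace K, v.IsComplex) :
    ∃ (ω₁ ω₂ : 𝓞 K) (c : ℝ), 0 ≤ c ∧ (∀ γ : 𝓞 K, ∃ a b : ℤ, γ = a * ω₁ + b * ω₂) ∧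
      ∀ (m α : 𝓞 K) (x : ℝ), m ≠ 0 →
        ∃ (r : 𝓞 K) (L : ℕ), (L : ℝ) ≤ c * Real.sqrt (x / Ideal.absNorm (Ideal.span {m})) + 1 ∧
          ∀ π : 𝓞 K, (Ideal.absNorm (Ideal.span {π}) : ℝ) ≤ x → m ∣ π - α →
          ∃ s ∈ Finset.range L ×ˢ Finset.range L, π = α + m * (r + s.1 * ω₁ + s.2 * ω₂) := by
  obtain ⟨ω₁, ω₂, c, hc, hω, h⟩ := exists_box_cover hdeg himag
  refine ⟨ω₁, ω₂, 2 * c, by positivity, hω, fun m α x hm => ?_⟩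
  set n : ℝ := (Ideal.absNorm (Ideal.span {m}) : ℝ) with hn
  have hn0 : 0 < n := by
    rw [hn, Nat.cast_pos]
    exact Nat.pos_of_ne_zero (Ideal.absNorm_eq_zero_iff.not.2 (by simpa using hm))
  set T : Set (𝓞 K) := {γ | (Ideal.absNorm (Ideal.span {α + m * γ}) : ℝ) ≤ x} with hT
  have hdiam : ∀ γ ∈ T, ∀ δ ∈ T, Real.sqrt (Ideal.absNorm (Ideal.span {γ - δ})) ≤
      2 * Real.sqrt (x / n) := by
    intro γ hγ δ hδ
    have h1 := sqrt_absNorm_sub_le hdeg himag (α + m * γ) (α + m * δ)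
    rw [add_sub_add_left_eq_sub, ← mul_sub, ← Ideal.span_singleton_mul_span_singleton, map_mul,
      Nat.cast_mul, Real.sqrt_mul hn0.le] at h1
    rw [Real.sqrt_div' _ hn0.le, ← mul_div_assoc, le_div_iff₀ (Real.sqrt_pos.2 hn0), mul_comm]
    linarith [Real.sqrt_le_sqrt (show _ ≤ x from hγ), Real.sqrt_le_sqrt (show _ ≤ x from hδ)]
  have hdecomp : ∀ π : 𝓞 K, (Ideal.absNorm (Ideal.span {π}) : ℝ) ≤ x → m ∣ π - α →
      ∃ γ ∈ T, π = α + m * γ := by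
    rintro π hπ ⟨γ, hγ⟩
    obtain rfl : π = α + m * γ := by rw [← hγ]; ring
    exact ⟨γ, hπ, rfl⟩
  rcases T.eq_empty_or_nonempty with hT0 | hT0
  · refine ⟨0, 0, by simp only [Nat.cast_zero]; positivity, fun π hπ hπα => ?_⟩
    obtain ⟨γ, hγ, -⟩ := hdecomp π hπ hπα
    simp [hT0] at hγ
  · obtain ⟨r, L, hL, hr⟩ := h T _ hdiam hT0
    refine ⟨r, L, by linarith, fun π hπ hπα => ?_⟩
    obtain ⟨γ, hγ, rfl⟩ := hdecomp π hπ hπα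
    obtain ⟨s, hs, rfl⟩ := hr γ hγ
    exact ⟨s, hs, rfl⟩

end ImaginaryQuadratic

section PrimeCount

variable {R : Type*} [CommRing R] [IsDedekindDomain R] [Module.Free ℤ R] [Module.Finite ℤ R]

theorem prime_notMem_of_absNorm_lt {p : Ideal R} (hp : p.IsPrime ∧ p ≠ ⊥) {π : R} (hπ : Prime π)
    (h : Ideal.absNorm p < Ideal.absNorm (Ideal.span {π})) : π ∉ p := by
  intro hmem
  have hle : Ideal.span {π} ≤ p := (Ideal.span_singleton_le_iff_mem p).2 hmem
  have hprime : (Ideal.span {π}).IsPrime := (Ideal.span_singleton_prime hπ.ne_zero).2 hπ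
  have hbot : Ideal.span {π} ≠ ⊥ := by simpa using hπ.ne_zero
  rw [(hprime.isMaximal hbot).eq_of_le hp.1.ne_top hle] at h
  exact h.false

variable [CharZero R]

/-- The density of the sieve weights is at least one. -/
theorem one_le_sum_sieveTerm (m : R) {z : ℕ} (hz : 1 ≤ z) :
    1 ≤ ∑ d ∈ (sieveSupport_finite m z).toFinset, sieveTerm d := by
  have h0 : (∅ : Finset (Ideal R)) ∈ (sieveSupport_finite m z).toFinset := by
    rw [Set.Finite.mem_toFinset]
    exact ⟨by simp, by simp, by simpa using hz⟩
  refine le_trans (by simp [sieveTerm]) (Finset.single_le_sum (fun d hd => ?_) h0)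
  exact Finset.prod_nonneg fun p hp =>
    (sieveRatio_pos (((Set.Finite.mem_toFinset _).1 hd).1 p hp)).le

/-- Sieve bound for primes of norm exceeding `z` in a box of a residue class modulo `m`. -/
theorem ncard_large_primes_le {ω₁ ω₂ : R} (hω : ∀ r : R, ∃ a b : ℤ, r = a * ω₁ + b * ω₂)
    {z : ℕ} (hz : 1 ≤ z) (α m r : R) (L : ℕ) {P : Set R}
    (hP : ∀ π ∈ P, Prime π ∧ z < Ideal.absNorm (Ideal.span {π}))
    (hbox : ∀ π ∈ P, ∃ s ∈ Finset.range L ×ˢ Finset.range L,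
      π = α + m * (r + s.1 * ω₁ + s.2 * ω₂)) :
    (P.ncard : ℝ) ≤ L ^ 2 / (∑ d ∈ (sieveSupport_finite m z).toFinset, sieveTerm d) +
      (Nat.card {I : Ideal R // Ideal.absNorm I ≤ z} : ℝ) ^ 2 * (4 * z ^ 2 * L) := by
  classical
  set S := (Finset.range L ×ˢ Finset.range L).filter fun s =>
    α + m * (r + s.1 * ω₁ + s.2 * ω₂) ∈ P with hS
  have hcard : P.ncard ≤ S.card := by
    have hsub : P ⊆ (S.image fun s => α + m * (r + s.1 * ω₁ + s.2 * ω₂) : Finset R) := by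
      intro π hπ
      obtain ⟨s, hs, rfl⟩ := hbox π hπ
      exact Finset.mem_coe.2 (Finset.mem_image_of_mem _ (Finset.mem_filter.2 ⟨hs, hπ⟩))
    refine (Set.ncard_le_ncard hsub (Finset.finite_toSet _)).trans ?_
    rw [Set.ncard_coe_finset]
    exact Finset.card_image_le
  have hD : ∀ d ∈ (sieveSupport_finite m z).toFinset, d ∈ sieveSupport m z :=
    fun d hd => (Set.Finite.mem_toFinset _).1 hd
  have hmain := selberg_sieve_box hω (fun d hd => (hD d hd).1) (fun d hd => (hD d hd).2.2)
    (fun d hd => (hD d hd).2.1) α r L (Finset.filter_subset _ _ : S ⊆ _) fun s hs d hd p hp => by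
      have hs' := hP _ (Finset.mem_filter.1 hs).2
      refine prime_notMem_of_absNorm_lt ((hD d hd).1 p hp) hs'.1 (lt_of_le_of_lt ?_ hs'.2)
      refine le_trans ?_ (hD d hd).2.2
      refine Nat.le_of_dvd (Finset.prod_pos fun q hq => ?_) (Finset.dvd_prod_of_mem _ hp)
      exact two_pos.trans_le (two_le_absNorm ((hD d hd).1 q hq))
  set G := ∑ d ∈ (sieveSupport_finite m z).toFinset, sieveTerm d with hG
  have hG1 : 1 ≤ G := one_le_sum_sieveTerm m hz
  have hG2 : (((sieveSupport_finite m z).toFinset.card : ℝ)) ^ 2 * (4 * z ^ 2 * L) ≤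
      (Nat.card {I : Ideal R // Ideal.absNorm I ≤ z} : ℝ) ^ 2 * (4 * z ^ 2 * L) := by
    have := card_sieveSupport_le m z
    gcongr
  set E := (Nat.card {I : Ideal R // Ideal.absNorm I ≤ z} : ℝ) ^ 2 * (4 * z ^ 2 * L) with hE
  have hE0 : 0 ≤ E := by positivity
  have hcard' : (P.ncard : ℝ) ≤ S.card := by exact_mod_cast hcard
  refine hcard'.trans (le_of_mul_le_mul_left ?_ (show 0 < G ^ 2 by positivity))
  refine (hmain.trans (add_le_add_right hG2 _)).trans ?_
  have h1 : G ^ 2 * (L ^ 2 / G + E) = L ^ 2 * G + G ^ 2 * E := by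
    field_simp
  rw [h1]
  have h2 := le_mul_of_one_le_left hE0 (one_le_pow₀ hG1 (n := 2))
  linarith

end PrimeCount

/-- Bounds for the main and error terms of the sieve at level `X ^ (1 / 16)`. -/
theorem exists_sieve_level {X : ℝ} (hX : 1 < X) : ∃ z : ℕ, 1 ≤ z ∧
    Real.log X / 16 ≤ Real.log (z + 1) ∧ (z : ℝ) ^ 4 * Real.sqrt X ≤ 4 * (X / Real.log X) ∧
    (z : ℝ) ≤ 4 * (X / Real.log X) := by
  set y : ℝ := X ^ (1 / 16 : ℝ) with hy
  have hX0 : 0 < X := one_pos.trans hX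
  have hyX : X = y ^ 16 := by
    rw [hy, ← Real.rpow_natCast, ← Real.rpow_mul hX0.le]; norm_num
  have hy1 : 1 < y := Real.one_lt_rpow hX (by norm_num)
  have hy0 : 0 < y := one_pos.trans hy1
  have hlog : Real.log X = 16 * Real.log y := by rw [hyX, Real.log_pow]; norm_num
  have hlogy : 0 < Real.log y := Real.log_pos hy1
  have hzy : (⌊y⌋₊ : ℝ) ≤ y := Nat.floor_le hy0.le
  have hmain : y ^ 12 ≤ 4 * (X / Real.log X) := by
    have h4 : 4 * Real.log y ≤ y ^ 4 := by
      have := Real.log_le_sub_one_of_pos (pow_pos hy0 4)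
      rw [Real.log_pow] at this
      push_cast at this
      linarith
    rw [hlog, hyX, ← mul_div_assoc, le_div_iff₀ (by positivity)]
    calc y ^ 12 * (16 * Real.log y) = 4 * y ^ 12 * (4 * Real.log y) := by ring
      _ ≤ 4 * y ^ 12 * y ^ 4 := by gcongr
      _ = 4 * y ^ 16 := by ring
  refine ⟨⌊y⌋₊, Nat.one_le_floor_iff _ |>.2 hy1.le, ?_, ?_, ?_⟩
  · rw [hlog, mul_div_cancel_left₀ _ (by norm_num)]
    exact Real.log_le_log hy0 (Nat.lt_floor_add_one y).le
  · have hs : Real.sqrt X = y ^ 8 := by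
      rw [hyX, show y ^ 16 = (y ^ 8) ^ 2 by ring, Real.sqrt_sq (by positivity)]
    rw [hs]
    refine le_trans ?_ hmain
    calc (⌊y⌋₊ : ℝ) ^ 4 * y ^ 8 ≤ y ^ 4 * y ^ 8 := by gcongr
      _ = y ^ 12 := by ring
  · refine hzy.trans (le_trans ?_ hmain)
    exact le_self_pow₀ hy1.le (by norm_num)

/-- Brun–Titchmarsh for imaginary quadratic fields: there is a constant `C > 0`, depending
only on `K`, such that for every real `x ≥ 3` and all `μ, α ∈ 𝓞 K` generating comaximal
ideals with `Nm(μ) < x`, the number of prime elements `π` of `𝓞 K` with `Nm(π) ≤ x` and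
`π ≡ α (mod μ)` is at most `C·x / (Φ(μ)·log(x/Nm(μ)))`. -/
theorem brun_titchmarsh_imaginary_quadratic (K : Type*) [Field K] [NumberField K]
    (hdeg : Module.finrank ℚ K = 2)
    (himag : ∀ v : InfinitePlace K, v.IsComplex) :
    ∃ C : ℝ, 0 < C ∧ ∀ x : ℝ, 3 ≤ x → ∀ μ α : 𝓞 K, IsCoprime μ α →
      (Ideal.absNorm (Ideal.span {μ}) : ℝ) < x →
      (Nat.card {π : 𝓞 K // Prime π ∧ (Ideal.absNorm (Ideal.span {π}) : ℝ) ≤ x ∧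
          μ ∣ (π - α)} : ℝ) ≤
        C * x / ((Nat.card ((𝓞 K ⧸ Ideal.span {μ})ˣ) : ℝ) *
          Real.log (x / (Ideal.absNorm (Ideal.span {μ}) : ℝ))) := by
  classical
  obtain ⟨c₀, C₁, hc₀, hC₁, hcount⟩ := exists_card_absNorm_le_bounds K
  obtain ⟨ω₁, ω₂, c, hc, hω, hcover⟩ := exists_box_cover_residue_class hdeg himag
  set B : ℝ := c + 1 with hB
  have hB0 : 0 < B := by positivity
  refine ⟨32 * B ^ 2 / c₀ + 4 * (4 * C₁ ^ 2 * B) + 4 * B ^ 2, by positivity,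
    fun x hx μ α hμα hμx => ?_⟩
  rcases eq_or_ne μ 0 with rfl | hμ
  · have hα : IsUnit α := isCoprime_zero_left.1 hμα
    have : IsEmpty {π : 𝓞 K // Prime π ∧ (Ideal.absNorm (Ideal.span {π}) : ℝ) ≤ x ∧
        (0 : 𝓞 K) ∣ (π - α)} := by
      refine ⟨fun ⟨π, hπ, _, h⟩ => hπ.not_isUnit ?_⟩
      rwa [sub_eq_zero.1 (zero_dvd_iff.1 h)]
    rw [Nat.card_of_isEmpty]
    simp
  set n : ℝ := (Ideal.absNorm (Ideal.span {μ}) : ℝ) with hn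
  set Φ : ℝ := (Nat.card ((𝓞 K ⧸ Ideal.span {μ})ˣ) : ℝ) with hΦ
  have hμ0 : Ideal.span {μ} ≠ ⊥ := by simpa using hμ
  have hn0 : 0 < n := by
    rw [hn, Nat.cast_pos]
    exact Nat.pos_of_ne_zero (Ideal.absNorm_eq_zero_iff.not.2 hμ0)
  have : Finite (𝓞 K ⧸ Ideal.span {μ}) := Ideal.finiteQuotientOfFreeOfNeBot _ hμ0
  have hΦ0 : 0 < Φ := by
    rw [hΦ, Nat.cast_pos]
    exact Nat.card_pos
  have hΦn : Φ ≤ n := by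
    rw [hΦ, hn, Ideal.absNorm_apply, Submodule.cardQuot_apply, Nat.cast_le]
    exact Nat.card_le_card_of_injective _ Units.val_injective
  set X := x / n with hX
  have hX1 : 1 < X := (one_lt_div hn0).2 hμx
  have hlogX : 0 < Real.log X := Real.log_pos hX1
  have hXx : X ≤ x / Φ := div_le_div_of_nonneg_left (by linarith) hΦ0 hΦn
  have hsX : 1 ≤ Real.sqrt X := Real.one_le_sqrt.2 hX1.le
  obtain ⟨z, hz, hzlog, hz4, hzX⟩ := exists_sieve_level hX1
  have hz' : (1 : ℝ) ≤ z := by exact_mod_cast hz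
  set P : Set (𝓞 K) := {π | Prime π ∧ (Ideal.absNorm (Ideal.span {π}) : ℝ) ≤ x ∧
    μ ∣ (π - α)} with hP
  have hsmall : ((P ∩ {π | Ideal.absNorm (Ideal.span {π}) ≤ z}).ncard : ℝ) ≤ B ^ 2 * z := by
    obtain ⟨r, L, hL, hr⟩ := hcover 1 0 z one_ne_zero
    rw [Ideal.span_singleton_one, Ideal.absNorm_top, Nat.cast_one, div_one] at hL
    have hsub : P ∩ {π | Ideal.absNorm (Ideal.span {π}) ≤ z} ⊆
        ((Finset.range L ×ˢ Finset.range L).image fun s : ℕ × ℕ =>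
          0 + 1 * (r + s.1 * ω₁ + s.2 * ω₂) : Finset (𝓞 K)) := by
      intro π hπ
      obtain ⟨s, hs, rfl⟩ := hr π (by exact_mod_cast hπ.2) (one_dvd _)
      exact Finset.mem_coe.2 (Finset.mem_image_of_mem _ hs)
    have hcard : (P ∩ {π | Ideal.absNorm (Ideal.span {π}) ≤ z}).ncard ≤ L * L := by
      refine (Set.ncard_le_ncard hsub (Finset.finite_toSet _)).trans ?_
      rw [Set.ncard_coe_finset]
      exact Finset.card_image_le.trans_eq (by simp)
    have hLB : (L : ℝ) ≤ B * Real.sqrt z := by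
      linarith [Real.one_le_sqrt.2 hz']
    calc ((P ∩ {π | Ideal.absNorm (Ideal.span {π}) ≤ z}).ncard : ℝ) ≤ L ^ 2 := by
          rw [sq]; exact_mod_cast hcard
      _ ≤ (B * Real.sqrt z) ^ 2 := by gcongr
      _ = B ^ 2 * z := by rw [mul_pow, Real.sq_sqrt (by positivity)]
  have hlarge : ((P \ {π | Ideal.absNorm (Ideal.span {π}) ≤ z}).ncard : ℝ) ≤
      (32 * B ^ 2 / c₀) * (x / (Φ * Real.log X)) + 4 * C₁ ^ 2 * B * (z ^ 4 * Real.sqrt X) := by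
    obtain ⟨r, L, hL, hr⟩ := hcover μ α x hμ
    have hLB : (L : ℝ) ≤ B * Real.sqrt X := by linarith
    refine (ncard_large_primes_le hω hz α μ r L (fun π hπ => ⟨hπ.1.1, not_le.1 hπ.2⟩)
      fun π hπ => hr π hπ.1.2.1 hπ.1.2.2).trans ?_
    have hG1 := one_le_sum_sieveTerm μ hz
    have hG := card_units_mul_sum_inv_absNorm_le hμ z
    set G := ∑ d ∈ (sieveSupport_finite μ z).toFinset, sieveTerm d with hGdef
    have hH := le_sum_inv_absNorm hc₀ (fun k hk => (hcount k hk).1) z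
    have hGlow : Φ * (c₀ / 2 * (Real.log X / 16)) ≤ n * G :=
      le_trans (by gcongr; exact le_trans (by gcongr) hH) hG
    refine add_le_add ?_ ?_
    · have hL2 : (L : ℝ) ^ 2 ≤ B ^ 2 * X := by
        calc (L : ℝ) ^ 2 ≤ (B * Real.sqrt X) ^ 2 := by gcongr
          _ = B ^ 2 * X := by rw [mul_pow, Real.sq_sqrt (by linarith)]
      rw [div_le_iff₀ (by linarith)]
      refine hL2.trans ?_
      have hkey : 32 * B ^ 2 / c₀ * (x / (Φ * Real.log X)) * G =
          (B ^ 2 * X) * ((n * G) / (Φ * (c₀ / 2 * (Real.log X / 16)))) := by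
        have hxX : x = X * n := by rw [hX]; field_simp
        rw [hxX]
        field_simp
        norm_num
      rw [hkey]
      exact le_mul_of_one_le_right (by positivity) ((one_le_div (by positivity)).2 hGlow)
    · have h1 := (hcount z hz).2
      calc (Nat.card {I : Ideal (𝓞 K) // Ideal.absNorm I ≤ z} : ℝ) ^ 2 * (4 * z ^ 2 * L)
          ≤ (C₁ * z) ^ 2 * (4 * z ^ 2 * (B * Real.sqrt X)) := by gcongr
        _ = 4 * C₁ ^ 2 * B * (z ^ 4 * Real.sqrt X) := by ring
  have hsplit : (Nat.card P : ℝ) ≤ (P ∩ {π | Ideal.absNorm (Ideal.span {π}) ≤ z}).ncard +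
      (P \ {π | Ideal.absNorm (Ideal.span {π}) ≤ z}).ncard := by
    rw [Nat.card_coe_set_eq]
    exact_mod_cast (Set.inter_union_sdiff P _ ▸ Set.ncard_union_le _ _ :
      P.ncard ≤ _)
  have hfin : X / Real.log X ≤ x / (Φ * Real.log X) := by
    rw [← div_div]
    gcongr
  calc (Nat.card P : ℝ) ≤ B ^ 2 * z + ((32 * B ^ 2 / c₀) * (x / (Φ * Real.log X)) +
        4 * C₁ ^ 2 * B * (z ^ 4 * Real.sqrt X)) := hsplit.trans (add_le_add hsmall hlarge)
    _ ≤ B ^ 2 * (4 * (x / (Φ * Real.log X))) + ((32 * B ^ 2 / c₀) * (x / (Φ * Real.log X)) +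
        4 * C₁ ^ 2 * B * (4 * (x / (Φ * Real.log X)))) := by
      exact add_le_add (mul_le_mul_of_nonneg_left (by linarith) (by positivity))
        (add_le_add le_rfl (mul_le_mul_of_nonneg_left (by linarith) (by positivity)))
    _ = _ := by ring
end

section
/- Let K be an imaginary quadratic number field with ring of integers 𝓞_K. For every positive integer d, the cardinality of the unit group (𝓞_K/d𝓞_K)ˣ is at least φ(d)², where φ is Euler's totient function. -/
open NumberField

open Finset in
open scoped Classical in
/-- The units of a finite monoid are counted by its invertible elements. -/
theorem natCard_units_eq_card_filter_isUnit (M : Type*) [Monoid M] [Fintype M] :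
    Nat.card Mˣ = #{x : M | IsUnit x} := by
  rw [Nat.card_eq_fintype_card, ← card_univ, ← card_image_of_injective _ Units.val_injective]
  congr 1
  ext x
  simp only [mem_image, mem_univ, true_and, mem_filter]
  rfl

/-- A surjective homomorphism of commutative rings with nil kernel reflects units. -/
theorem isUnit_of_map_of_ker_nil {A B : Type*} [CommRing A] [CommRing B] {f : A →+* B}
    (hf : Function.Surjective f) (hker : ∀ x, f x = 0 → IsNilpotent x) {x : A}
    (hx : IsUnit (f x)) : IsUnit x := by
  obtain ⟨b, hb⟩ := hx.exists_right_inv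
  obtain ⟨y, rfl⟩ := hf b
  have h : IsNilpotent (x * y - 1) := hker _ (by simp [hb])
  have hxy : IsUnit (x * y) := by simpa using h.isUnit_add_one
  exact isUnit_of_mul_isUnit_left hxy

open Finset in
open scoped Classical in
/-- The proportion of units is invariant under quotients by nil ideals. -/
theorem natCard_units_mul_natCard_of_ker_nil {A B : Type*} [CommRing A] [CommRing B]
    [Finite A] [Finite B] {f : A →+* B}
    (hf : Function.Surjective f) (hker : ∀ x, f x = 0 → IsNilpotent x) :
    Nat.card Aˣ * Nat.card B = Nat.card Bˣ * Nat.card A := by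
  have := Fintype.ofFinite A
  have := Fintype.ofFinite B
  have hfib (y : B) : #{x : A | f x = y} = #{x : A | f x = 0} :=
    AddMonoidHom.card_fiber_eq_of_mem_range f (hf y) (hf 0)
  have hcard : Nat.card A = Nat.card B * #{x : A | f x = 0} := by
    rw [Nat.card_eq_fintype_card, ← card_univ,
      card_eq_sum_card_fiberwise (f := f) (t := univ) (by simp)]
    simp [hfib]
  have hunits : Nat.card Aˣ = Nat.card Bˣ * #{x : A | f x = 0} := by
    rw [natCard_units_eq_card_filter_isUnit, natCard_units_eq_card_filter_isUnit,
      card_eq_sum_card_fiberwise (f := f) (t := {y : B | IsUnit y})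
        (fun x hx ↦ by simpa using (by simpa using hx : IsUnit x).map f),
      sum_congr rfl (g := fun _ ↦ #{x : A | f x = 0}), sum_const, smul_eq_mul]
    intro y hy
    rw [← hfib y, filter_filter]
    congr 1
    ext x
    simp only [mem_filter, mem_univ, true_and] at hy ⊢
    exact ⟨fun h ↦ h.2, fun h ↦ ⟨isUnit_of_map_of_ker_nil hf hker (h ▸ hy), h⟩⟩
  rw [hcard, hunits]
  ring

open Finset in
open scoped Classical in
/-- In an algebra of finite dimension `n` over a field, at most `n` translates of an element
by scalars fail to be invertible. -/
theorem card_filter_not_isUnit_add_algebraMap_le (F : Type*) {A : Type*} [Field F] [Fintype F]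
    [CommRing A] [Algebra F A] [Module.Finite F A] (x : A) :
    #{c : F | ¬ IsUnit (x + algebraMap F A c)} ≤ Module.finrank F A := by
  set P := (Algebra.lmul F A x).charpoly with hP
  have hP0 : P ≠ 0 := (LinearMap.charpoly_monic _).ne_zero
  have hx : Polynomial.aeval x P = 0 := Algebra.aeval_self_charpoly_lmul x
  calc #{c : F | ¬ IsUnit (x + algebraMap F A c)}
      = #(image (fun c ↦ -c) {c : F | ¬ IsUnit (x + algebraMap F A c)}) :=
        (card_image_of_injective _ neg_injective).symm
    _ ≤ #P.roots.toFinset := by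
        refine card_le_card fun c hc ↦ ?_
        obtain ⟨c, hc', rfl⟩ := mem_image.1 hc
        rw [Multiset.mem_toFinset, Polynomial.mem_roots hP0, Polynomial.IsRoot]
        by_contra h
        refine (mem_filter.1 hc').2 ?_
        have hdvd := Polynomial.sub_dvd_eval_sub x (algebraMap F A (-c)) (P.map (algebraMap F A))
        rw [Polynomial.eval_map_algebraMap, hx, Polynomial.eval_map_algebraMap,
          Polynomial.aeval_algebraMap_apply, Polynomial.coe_aeval_eq_eval, map_neg,
          sub_neg_eq_add, zero_sub, dvd_neg] at hdvd
        exact isUnit_of_dvd_unit hdvd ((IsUnit.mk0 _ h).map _)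
    _ ≤ P.roots.card := Multiset.toFinset_card_le _
    _ ≤ P.natDegree := Polynomial.card_roots' P
    _ = Module.finrank F A := LinearMap.charpoly_natDegree _

open Finset in
open scoped Classical in
/-- A two-dimensional algebra over a field with `q` elements has at least `(q - 1)²` units. -/
theorem natCard_sub_one_sq_le_natCard_units (F A : Type*) [Field F] [Finite F]
    [CommRing A] [Algebra F A] (h2 : Module.finrank F A = 2) :
    (Nat.card F - 1) ^ 2 ≤ Nat.card Aˣ := by
  have : Module.Finite F A := Module.finite_of_finrank_pos (by omega)
  have : Finite A := Module.finite_of_finite F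
  have : Nontrivial A := Module.nontrivial_of_finrank_pos (R := F) (by omega)
  have := Fintype.ofFinite F
  have := Fintype.ofFinite A
  have hcard : Fintype.card A = Fintype.card F ^ 2 := by
    rw [Module.card_eq_pow_finrank (K := F), h2]
  set S : Finset A := univ.image (algebraMap F A) with hS
  have hScard : #S = Fintype.card F :=
    card_image_of_injective _ (algebraMap F A).injective
  have hSle (x : A) (hx : x ∈ S) : #{c : F | ¬ IsUnit (x + algebraMap F A c)} ≤ 1 := by
    obtain ⟨a, -, rfl⟩ := mem_image.1 hx
    refine (card_le_card (t := {-a}) fun c hc ↦ ?_).trans_eq (card_singleton _)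
    have hc := (mem_filter.1 hc).2
    rw [← map_add] at hc
    rw [mem_singleton, eq_neg_iff_add_eq_zero, add_comm]
    by_contra h
    exact hc ((IsUnit.mk0 _ h).map _)
  have hle2 (x : A) : #{c : F | ¬ IsUnit (x + algebraMap F A c)} ≤ 2 := by
    convert card_filter_not_isUnit_add_algebraMap_le F x
    exact h2.symm
  have hsum : ∑ x : A, #{c : F | ¬ IsUnit (x + algebraMap F A c)} =
      Fintype.card F * #{x : A | ¬ IsUnit x} := by
    simp_rw [card_filter]
    rw [sum_comm, ← smul_eq_mul, ← card_univ, ← sum_const]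
    exact sum_congr rfl fun c _ ↦
      Equiv.sum_comp (Equiv.addRight (algebraMap F A c)) fun x ↦ if ¬ IsUnit x then 1 else 0
  have hle : ∑ x : A, #{c : F | ¬ IsUnit (x + algebraMap F A c)} ≤
      #S * 1 + #Sᶜ * 2 := by
    rw [← sum_add_sum_compl S]
    exact add_le_add (sum_le_card_nsmul _ _ _ hSle) (sum_le_card_nsmul _ _ _ fun x _ ↦ hle2 x)
  have hcompl := card_add_card_compl S
  have htot := card_filter_add_card_filter_not (s := (univ : Finset A)) (fun x ↦ IsUnit x)
  rw [natCard_units_eq_card_filter_isUnit, Nat.card_eq_fintype_card]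
  rw [card_univ] at htot
  have hq : 0 < Fintype.card F := Fintype.card_pos
  rw [hsum] at hle
  rw [hScard] at hle hcompl
  rw [hcard] at hcompl htot
  generalize Fintype.card F = q at *
  obtain ⟨q, rfl⟩ := Nat.exists_eq_add_one.2 hq
  have hN : #{x : A | ¬ IsUnit x} ≤ 2 * q + 1 := by
    refine Nat.le_of_mul_le_mul_left (c := q + 1) ?_ q.succ_pos
    linarith
  rw [Nat.add_sub_cancel]
  linarith

section NumberField

variable (K : Type*) [Field K] [NumberField K]

theorem NumberField.natCard_quotient_span_natCast (d : ℕ) :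
    Nat.card (𝓞 K ⧸ Ideal.span {(d : 𝓞 K)}) = d ^ Module.finrank ℚ K := by
  have h : Ideal.absNorm (Ideal.span {(d : 𝓞 K)}) = d ^ Module.finrank ℚ K := by
    have h := Algebra.norm_algebraMap_of_basis (Module.Free.chooseBasis ℤ (𝓞 K)) (d : ℤ)
    rw [← Module.finrank_eq_card_chooseBasisIndex, RingOfIntegers.rank] at h
    rw [Ideal.absNorm_span_singleton]
    simp only [algebraMap_int_eq, eq_intCast, Int.cast_natCast] at h
    rw [h, Int.natAbs_pow, Int.natAbs_natCast]
  exact h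

theorem NumberField.finite_quotient_span_natCast {d : ℕ} (hd : 0 < d) :
    Finite (𝓞 K ⧸ Ideal.span {(d : 𝓞 K)}) :=
  Nat.finite_of_card_ne_zero (by rw [natCard_quotient_span_natCast]; positivity)

variable {K}

theorem NumberField.sub_one_sq_le_natCard_units_quotient_prime
    (hdeg : Module.finrank ℚ K = 2) {p : ℕ} (hp : p.Prime) :
    (p - 1) ^ 2 ≤ Nat.card (𝓞 K ⧸ Ideal.span {(p : 𝓞 K)})ˣ := by
  have : Fact p.Prime := ⟨hp⟩
  have := finite_quotient_span_natCast K hp.pos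
  have hcard := natCard_quotient_span_natCast K p
  have hp0 : (p : 𝓞 K ⧸ Ideal.span {(p : 𝓞 K)}) = 0 := by
    rw [← map_natCast (Ideal.Quotient.mk _), Ideal.Quotient.eq_zero_iff_mem]
    exact Ideal.mem_span_singleton_self _
  have : Nontrivial (𝓞 K ⧸ Ideal.span {(p : 𝓞 K)}) := by
    rw [← Finite.one_lt_card_iff_nontrivial, hcard, hdeg]
    exact Nat.one_lt_pow two_ne_zero hp.one_lt
  have : CharP (𝓞 K ⧸ Ideal.span {(p : 𝓞 K)}) p := (CharP.charP_iff_prime_eq_zero hp).2 hp0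
  let _ : Algebra (ZMod p) (𝓞 K ⧸ Ideal.span {(p : 𝓞 K)}) := ZMod.algebra _ p
  have h2 : Module.finrank (ZMod p) (𝓞 K ⧸ Ideal.span {(p : 𝓞 K)}) = 2 := by
    have h := Module.natCard_eq_pow_finrank (K := ZMod p) (V := 𝓞 K ⧸ Ideal.span {(p : 𝓞 K)})
    rw [hcard, hdeg, Nat.card_zmod] at h
    exact (Nat.pow_right_injective hp.two_le h).symm
  simpa using natCard_sub_one_sq_le_natCard_units (ZMod p) _ h2

theorem NumberField.totient_sq_le_natCard_units_quotient_prime_pow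
    (hdeg : Module.finrank ℚ K = 2) {p k : ℕ} (hp : p.Prime) (hk : 0 < k) :
    Nat.totient (p ^ k) ^ 2 ≤ Nat.card (𝓞 K ⧸ Ideal.span {((p ^ k : ℕ) : 𝓞 K)})ˣ := by
  have := finite_quotient_span_natCast K hp.pos
  have := finite_quotient_span_natCast K (Nat.pow_pos (n := k) hp.pos)
  have hle : Ideal.span {((p ^ k : ℕ) : 𝓞 K)} ≤ Ideal.span {(p : 𝓞 K)} := by
    rw [Ideal.span_singleton_le_span_singleton, Nat.cast_pow]
    exact dvd_pow_self _ hk.ne'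
  have h := natCard_units_mul_natCard_of_ker_nil (f := Ideal.Quotient.factor hle)
    (Ideal.Quotient.factor_surjective hle) fun x hx ↦ by
      obtain ⟨x, rfl⟩ := Ideal.Quotient.mk_surjective x
      rw [Ideal.Quotient.factor_mk, Ideal.Quotient.eq_zero_iff_mem,
        Ideal.mem_span_singleton] at hx
      refine ⟨k, ?_⟩
      rw [← map_pow, Ideal.Quotient.eq_zero_iff_mem, Ideal.mem_span_singleton, Nat.cast_pow]
      exact pow_dvd_pow_of_dvd hx k
  rw [natCard_quotient_span_natCast, natCard_quotient_span_natCast, hdeg] at h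
  refine Nat.le_of_mul_le_mul_right (c := p ^ 2) ?_ (pow_pos hp.pos 2)
  rw [h, Nat.totient_prime_pow hp hk]
  calc (p ^ (k - 1) * (p - 1)) ^ 2 * p ^ 2
      = (p - 1) ^ 2 * (p ^ (k - 1) * p) ^ 2 := by ring
    _ = (p - 1) ^ 2 * (p ^ k) ^ 2 := by rw [pow_sub_one_mul hk.ne']
    _ ≤ _ := Nat.mul_le_mul_right _ (sub_one_sq_le_natCard_units_quotient_prime hdeg hp)

omit [NumberField K] in
variable (K) in
theorem NumberField.natCard_units_quotient_mul {a b : ℕ} (hab : a.Coprime b) :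
    Nat.card (𝓞 K ⧸ Ideal.span {((a * b : ℕ) : 𝓞 K)})ˣ =
      Nat.card (𝓞 K ⧸ Ideal.span {(a : 𝓞 K)})ˣ * Nat.card (𝓞 K ⧸ Ideal.span {(b : 𝓞 K)})ˣ := by
  have hcop : IsCoprime (Ideal.span {(a : 𝓞 K)}) (Ideal.span {(b : 𝓞 K)}) := by
    rw [Ideal.isCoprime_span_singleton_iff]
    exact hab.cast
  have hmul : Ideal.span {((a * b : ℕ) : 𝓞 K)} =
      Ideal.span {(a : 𝓞 K)} * Ideal.span {(b : 𝓞 K)} := by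
    rw [Ideal.span_singleton_mul_span_singleton, Nat.cast_mul]
  rw [hmul, ← Nat.card_prod]
  exact Nat.card_congr ((Units.mapEquiv
    (Ideal.quotientMulEquivQuotientProd _ _ hcop).toMulEquiv).trans MulEquiv.prodUnits).toEquiv

end NumberField

/-- Let `K` be an imaginary quadratic number field with ring of integers `𝓞 K`. For every
positive integer `d`, the cardinality of `(𝓞 K ⧸ d𝓞 K)ˣ` is at least `φ(d)²`. -/
theorem card_units_quotient_ge_totient_sq (K : Type*) [Field K] [NumberField K]
    (hdeg : Module.finrank ℚ K = 2)
    (himag : ∀ v : InfinitePlace K, v.IsComplex)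
    (d : ℕ) (hd : 0 < d) :
    (Nat.totient d) ^ 2 ≤ Nat.card ((𝓞 K ⧸ Ideal.span {(d : 𝓞 K)})ˣ) := by
  induction d using Nat.recOnPosPrimePosCoprime with
  | prime_pow p k hp hk =>
    exact NumberField.totient_sq_le_natCard_units_quotient_prime_pow hdeg hp hk
  | zero => exact absurd hd (lt_irrefl 0)
  | one =>
    have := NumberField.finite_quotient_span_natCast K one_pos
    simpa using Nat.one_le_iff_ne_zero.2 Nat.card_pos.ne'
  | coprime a b ha hb hab iha ihb =>
    rw [NumberField.natCard_units_quotient_mul K hab, Nat.totient_mul hab, mul_pow]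
    exact Nat.mul_le_mul (iha (by omega)) (ihb (by omega))
end

section
/- Let Δ < 0 be the discriminant of an imaginary quadratic number field. There is a constant C > 0, depending only on Δ, with the following property. Let n ≥ 1, b, and Y ≠ 0 be integers with b² − 4n = Y²·Δ, and set D = 2·n·|Y|. Then for every real x ≥ 3 and every real N with x^{1/3} ≤ N ≤ x, the number of integers d with N < d ≤ 2N for which n·d² + b·d + 1 is prime is at most C·(D/φ(D))²·N/log x. -/
namespace QuadraticSieve

section Sieve

open Finset

theorem sum_neg_one_pow_card_between {α : Type*} [DecidableEq α] (P L U : Finset α)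
    (hU : U ⊆ P) :
    ∑ T ∈ P.powerset, (if L ⊆ T ∧ T ⊆ U then (-1 : ℝ) ^ #T else 0) =
      if L = U then (-1) ^ #U else 0 := by
  by_cases hLU : L ⊆ U
  · have hset : ({T ∈ P.powerset | L ⊆ T ∧ T ⊆ U} : Finset (Finset α)) =
        (U \ L).powerset.image (L ∪ ·) := by
      ext T
      simp only [mem_filter, mem_powerset, mem_image]
      constructor
      · rintro ⟨-, h1, h2⟩
        exact ⟨T \ L, sdiff_subset_sdiff h2 le_rfl, union_sdiff_of_subset h1⟩
      · rintro ⟨R, hR, rfl⟩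
        have : L ∪ R ⊆ U := union_subset hLU (hR.trans sdiff_subset)
        exact ⟨this.trans hU, subset_union_left, this⟩
    have hdisj : ∀ R ∈ (U \ L).powerset, Disjoint L R := fun R hR =>
      disjoint_of_subset_right (mem_powerset.1 hR) disjoint_sdiff
    rw [← sum_filter, hset, sum_image]
    · have := congrArg (Int.cast : ℤ → ℝ) (sum_powerset_neg_one_pow_card (x := U \ L))
      push_cast at this
      calc _ = ∑ R ∈ (U \ L).powerset, (-1 : ℝ) ^ #L * (-1) ^ #R :=
            sum_congr rfl fun R hR => by rw [card_union_of_disjoint (hdisj R hR), pow_add]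
        _ = _ := by
            rw [← mul_sum, this]
            by_cases h : L = U
            · simp [h]
            · have h' : ¬ U ⊆ L := fun h' => h (hLU.antisymm h')
              simp [h, sdiff_eq_empty_iff_subset, h']
    · intro R hR R' hR' h
      have h1 := union_sdiff_cancel_left (hdisj R hR)
      have h2 := union_sdiff_cancel_left (hdisj R' hR')
      simp only at h
      rw [← h1, h, h2]
  · rw [sum_eq_zero, if_neg (fun h => hLU h.le)]
    exact fun T _ => if_neg fun h => hLU (h.1.trans h.2)

/-- The Selberg weights: the minimum of the quadratic form `∑ Λ T₁ Λ T₂ w (T₁ ∪ T₂)` subject to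
`Λ ∅ = 1` and with support controlled by a family `𝒟`. -/
theorem exists_selberg_weights {α : Type*} [DecidableEq α] (P : Finset α) (w : α → ℝ)
    (hw : ∀ i ∈ P, 0 < w i) (hw1 : ∀ i ∈ P, w i < 1) (𝒟 : Finset (Finset α))
    (h𝒟 : 𝒟 ⊆ P.powerset) (hempty : ∅ ∈ 𝒟) :
    ∃ Λ : Finset α → ℝ, Λ ∅ = 1 ∧ (∀ T ∈ P.powerset, |Λ T| ≤ ∏ i ∈ T, (w i)⁻¹) ∧
      (∀ T, Λ T ≠ 0 → ∃ U ∈ 𝒟, T ⊆ U) ∧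
      ∑ T₁ ∈ P.powerset, ∑ T₂ ∈ P.powerset, Λ T₁ * Λ T₂ * ∏ i ∈ T₁ ∪ T₂, w i =
        (∑ U ∈ 𝒟, ∏ i ∈ U, w i / (1 - w i))⁻¹ := by
  set g : Finset α → ℝ := fun U => ∏ i ∈ U, w i / (1 - w i) with hg
  set S := ∑ U ∈ 𝒟, g U with hS
  have hgpos : ∀ U ∈ 𝒟, 0 < g U := fun U hU => prod_pos fun i hi => by
    have := mem_powerset.1 (h𝒟 hU) hi
    exact div_pos (hw i this) (sub_pos.2 (hw1 i this))
  have hSpos : 0 < S := sum_pos hgpos ⟨_, hempty⟩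
  refine ⟨fun T => (-1) ^ #T * (∏ i ∈ T, (w i)⁻¹) * (∑ U ∈ 𝒟, if T ⊆ U then g U else 0) / S,
    ?_, ?_, ?_, ?_⟩
  · simp [← hS, hSpos.ne']
  · intro T hT
    have h1 : 0 ≤ ∏ i ∈ T, (w i)⁻¹ :=
      prod_nonneg fun i hi => (inv_pos.2 (hw i (mem_powerset.1 hT hi))).le
    have h2 : 0 ≤ ∑ U ∈ 𝒟, if T ⊆ U then g U else 0 :=
      sum_nonneg fun U hU => by split_ifs <;> simp [(hgpos U hU).le]
    have h3 : ∑ U ∈ 𝒟, (if T ⊆ U then g U else 0) ≤ S :=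
      sum_le_sum fun U hU => by split_ifs <;> simp [(hgpos U hU).le]
    rw [abs_div, abs_mul, abs_mul, abs_pow, abs_neg, abs_one, one_pow, one_mul, abs_of_nonneg h1,
      abs_of_nonneg h2, abs_of_pos hSpos, mul_div_assoc]
    exact mul_le_of_le_one_right h1 ((div_le_one hSpos).2 h3)
  · intro T hT
    by_contra! h
    refine hT ?_
    dsimp only
    rw [sum_eq_zero fun U hU => if_neg (h U hU)]
    simp
  · set Λ : Finset α → ℝ := fun T =>
      (-1) ^ #T * (∏ i ∈ T, (w i)⁻¹) * (∑ U ∈ 𝒟, if T ⊆ U then g U else 0) / S with hΛ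
    set j : Finset α → ℝ := fun L => ∏ i ∈ L, ((w i)⁻¹ - 1) with hj
    have hwne : ∀ T ∈ P.powerset, ∏ i ∈ T, w i ≠ 0 := fun T hT =>
      prod_ne_zero_iff.2 fun i hi => (hw i (mem_powerset.1 hT hi)).ne'
    have hjg : ∀ L ∈ P.powerset, j L * g L = 1 := fun L hL => by
      rw [← prod_mul_distrib]
      refine prod_eq_one fun i hi => ?_
      have h1 := (hw i (mem_powerset.1 hL hi)).ne'
      have h2 := (sub_pos.2 (hw1 i (mem_powerset.1 hL hi))).ne'
      field_simp
    have hunion : ∀ T₁ ∈ P.powerset, ∀ T₂ ∈ P.powerset, ∏ i ∈ T₁ ∪ T₂, w i =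
        ∑ L ∈ P.powerset, j L * ((if L ⊆ T₁ then ∏ i ∈ T₁, w i else 0) *
          (if L ⊆ T₂ then ∏ i ∈ T₂, w i else 0)) := by
      intro T₁ h₁ T₂ h₂
      have h12 : T₁ ∩ T₂ ∈ P.powerset :=
        mem_powerset.2 (inter_subset_left.trans (mem_powerset.1 h₁))
      have e1 : ∑ L ∈ P.powerset, j L * ((if L ⊆ T₁ then ∏ i ∈ T₁, w i else 0) *
          (if L ⊆ T₂ then ∏ i ∈ T₂, w i else 0)) =
          (∑ L ∈ (T₁ ∩ T₂).powerset, j L) * ((∏ i ∈ T₁, w i) * ∏ i ∈ T₂, w i) := by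
        rw [sum_mul]
        have : (T₁ ∩ T₂).powerset = {L ∈ P.powerset | L ⊆ T₁ ∧ L ⊆ T₂} := by
          ext L
          simp only [mem_powerset, mem_filter, subset_inter_iff]
          exact ⟨fun h => ⟨h.1.trans (mem_powerset.1 h₁), h⟩, fun h => h.2⟩
        rw [this, sum_filter]
        refine sum_congr rfl fun L _ => ?_
        split_ifs <;> simp_all
      have e2 : ∑ L ∈ (T₁ ∩ T₂).powerset, j L = (∏ i ∈ T₁ ∩ T₂, w i)⁻¹ := by
        rw [hj, ← prod_one_add, ← prod_inv_distrib]
        exact prod_congr rfl fun i _ => by ring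
      rw [e1, e2, ← prod_union_inter, mul_comm, mul_assoc, mul_inv_cancel₀ (hwne _ h12), mul_one]
    have hy : ∀ L ∈ P.powerset,
        ∑ T ∈ P.powerset, Λ T * (if L ⊆ T then ∏ i ∈ T, w i else 0) =
          if L ∈ 𝒟 then (-1) ^ #L * g L / S else 0 := by
      intro L hL
      calc _ = ∑ T ∈ P.powerset, ∑ U ∈ 𝒟,
              g U / S * (if L ⊆ T ∧ T ⊆ U then (-1 : ℝ) ^ #T else 0) := by
            refine sum_congr rfl fun T hT => ?_
            by_cases hLT : L ⊆ T
            · have := hwne T hT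
              simp only [hLT, true_and, if_true, hΛ, prod_inv_distrib]
              rw [mul_sum, sum_div, sum_mul]
              refine sum_congr rfl fun U _ => ?_
              split_ifs
              · field_simp
              · simp
            · simp [hLT]
        _ = ∑ U ∈ 𝒟, g U / S * (if L = U then (-1) ^ #U else 0) := by
            rw [sum_comm]
            refine sum_congr rfl fun U hU => ?_
            rw [← mul_sum, sum_neg_one_pow_card_between P L U (mem_powerset.1 (h𝒟 hU))]
        _ = _ := by
            simp only [mul_ite, mul_zero, sum_ite_eq]
            split_ifs <;> ring
    calc _ = ∑ T₁ ∈ P.powerset, ∑ T₂ ∈ P.powerset, ∑ L ∈ P.powerset,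
            j L * ((Λ T₁ * if L ⊆ T₁ then ∏ i ∈ T₁, w i else 0) *
              (Λ T₂ * if L ⊆ T₂ then ∏ i ∈ T₂, w i else 0)) := by
          refine sum_congr rfl fun T₁ h₁ => sum_congr rfl fun T₂ h₂ => ?_
          rw [hunion T₁ h₁ T₂ h₂, mul_sum]
          exact sum_congr rfl fun L _ => by ring
      _ = ∑ L ∈ P.powerset, j L *
            (∑ T ∈ P.powerset, Λ T * if L ⊆ T then ∏ i ∈ T, w i else 0) ^ 2 := by
          simp_rw [sq, sum_mul_sum, mul_sum]
          symm
          rw [sum_comm]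
          exact sum_congr rfl fun T₁ _ => sum_comm
      _ = ∑ L ∈ 𝒟, g L / S ^ 2 := by
          rw [← sum_subset h𝒟]
          · refine sum_congr rfl fun L hL => ?_
            rw [hy L (h𝒟 hL), if_pos hL]
            have h1 := hjg L (h𝒟 hL)
            have h2 : ((-1 : ℝ) ^ #L) ^ 2 = 1 := by rw [← pow_mul, mul_comm, pow_mul]; simp
            calc _ = (j L * g L) * ((-1 : ℝ) ^ #L) ^ 2 * (g L / S ^ 2) := by ring
              _ = _ := by rw [h1, h2]; ring
          · intro L hL hL'
            rw [hy L hL, if_neg hL']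
            simp
      _ = _ := by
          rw [← sum_div, ← hS, sq]
          field_simp

theorem abs_card_Ioc_modEq_sub_le (u v : ℤ) (huv : u ≤ v) (q : ℕ) (hq : 0 < q) (a : ℤ) :
    |(#{d ∈ Ioc u v | d ≡ a [ZMOD q]} : ℝ) - (v - u) / q| ≤ 1 := by
  have hq' : (0 : ℚ) < ((q : ℤ) : ℚ) := by exact_mod_cast hq
  have h := Int.Ioc_filter_modEq_card u v (r := (q : ℤ)) (by exact_mod_cast hq) a
  have hmono : ⌊((u : ℚ) - a) / (q : ℤ)⌋ ≤ ⌊((v : ℚ) - a) / (q : ℤ)⌋ := by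
    gcongr
  rw [max_eq_left (sub_nonneg.2 hmono)] at h
  have key : |(#{d ∈ Ioc u v | d ≡ a [ZMOD q]} : ℚ) - (v - u) / q| ≤ 1 := by
    have h' : (#{d ∈ Ioc u v | d ≡ a [ZMOD q]} : ℚ) =
        (⌊((v : ℚ) - a) / (q : ℤ)⌋ : ℚ) - ⌊((u : ℚ) - a) / (q : ℤ)⌋ := by exact_mod_cast h
    have e : ((v : ℚ) - u) / q = (v - a) / (q : ℤ) - (u - a) / (q : ℤ) := by push_cast; ring
    rw [h', e, abs_le]
    have h1 := Int.floor_le (((v : ℚ) - a) / (q : ℤ))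
    have h2 := Int.lt_floor_add_one (((v : ℚ) - a) / (q : ℤ))
    have h3 := Int.floor_le (((u : ℚ) - a) / (q : ℤ))
    have h4 := Int.lt_floor_add_one (((u : ℚ) - a) / (q : ℤ))
    constructor <;> linarith
  exact_mod_cast key

/-- Integers of an interval in prescribed residue classes modulo several distinct primes. -/
theorem abs_card_residues_sub_le (u v : ℤ) (huv : u ≤ v) (A : ∀ p : ℕ, Finset (ZMod p))
    (T : Finset ℕ) (hT : ∀ p ∈ T, p.Prime) (q : ℕ) (hq : 0 < q) (hqT : ∀ p ∈ T, q.Coprime p)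
    (a : ℤ) :
    |(#{d ∈ Ioc u v | d ≡ a [ZMOD q] ∧ ∀ p ∈ T, (d : ZMod p) ∈ A p} : ℝ) -
      (v - u) / q * ∏ p ∈ T, ((#(A p) : ℝ) / p)| ≤ ∏ p ∈ T, (#(A p) : ℝ) := by
  induction T using Finset.induction_on generalizing q a with
  | empty => simpa using abs_card_Ioc_modEq_sub_le u v huv q hq a
  | insert p T hpT ih =>
    have hp := hT p (mem_insert_self _ _)
    have hqp := hqT p (mem_insert_self _ _)
    have : ∀ s : ZMod p, ∃ c : ℤ, ∀ d : ℤ,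
        d ≡ c [ZMOD (q * p : ℕ)] ↔ d ≡ a [ZMOD q] ∧ (d : ZMod p) = s := by
      intro s
      obtain ⟨t, rfl⟩ := ZMod.intCast_surjective s
      obtain ⟨c, hc1, hc2⟩ : ∃ c : ℤ, c ≡ a [ZMOD q] ∧ c ≡ t [ZMOD p] := by
        obtain ⟨x, y, hxy⟩ := Nat.isCoprime_iff_coprime.2 hqp
        refine ⟨a * y * p + t * x * q, ?_, ?_⟩
        · exact Int.modEq_iff_dvd.2 ⟨a * x - t * x, by linear_combination -a * hxy⟩
        · exact Int.modEq_iff_dvd.2 ⟨t * y - a * y, by linear_combination -t * hxy⟩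
      refine ⟨c, fun d => ?_⟩
      rw [ZMod.intCast_eq_intCast_iff, Nat.cast_mul,
        ← Int.modEq_and_modEq_iff_modEq_mul (by simpa using hqp)]
      exact ⟨fun h => ⟨h.1.trans hc1, h.2.trans hc2⟩,
        fun h => ⟨h.1.trans hc1.symm, h.2.trans hc2.symm⟩⟩
    choose c hc using this
    have hsplit : #{d ∈ Ioc u v | d ≡ a [ZMOD q] ∧ ∀ p' ∈ insert p T, (d : ZMod p') ∈ A p'} =
        ∑ s ∈ A p, #{d ∈ Ioc u v | d ≡ c s [ZMOD (q * p : ℕ)] ∧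
          ∀ p' ∈ T, (d : ZMod p') ∈ A p'} := by
      rw [card_eq_sum_card_fiberwise (f := fun d : ℤ => (d : ZMod p)) (t := A p)]
      · refine sum_congr rfl fun s hs => congrArg card ?_
        rw [filter_filter]
        refine filter_congr fun d _ => ?_
        rw [hc s d, forall_mem_insert]
        constructor
        · rintro ⟨⟨h1, -, h3⟩, h4⟩
          exact ⟨⟨h1, h4⟩, h3⟩
        · rintro ⟨⟨h1, h4⟩, h3⟩
          exact ⟨⟨h1, by rwa [h4], h3⟩, h4⟩
      · intro d hd
        simp only [coe_filter, Set.mem_ofPred_eq] at hd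
        exact hd.2.2 p (mem_insert_self _ _)
    rw [hsplit, prod_insert hpT, prod_insert hpT]
    have hmain : ((v : ℝ) - u) / q * ((#(A p) : ℝ) / p * ∏ p ∈ T, ((#(A p) : ℝ) / p)) =
        ∑ s ∈ A p, (v - u) / (q * p : ℕ) * ∏ p ∈ T, ((#(A p) : ℝ) / p) := by
      rw [sum_const, nsmul_eq_mul]
      push_cast
      ring
    rw [hmain, Nat.cast_sum, ← sum_sub_distrib]
    refine (abs_sum_le_sum_abs _ _).trans ?_
    rw [← nsmul_eq_mul]
    refine sum_le_card_nsmul _ _ _ fun s _ => ?_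
    refine ih (fun p' h => hT p' (mem_insert_of_mem h)) _ (Nat.mul_pos hq hp.pos) ?_ _
    intro p' h
    refine Nat.Coprime.mul_left (hqT p' (mem_insert_of_mem h)) ?_
    rw [Nat.coprime_primes hp (hT p' (mem_insert_of_mem h))]
    rintro rfl
    exact hpT h

/-- The Selberg upper bound sieve for integers in an interval, with a crude error term. -/
theorem selberg_sieve (u v : ℤ) (huv : u ≤ v) (P : Finset ℕ) (hP : ∀ p ∈ P, p.Prime)
    (A : ∀ p : ℕ, Finset (ZMod p)) (hA : ∀ p ∈ P, 0 < #(A p)) (hA' : ∀ p ∈ P, #(A p) < p)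
    (z : ℕ) (hz : 1 ≤ z) :
    (#{d ∈ Ioc u v | ∀ p ∈ P, (d : ZMod p) ∉ A p} : ℝ) ≤
      (v - u) / (∑ U ∈ P.powerset with ∏ p ∈ U, p ≤ z,
        ∏ p ∈ U, (#(A p) : ℝ) / (p - #(A p))) + z ^ 6 := by
  set w : ℕ → ℝ := fun p => (#(A p) : ℝ) / p with hw
  set 𝒟 : Finset (Finset ℕ) := {U ∈ P.powerset | ∏ p ∈ U, p ≤ z} with h𝒟
  have hppos : ∀ p ∈ P, (0 : ℝ) < p := fun p hp => by exact_mod_cast (hP p hp).pos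
  obtain ⟨Λ, hΛ0, hΛabs, hΛsupp, hΛsum⟩ := exists_selberg_weights P w
    (fun p hp => div_pos (by exact_mod_cast hA p hp) (hppos p hp))
    (fun p hp => (div_lt_one (hppos p hp)).2 (by exact_mod_cast hA' p hp)) 𝒟
    (filter_subset _ _) (by simpa [h𝒟] using hz)
  have hS : ∑ U ∈ 𝒟, ∏ p ∈ U, w p / (1 - w p) =
      ∑ U ∈ 𝒟, ∏ p ∈ U, (#(A p) : ℝ) / (p - #(A p)) := by
    refine sum_congr rfl fun U hU => prod_congr rfl fun p hp => ?_
    have := (hppos p (mem_powerset.1 (filter_subset _ _ hU) hp)).ne'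
    simp only [hw]
    rw [one_sub_div this, div_div_div_cancel_right₀ this]
  rw [hS] at hΛsum
  have hsupp : ∀ T ∈ P.powerset, T ∉ 𝒟 → Λ T = 0 := by
    intro T hT hT'
    by_contra h
    obtain ⟨U, hU, hTU⟩ := hΛsupp T h
    refine hT' (mem_filter.2 ⟨hT, le_trans ?_ (mem_filter.1 hU).2⟩)
    refine Nat.le_of_dvd (prod_pos fun p hp => ?_) (prod_dvd_prod_of_subset _ _ _ hTU)
    exact (hP p (mem_powerset.1 (mem_filter.1 hU).1 hp)).pos
  have hprod : ∀ T ∈ 𝒟, (∏ p ∈ T, (p : ℝ)) ≤ z := fun T hT => by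
    rw [← Nat.cast_prod]
    exact Nat.cast_le.2 (mem_filter.1 hT).2
  have hTP : ∀ T ∈ 𝒟, T ⊆ P := fun T hT => mem_powerset.1 (filter_subset _ _ hT)
  have hΛz : ∀ T ∈ 𝒟, |Λ T| ≤ z := by
    intro T hT
    refine (hΛabs T (filter_subset _ _ hT)).trans (le_trans ?_ (hprod T hT))
    refine prod_le_prod (fun p hp => by simp only [hw]; positivity) fun p hp => ?_
    have h1 : (1 : ℝ) ≤ #(A p) := by exact_mod_cast hA p (hTP T hT hp)
    simp only [hw, inv_div]
    exact div_le_self (Nat.cast_nonneg _) h1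
  have hcard : (#𝒟 : ℝ) ≤ z := by
    have : #𝒟 ≤ #(Icc 1 z) := by
      refine card_le_card_of_injOn (fun U => ∏ p ∈ U, p) (fun U hU => ?_) ?_
      · simp only [coe_Icc, Set.mem_Icc]
        exact ⟨prod_pos fun p hp => (hP p (hTP U hU hp)).pos, (mem_filter.1 hU).2⟩
      · intro U hU V hV h
        simp only at h
        rw [← Nat.primeFactors_prod fun p hp => hP p (hTP U hU hp), h,
          Nat.primeFactors_prod fun p hp => hP p (hTP V hV hp)]
    simpa using (Nat.cast_le (α := ℝ)).2 this
  set B : ℤ → Finset ℕ := fun d => {p ∈ P | (d : ZMod p) ∈ A p} with hB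
  set cnt : Finset ℕ → ℝ := fun T => (#{d ∈ Ioc u v | ∀ p ∈ T, (d : ZMod p) ∈ A p} : ℝ) with hcnt
  have hcnt_le : ∀ T₁ ∈ 𝒟, ∀ T₂ ∈ 𝒟,
      |cnt (T₁ ∪ T₂) - (v - u) * ∏ p ∈ T₁ ∪ T₂, w p| ≤ (z : ℝ) ^ 2 := by
    intro T₁ h₁ T₂ h₂
    have hsub := union_subset (hTP T₁ h₁) (hTP T₂ h₂)
    have h := abs_card_residues_sub_le u v huv A (T₁ ∪ T₂) (fun p hp => hP p (hsub hp)) 1 one_pos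
      (fun p _ => Nat.coprime_one_left p) 0
    simp only [Nat.cast_one, Int.modEq_one, true_and, div_one] at h
    refine h.trans ?_
    calc ∏ p ∈ T₁ ∪ T₂, (#(A p) : ℝ) ≤ ∏ p ∈ T₁ ∪ T₂, (p : ℝ) :=
          prod_le_prod (fun _ _ => Nat.cast_nonneg _)
            fun p hp => by exact_mod_cast (hA' p (hsub hp)).le
      _ ≤ (∏ p ∈ T₁ ∪ T₂, (p : ℝ)) * ∏ p ∈ T₁ ∩ T₂, (p : ℝ) := by
          refine le_mul_of_one_le_right (prod_nonneg fun _ _ => Nat.cast_nonneg _) ?_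
          rw [← Nat.cast_prod, Nat.one_le_cast]
          exact Nat.one_le_iff_ne_zero.2 <| prod_ne_zero_iff.2 fun p hp =>
            (hP p (hTP T₁ h₁ (inter_subset_left hp))).ne_zero
      _ = (∏ p ∈ T₁, (p : ℝ)) * ∏ p ∈ T₂, (p : ℝ) := prod_union_inter
      _ ≤ z * z := mul_le_mul (hprod _ h₁) (hprod _ h₂)
          (prod_nonneg fun _ _ => Nat.cast_nonneg _) (Nat.cast_nonneg _)
      _ = (z : ℝ) ^ 2 := (sq _).symm
  have hrestrict : ∀ F : Finset ℕ → Finset ℕ → ℝ,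
      ∑ T₁ ∈ P.powerset, ∑ T₂ ∈ P.powerset, Λ T₁ * Λ T₂ * F T₁ T₂ =
        ∑ T₁ ∈ 𝒟, ∑ T₂ ∈ 𝒟, Λ T₁ * Λ T₂ * F T₁ T₂ := by
    intro F
    rw [sum_subset (filter_subset _ P.powerset) fun T hT hT' => by simp [hsupp T hT hT']]
    refine sum_congr rfl fun T₁ _ => ?_
    rw [sum_subset (filter_subset _ P.powerset) fun T hT hT' => by simp [hsupp T hT hT']]
  rw [hrestrict] at hΛsum
  have hpoint : ∀ d : ℤ, (if ∀ p ∈ P, (d : ZMod p) ∉ A p then (1 : ℝ) else 0) ≤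
      (∑ T ∈ 𝒟, Λ T * if T ⊆ B d then 1 else 0) ^ 2 := by
    intro d
    split_ifs with h
    · have hBd : B d = ∅ := filter_eq_empty_iff.2 h
      have h0 : ∅ ∈ 𝒟 := by simpa [h𝒟] using hz
      simp [hBd, subset_empty, h0, hΛ0]
    · positivity
  have hmainle : (#{d ∈ Ioc u v | ∀ p ∈ P, (d : ZMod p) ∉ A p} : ℝ) ≤
      ∑ T₁ ∈ 𝒟, ∑ T₂ ∈ 𝒟, Λ T₁ * Λ T₂ * cnt (T₁ ∪ T₂) := by
    calc _ = ∑ d ∈ Ioc u v, (if ∀ p ∈ P, (d : ZMod p) ∉ A p then (1 : ℝ) else 0) := by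
          rw [card_filter]; push_cast; rfl
      _ ≤ ∑ d ∈ Ioc u v, (∑ T ∈ 𝒟, Λ T * if T ⊆ B d then 1 else 0) ^ 2 :=
          sum_le_sum fun d _ => hpoint d
      _ = ∑ d ∈ Ioc u v, ∑ T₁ ∈ 𝒟, ∑ T₂ ∈ 𝒟,
            Λ T₁ * Λ T₂ * if ∀ p ∈ T₁ ∪ T₂, (d : ZMod p) ∈ A p then 1 else 0 := by
          refine sum_congr rfl fun d _ => ?_
          rw [sq, sum_mul_sum]
          refine sum_congr rfl fun T₁ h₁ => sum_congr rfl fun T₂ h₂ => ?_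
          have hiff : (∀ p ∈ T₁ ∪ T₂, (d : ZMod p) ∈ A p) ↔ T₁ ⊆ B d ∧ T₂ ⊆ B d := by
            rw [← union_subset_iff]
            constructor
            · exact fun h p hp =>
                mem_filter.2 ⟨union_subset (hTP T₁ h₁) (hTP T₂ h₂) hp, h p hp⟩
            · exact fun h p hp => (mem_filter.1 (h hp)).2
          rw [if_congr hiff rfl rfl]
          by_cases a : T₁ ⊆ B d <;> by_cases b : T₂ ⊆ B d <;> simp [a, b]
      _ = _ := by
          rw [sum_comm]
          refine sum_congr rfl fun T₁ _ => ?_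
          rw [sum_comm]
          refine sum_congr rfl fun T₂ _ => ?_
          rw [← mul_sum, hcnt]
          simp only
          rw [card_filter]
          push_cast
          rfl
  refine hmainle.trans ?_
  have hsplit : ∑ T₁ ∈ 𝒟, ∑ T₂ ∈ 𝒟, Λ T₁ * Λ T₂ * cnt (T₁ ∪ T₂) =
      (v - u) * (∑ T₁ ∈ 𝒟, ∑ T₂ ∈ 𝒟, Λ T₁ * Λ T₂ * ∏ p ∈ T₁ ∪ T₂, w p) +
      ∑ T₁ ∈ 𝒟, ∑ T₂ ∈ 𝒟, Λ T₁ * Λ T₂ *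
        (cnt (T₁ ∪ T₂) - (v - u) * ∏ p ∈ T₁ ∪ T₂, w p) := by
    simp only [mul_sum, ← sum_add_distrib]
    exact sum_congr rfl fun T₁ _ => sum_congr rfl fun T₂ _ => by ring
  rw [hsplit, hΛsum, ← div_eq_mul_inv]
  gcongr
  calc _ ≤ ∑ T₁ ∈ 𝒟, ∑ T₂ ∈ 𝒟, (z : ℝ) ^ 4 := by
        refine sum_le_sum fun T₁ h₁ => sum_le_sum fun T₂ h₂ => (le_abs_self _).trans ?_
        rw [abs_mul, abs_mul]
        calc _ ≤ (z : ℝ) * z * z ^ 2 := by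
              gcongr
              exacts [hΛz _ h₁, hΛz _ h₂, hcnt_le _ h₁ _ h₂]
          _ = (z : ℝ) ^ 4 := by ring
    _ = (#𝒟 : ℝ) * #𝒟 * z ^ 4 := by simp only [sum_const, nsmul_eq_mul]; ring
    _ ≤ (z : ℝ) * z * z ^ 4 := by gcongr
    _ = (z : ℝ) ^ 6 := by ring

/-- The quadratic character `m ↦ J(k | m)` on odd `m` coprime to `k < 0`. -/
theorem exists_quadratic_dirichletCharacter (k : ℤ) (hk : k < 0) :
    ∃ (q : ℕ) (_ : NeZero q) (χ : DirichletCharacter ℂ q), χ ^ 2 = 1 ∧ χ ≠ 1 ∧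
      ∀ p : ℕ, p.Prime → p ≠ 2 → χ p = (jacobiSym k p : ℂ) := by
  set q := 4 * k.natAbs with hq
  have hk0 : k.natAbs ≠ 0 := by simpa using hk.ne
  have hq0 : NeZero q := ⟨by simp [hq, hk0]⟩
  have hodd : ∀ a : ZMod q, IsUnit a → Odd a.val := by
    intro a ha
    have h := ZMod.val_coe_unit_coprime ha.unit
    rw [IsUnit.unit_spec] at h
    rw [← Nat.not_even_iff_odd]
    intro h2
    have := Nat.dvd_gcd h2.two_dvd (show 2 ∣ q from ⟨2 * k.natAbs, by omega⟩)
    rw [h.gcd_eq_one] at this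
    omega
  have hmod : ∀ m : ℕ, Odd m → jacobiSym k (m % q) = jacobiSym k m :=
    fun m hm => (jacobiSym.mod_right k hm).symm
  let χ : DirichletCharacter ℂ q :=
    { toFun := fun a => open Classical in if IsUnit a then (jacobiSym k a.val : ℂ) else 0
      map_one' := by
        rw [if_pos isUnit_one, ZMod.val_one_eq_one_mod, hmod 1 odd_one, jacobiSym.one_right]
        simp
      map_mul' := by
        intro a b
        by_cases ha : IsUnit a
        · by_cases hb : IsUnit b
          · have hva := hodd a ha
            have hvb := hodd b hb
            rw [if_pos (ha.mul hb), if_pos ha, if_pos hb, ZMod.val_mul,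
              hmod _ (hva.mul hvb), jacobiSym.mul_right' k hva.pos.ne' hvb.pos.ne']
            push_cast
            rfl
          · simp [IsUnit.mul_iff, hb]
        · simp [IsUnit.mul_iff, ha]
      map_nonunit' := fun a ha => if_neg ha }
  have hval : ∀ m : ℕ, Odd m → IsUnit (m : ZMod q) → χ m = (jacobiSym k m : ℂ) := by
    intro m hm hu
    change (open Classical in if IsUnit (m : ZMod q) then
      (jacobiSym k (m : ZMod q).val : ℂ) else 0) = _
    rw [if_pos hu, ZMod.val_natCast, hmod m hm]
  have hquad : χ.IsQuadratic := by
    intro a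
    by_cases ha : IsUnit a
    · have : χ a = (jacobiSym k a.val : ℂ) := by
        change (open Classical in if IsUnit a then (jacobiSym k a.val : ℂ) else 0) = _
        rw [if_pos ha]
      rw [this]
      rcases jacobiSym.trichotomy k a.val with h | h | h <;> simp [h]
    · exact Or.inl (χ.map_nonunit ha)
  refine ⟨q, hq0, χ, MulChar.isQuadratic_iff_sq_eq_one.1 hquad, ?_, ?_⟩
  · intro h1
    have hm : Odd (q - 1) := by
      rw [Nat.odd_iff]; omega
    have hcq : (q - 1).Coprime q := by
      rw [Nat.coprime_comm]
      exact (Nat.coprime_self_sub_right (by omega)).2 (Nat.coprime_one_right q)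
    have hu : IsUnit ((q - 1 : ℕ) : ZMod q) := (ZMod.isUnit_iff_coprime _ _).2 hcq
    have h2 := hval _ hm hu
    rw [h1, MulChar.one_apply hu] at h2
    have hJ4 : jacobiSym 4 (q - 1) = 1 := by
      rw [show (4 : ℤ) = 2 ^ 2 by norm_num]
      refine jacobiSym.sq_one' ?_
      exact Nat.coprime_two_left.2 hm
    have hJq : jacobiSym (4 * -k) (q - 1) = 1 := by
      have : (4 * -k) % ((q - 1 : ℕ) : ℤ) = 1 % ((q - 1 : ℕ) : ℤ) := by
        refine Int.ModEq.symm (Int.modEq_iff_dvd.2 ⟨1, ?_⟩)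
        omega
      rw [jacobiSym.mod_left, this, ← jacobiSym.mod_left, jacobiSym.one_left]
    rw [jacobiSym.mul_left, hJ4, one_mul, jacobiSym.neg _ hm,
      ZMod.χ₄_nat_three_mod_four (by omega)] at hJq
    have : jacobiSym k (q - 1) = -1 := by linarith
    rw [this] at h2
    norm_num at h2
  · intro p hp hp2
    by_cases hpk : p ∣ k.natAbs
    · have hnu : ¬ IsUnit (p : ZMod q) := by
        rw [ZMod.isUnit_iff_coprime, hp.coprime_iff_not_dvd, not_not]
        exact hpk.mul_left 4
      have := Fact.mk hp
      rw [χ.map_nonunit hnu, ← jacobiSym.legendreSym.to_jacobiSym,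
        (legendreSym.eq_zero_iff p k).2 ((ZMod.intCast_zmod_eq_zero_iff_dvd k p).2
          (Int.natCast_dvd.2 hpk))]
      simp
    · refine hval p (hp.odd_of_ne_two hp2) ?_
      rw [ZMod.isUnit_iff_coprime]
      refine Nat.Coprime.mul_right ?_ ((hp.coprime_iff_not_dvd).2 hpk)
      have := (Nat.coprime_primes hp Nat.prime_two).2 hp2
      exact this.pow_right 2

/-- Sums over integers composed of primes in `Q` are compared with sums over squarefree products
of the primes in `Q` satisfying `good`, at the cost of the local factors at the other primes. -/
theorem sum_primeFactors_subset_le (r : ℕ → ℝ) (hr : ∀ m, 0 ≤ r m) (hr1 : r 1 = 1)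
    (hmul : ∀ m n : ℕ, m.Coprime n → r (m * n) = r m * r n)
    (good : ℕ → Prop) [DecidablePred good] (g a : ℕ → ℝ) (Q : Finset ℕ) (hQ : ∀ p ∈ Q, p.Prime)
    (hg0 : ∀ p ∈ Q, good p → 0 ≤ g p)
    (hg : ∀ p ∈ Q, good p → ∀ K, ∑ k ∈ Icc 1 K, r (p ^ k) / (p : ℝ) ^ k ≤ g p)
    (ha0 : ∀ p ∈ Q, ¬ good p → 0 ≤ a p)
    (ha : ∀ p ∈ Q, ¬ good p → ∀ K, ∑ k ∈ range (K + 1), r (p ^ k) / (p : ℝ) ^ k ≤ a p) (x : ℕ) :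
    ∑ m ∈ Icc 1 x with m.primeFactors ⊆ Q, r m / m ≤
      (∏ p ∈ Q with ¬ good p, a p) *
        ∑ T ∈ (Q.filter good).powerset with ∏ p ∈ T, p ≤ x, ∏ p ∈ T, g p := by
  induction Q using Finset.induction_on generalizing x with
  | empty =>
    by_cases hx : 1 ≤ x
    · have : ({m ∈ Icc 1 x | m.primeFactors ⊆ ∅} : Finset ℕ) = {1} := by
        ext m
        simp only [mem_filter, mem_Icc, subset_empty, Nat.primeFactors_eq_empty, mem_singleton]
        omega
      rw [this]
      simp [hr1, filter_singleton, hx]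
    · have : Icc 1 x = ∅ := Icc_eq_empty hx
      rw [this]
      simp only [filter_empty, sum_empty, prod_empty, one_mul]
      refine sum_nonneg fun T hT => ?_
      simp only [powerset_empty, mem_filter, mem_singleton] at hT
      simp [hT.1]
  | insert p Q hpQ ih =>
    have hp := hQ p (mem_insert_self _ _)
    have hp0 : (0 : ℝ) < p := by exact_mod_cast hp.pos
    have ih' := ih (fun q h => hQ q (mem_insert_of_mem h)) (fun q h => hg0 q (mem_insert_of_mem h))
      (fun q h => hg q (mem_insert_of_mem h)) (fun q h => ha0 q (mem_insert_of_mem h))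
      (fun q h => ha q (mem_insert_of_mem h))
    set M : ℕ → ℝ := fun x => ∑ m ∈ Icc 1 x with m.primeFactors ⊆ Q, r m / m with hM
    set S : ℕ → ℝ := fun x =>
      ∑ T ∈ (Q.filter good).powerset with ∏ p ∈ T, p ≤ x, ∏ p ∈ T, g p with hS
    set c := ∏ p ∈ Q with ¬ good p, a p with hc
    have hc0 : 0 ≤ c := prod_nonneg fun q hq =>
      ha0 q (mem_insert_of_mem (mem_filter.1 hq).1) (mem_filter.1 hq).2
    have hgT : ∀ T ∈ (Q.filter good).powerset, 0 ≤ ∏ p ∈ T, g p := fun T hT =>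
      prod_nonneg fun q hq => by
        have := mem_filter.1 (mem_powerset.1 hT hq)
        exact hg0 q (mem_insert_of_mem this.1) this.2
    have hSmono : ∀ y y', y ≤ y' → S y ≤ S y' := by
      intro y y' h
      refine sum_le_sum_of_subset_of_nonneg ?_ fun T hT _ => hgT T (filter_subset _ _ hT)
      exact fun T hT => mem_filter.2 ⟨(mem_filter.1 hT).1, (mem_filter.1 hT).2.trans h⟩
    have hdecomp : ∑ m ∈ Icc 1 x with m.primeFactors ⊆ insert p Q, r m / m ≤
        ∑ k ∈ range (x + 1), r (p ^ k) / (p : ℝ) ^ k * M (x / p ^ k) := by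
      simp only [hM, mul_sum]
      rw [sum_sigma']
      set i : ℕ → (_ : ℕ) × ℕ := fun m => ⟨m.factorization p, m / p ^ m.factorization p⟩ with hi
      have hinj : Function.Injective i := by
        intro m n h
        simp only [hi, Sigma.mk.injEq, heq_eq_eq] at h
        rw [← Nat.ordProj_mul_ordCompl_eq_self m p, ← Nat.ordProj_mul_ordCompl_eq_self n p, h.2,
          h.1]
      have hterm : ∀ m ∈ ({m ∈ Icc 1 x | m.primeFactors ⊆ insert p Q} : Finset ℕ), r m / m =
          r (p ^ (i m).1) / (p : ℝ) ^ (i m).1 * (r (i m).2 / ((i m).2 : ℕ)) := by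
        intro m hm
        have hm0 : m ≠ 0 := by
          have := (mem_Icc.1 (mem_filter.1 hm).1).1
          omega
        have hcop : (p ^ m.factorization p).Coprime (m / p ^ m.factorization p) :=
          (Nat.coprime_ordCompl hp hm0).pow_left _
        have e := hmul _ _ hcop
        have e' := congrArg (Nat.cast : ℕ → ℝ) (Nat.ordProj_mul_ordCompl_eq_self m p)
        rw [Nat.ordProj_mul_ordCompl_eq_self] at e
        simp only [hi]
        rw [div_mul_div_comm, ← e, ← Nat.cast_pow, ← Nat.cast_mul,
          Nat.ordProj_mul_ordCompl_eq_self]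
      rw [sum_congr rfl hterm, ← sum_image (f := fun y : (_ : ℕ) × ℕ =>
        r (p ^ y.1) / (p : ℝ) ^ y.1 * (r y.2 / (y.2 : ℕ))) hinj.injOn]
      refine sum_le_sum_of_subset_of_nonneg ?_ fun y _ _ => mul_nonneg
        (div_nonneg (hr _) (by positivity)) (div_nonneg (hr _) (by positivity))
      intro y hy
      obtain ⟨m, hm, rfl⟩ := mem_image.1 hy
      obtain ⟨hm1, hm2⟩ := mem_filter.1 hm
      obtain ⟨hm3, hm4⟩ := mem_Icc.1 hm1
      have hm0 : m ≠ 0 := by omega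
      simp only [hi, mem_sigma, mem_range, mem_filter, mem_Icc]
      refine ⟨?_, ⟨Nat.ordCompl_pos p hm0, Nat.div_le_div_right hm4⟩, ?_⟩
      · have := Nat.factorization_lt (n := m) p hm0
        omega
      · intro q hq
        have hqm : q ∈ m.primeFactors := Nat.primeFactors_mono (Nat.ordCompl_dvd m p) hm0 hq
        refine (mem_insert.1 (hm2 hqm)).resolve_left ?_
        rintro rfl
        exact Nat.not_dvd_ordCompl hp hm0 (Nat.dvd_of_mem_primeFactors hq)
    have hr0 : ∀ k, 0 ≤ r (p ^ k) / (p : ℝ) ^ k := fun k => div_nonneg (hr _) (by positivity)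
    refine hdecomp.trans ?_
    by_cases hgood : good p
    · have hfb : (insert p Q).filter (fun p => ¬ good p) = Q.filter (fun p => ¬ good p) := by
        rw [filter_insert, if_neg (not_not.2 hgood)]
      have hfg : (insert p Q).filter good = insert p (Q.filter good) := by
        rw [filter_insert, if_pos hgood]
      have hpQ' : p ∉ Q.filter good := fun h => hpQ (mem_filter.1 h).1
      have hSins : ∑ T ∈ (insert p (Q.filter good)).powerset with ∏ p ∈ T, p ≤ x, ∏ p ∈ T, g p =
          S x + g p * S (x / p) := by
        rw [sum_filter, sum_powerset_insert hpQ', ← sum_filter]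
        congr 1
        simp only [hS]
        rw [sum_filter, mul_sum]
        refine sum_congr rfl fun T hT => ?_
        have hpT : p ∉ T := fun h => hpQ' (mem_powerset.1 hT h)
        rw [prod_insert hpT, prod_insert hpT, mul_ite, mul_zero]
        refine if_congr ?_ rfl rfl
        rw [Nat.le_div_iff_mul_le hp.pos, mul_comm]
      rw [hfb, hfg, hSins, range_eq_Ico, sum_eq_sum_Ico_succ_bot (Nat.succ_pos x)]
      have h0 : r (p ^ 0) / (p : ℝ) ^ 0 * M (x / p ^ 0) ≤ c * S x := by
        simpa [hr1] using ih' x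
      have h1 : ∑ k ∈ Ico (0 + 1) (x + 1), r (p ^ k) / (p : ℝ) ^ k * M (x / p ^ k) ≤
          g p * (c * S (x / p)) := by
        refine le_trans ?_ (mul_le_mul_of_nonneg_right
          (hg p (mem_insert_self _ _) hgood x) (mul_nonneg hc0 (sum_nonneg fun T hT =>
            hgT T (filter_subset _ _ hT))))
        rw [sum_mul]
        refine sum_le_sum fun k hk => ?_
        refine mul_le_mul_of_nonneg_left ((ih' _).trans ?_) (hr0 k)
        refine mul_le_mul_of_nonneg_left (hSmono _ _ ?_) hc0
        exact Nat.div_le_div_left (Nat.le_self_pow (by have := (mem_Ico.1 hk).1; omega) p) hp.pos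
      linarith
    · have hfb : (insert p Q).filter (fun p => ¬ good p) =
          insert p (Q.filter (fun p => ¬ good p)) := by
        rw [filter_insert, if_pos hgood]
      have hfg : (insert p Q).filter good = Q.filter good := by
        rw [filter_insert, if_neg hgood]
      rw [hfb, hfg, prod_insert (fun h => hpQ (mem_filter.1 h).1), mul_assoc]
      refine le_trans ?_ (mul_le_mul_of_nonneg_right
          (ha p (mem_insert_self _ _) hgood x) (mul_nonneg hc0 (sum_nonneg fun T hT =>
            hgT T (filter_subset _ _ hT))))
      rw [sum_mul]
      refine sum_le_sum fun k _ => ?_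
      refine mul_le_mul_of_nonneg_left ((ih' _).trans ?_) (hr0 k)
      exact mul_le_mul_of_nonneg_left (hSmono _ _ (Nat.div_le_self _ _)) hc0

end Sieve

section LSeries

open Finset Filter Topology
open scoped LSeries.notation ComplexOrder

/-- The real number `(ζ * χ)(m)` is nonnegative and its Dirichlet series at `1 + σ` is
asymptotic to a positive multiple of `1 / σ`. -/
theorem tendsto_mul_tsum_zetaMul {q : ℕ} [NeZero q] (χ : DirichletCharacter ℂ q)
    (hχ2 : χ ^ 2 = 1) (hχ : χ ≠ 1) :
    ∃ ℓ : ℝ, 0 < ℓ ∧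
      (∀ σ : ℝ, 0 < σ → Summable fun m : ℕ => (χ.zetaMul m).re / (m : ℝ) ^ (1 + σ)) ∧
      Tendsto (fun σ : ℝ => σ * ∑' m : ℕ, (χ.zetaMul m).re / (m : ℝ) ^ (1 + σ)) (𝓝[>] 0)
        (𝓝 ℓ) := by
  have hterm : ∀ (σ : ℝ) (m : ℕ), LSeries.term (χ.zetaMul ·) (1 + σ) m =
      (((χ.zetaMul m).re / (m : ℝ) ^ (1 + σ) : ℝ) : ℂ) := by
    intro σ m
    rcases eq_or_ne m 0 with rfl | hm
    · simp
    · rw [LSeries.term_of_ne_zero hm]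
      have h0 := DirichletCharacter.zetaMul_nonneg hχ2 m
      have h1 : χ.zetaMul m = ((χ.zetaMul m).re : ℂ) := (Complex.eq_re_of_ofReal_le h0)
      rw [Complex.ofReal_div, ← h1, Complex.ofReal_cpow (Nat.cast_nonneg m)]
      simp
  have hre : ∀ σ : ℝ, 0 < σ → 1 < (1 + (σ : ℂ)).re := by intro σ hσ; simpa using hσ
  have hsum : ∀ σ : ℝ, 0 < σ → Summable fun m : ℕ => (χ.zetaMul m).re / (m : ℝ) ^ (1 + σ) := by
    intro σ hσ
    have h := χ.LSeriesSummable_zetaMul (hre σ hσ)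
    rw [LSeriesSummable, show LSeries.term (χ.zetaMul ·) (1 + (σ : ℂ)) = _ from
      funext (hterm σ)] at h
    exact Complex.summable_ofReal.1 h
  have hval : ∀ σ : ℝ, 0 < σ → ((∑' m : ℕ, (χ.zetaMul m).re / (m : ℝ) ^ (1 + σ) : ℝ) : ℂ) =
      riemannZeta (1 + σ) * χ.LFunction (1 + σ) := by
    intro σ hσ
    have h1 : L (χ.zetaMul ·) (1 + (σ : ℂ)) = riemannZeta (1 + σ) * χ.LFunction (1 + σ) := by
      rw [DirichletCharacter.zetaMul, ← ArithmeticFunction.coe_mul, LSeries_convolution',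
        χ.LFunction_eq_LSeries (hre σ hσ)]
      · congr 1
        · simp_rw [← ArithmeticFunction.LSeries_zeta_eq_riemannZeta (hre σ hσ),
            ← ArithmeticFunction.natCoe_apply]
        · exact LSeries_congr (fun h => (χ.apply_eq_toArithmeticFunction_apply h).symm) _
      · exact ArithmeticFunction.LSeriesSummable_zeta_iff.mpr (hre σ hσ)
      · exact (LSeriesSummable_congr _ fun h =>
          (χ.apply_eq_toArithmeticFunction_apply h).symm).mpr <|
            ZMod.LSeriesSummable_of_one_lt_re χ (hre σ hσ)
    rw [← h1, LSeries, Complex.ofReal_tsum]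
    exact tsum_congr fun m => (hterm σ m).symm
  have hL : χ.LFunction 1 ≠ 0 := χ.LFunction_apply_one_ne_zero hχ
  have htend : Tendsto (fun s : ℂ => (s - 1) * riemannZeta s * χ.LFunction s) (𝓝[≠] 1)
      (𝓝 (1 * χ.LFunction 1)) :=
    riemannZeta_residue_one.mul
      ((χ.differentiable_LFunction hχ).continuous.tendsto 1 |>.mono_left nhdsWithin_le_nhds)
  have hpath : Tendsto (fun σ : ℝ => 1 + (σ : ℂ)) (𝓝[>] 0) (𝓝[≠] 1) := by
    refine tendsto_nhdsWithin_iff.2 ⟨?_, ?_⟩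
    · have : Continuous fun σ : ℝ => 1 + (σ : ℂ) := by fun_prop
      simpa using (this.tendsto 0).mono_left (nhdsWithin_le_nhds (s := Set.Ioi 0))
    · filter_upwards [self_mem_nhdsWithin] with σ hσ
      simpa using (ne_of_gt hσ : σ ≠ 0)
  have hcomp := (htend.comp hpath).norm
  refine ⟨‖1 * χ.LFunction 1‖, by simpa using hL, hsum, hcomp.congr' ?_⟩
  filter_upwards [self_mem_nhdsWithin] with σ hσ
  have hσ' : 0 < σ := hσ
  have hnonneg : 0 ≤ ∑' m : ℕ, (χ.zetaMul m).re / (m : ℝ) ^ (1 + σ) :=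
    tsum_nonneg fun m => div_nonneg (Complex.le_def.1 (DirichletCharacter.zetaMul_nonneg hχ2 m)).1
      (by positivity)
  simp only [Function.comp]
  rw [mul_assoc, ← hval σ hσ', add_sub_cancel_left, ← Complex.ofReal_mul, Complex.norm_real,
    Real.norm_of_nonneg (mul_nonneg hσ'.le hnonneg)]

/-- A Tauberian lower bound: a Dirichlet series with nonnegative coefficients having a simple
pole at `1` has logarithmic partial sums of at least logarithmic growth. -/
theorem exists_log_le_sum_div (r : ℕ → ℝ) (hr : ∀ m, 0 ≤ r m) (hr1 : 1 ≤ r 1) (ℓ : ℝ) (hℓ : 0 < ℓ)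
    (hsum : ∀ σ : ℝ, 0 < σ → Summable fun m : ℕ => r m / (m : ℝ) ^ (1 + σ))
    (hlim : Tendsto (fun σ : ℝ => σ * ∑' m : ℕ, r m / (m : ℝ) ^ (1 + σ)) (𝓝[>] 0) (𝓝 ℓ)) :
    ∃ c : ℝ, 0 < c ∧ ∀ z : ℕ, 1 ≤ z → c * Real.log (z + 1) ≤ ∑ m ∈ Icc 1 z, r m / m := by
  set F : ℝ → ℝ := fun σ => ∑' m : ℕ, r m / (m : ℝ) ^ (1 + σ) with hF
  have hev : ∀ᶠ σ in 𝓝[>] (0 : ℝ), ℓ / 2 < σ * F σ ∧ σ * F σ < 2 * ℓ :=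
    (hlim.eventually (lt_mem_nhds (half_lt_self hℓ))).and
      (hlim.eventually (gt_mem_nhds (by linarith)))
  obtain ⟨σ₀, hσ₀, hσ⟩ := mem_nhdsGT_iff_exists_Ioo_subset.1 hev
  have hσ₀' : (0 : ℝ) < σ₀ := hσ₀
  have hone : ∀ z : ℕ, 1 ≤ z → 1 ≤ ∑ m ∈ Icc 1 z, r m / m := by
    intro z hz
    have h := single_le_sum (f := fun m : ℕ => r m / m) (s := Icc 1 z) (a := 1)
      (fun m _ => div_nonneg (hr m) (Nat.cast_nonneg m)) (by simpa using hz)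
    simp only [Nat.cast_one, div_one] at h
    linarith
  have hbig : ∀ z : ℕ, 1 ≤ z → 6 / σ₀ < Real.log z →
      ℓ / 24 * Real.log z ≤ ∑ m ∈ Icc 1 z, r m / m := by
    intro z hz hlog
    have hlpos : 0 < Real.log z := lt_trans (by positivity) hlog
    have hz0 : (0 : ℝ) < z := by exact_mod_cast hz
    set σ := 6 / Real.log z with hσdef
    have hσpos : 0 < σ := by positivity
    have hσlt : σ < σ₀ := by
      rw [hσdef, div_lt_iff₀ hlpos]
      rw [div_lt_iff₀ hσ₀'] at hlog
      linarith
    have h1 := (hσ ⟨hσpos, hσlt⟩).1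
    have h2 := (hσ ⟨half_pos hσpos, (half_lt_self hσpos).trans hσlt⟩).2
    have hzσ : (z : ℝ) ^ (-(σ / 2)) = Real.exp (-3) := by
      rw [Real.rpow_def_of_pos hz0]
      congr 1
      rw [hσdef]
      field_simp
      norm_num
    have hexp : Real.exp (-3) ≤ 1 / 16 := by
      have h := Real.add_one_le_exp (1 : ℝ)
      have e3 : Real.exp 3 = Real.exp 1 ^ 3 := by rw [← Real.exp_nat_mul]; norm_num
      have hd := Real.exp_one_gt_d9
      rw [Real.exp_neg, e3, one_div]
      refine inv_anti₀ (by norm_num) ?_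
      calc (16 : ℝ) ≤ 2.7 ^ 3 := by norm_num
        _ ≤ Real.exp 1 ^ 3 := by gcongr; linarith
    have hle : F σ ≤ ∑ m ∈ Icc 1 z, r m / m + Real.exp (-3) * F (σ / 2) := by
      have hind : HasSum (fun m : ℕ => if m ∈ Icc 1 z then r m / m else 0)
          (∑ m ∈ Icc 1 z, r m / m) := by
        have : HasSum (fun m : ℕ => if m ∈ Icc 1 z then r m / m else 0)
            (∑ m ∈ Icc 1 z, if m ∈ Icc 1 z then r m / m else 0) :=
          hasSum_sum_of_ne_finset_zero fun m hm => if_neg hm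
        rwa [sum_ite_mem, inter_self] at this
      refine hasSum_le ?_ (hsum σ hσpos).hasSum
        (hind.add ((hsum _ (half_pos hσpos)).hasSum.mul_left _))
      intro m
      rcases Nat.eq_zero_or_pos m with rfl | hm
      · simp only [CharP.cast_eq_zero]
        rw [Real.zero_rpow (by positivity), Real.zero_rpow (by positivity)]
        simp
      have hm1 : (1 : ℝ) ≤ m := by exact_mod_cast hm
      have hm0 : (0 : ℝ) < m := by linarith
      by_cases hmz : m ≤ z
      · rw [if_pos (mem_Icc.2 ⟨hm, hmz⟩)]
        have : r m / (m : ℝ) ^ (1 + σ) ≤ r m / m := by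
          refine div_le_div_of_nonneg_left (hr m) hm0 ?_
          exact Real.self_le_rpow_of_one_le hm1 (by linarith)
        have h3 : 0 ≤ Real.exp (-3) * (r m / (m : ℝ) ^ (1 + σ / 2)) :=
          mul_nonneg (Real.exp_pos _).le (div_nonneg (hr m) (by positivity))
        linarith
      · rw [if_neg (fun h => hmz (mem_Icc.1 h).2), zero_add, ← hzσ]
        have e : (m : ℝ) ^ (1 + σ) = (m : ℝ) ^ (1 + σ / 2) * (m : ℝ) ^ (σ / 2) := by
          rw [← Real.rpow_add hm0]; congr 1; ring
        rw [e, Real.rpow_neg hz0.le, ← div_div, inv_mul_eq_div]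
        refine div_le_div_of_nonneg_left (div_nonneg (hr m) (by positivity)) (by positivity) ?_
        have : (z : ℝ) ≤ m := by exact_mod_cast (not_le.1 hmz).le
        exact Real.rpow_le_rpow hz0.le this (by positivity)
    have hF1 : ℓ / 2 / σ < F σ := by rw [div_lt_iff₀ hσpos]; linarith
    have hF2 : F (σ / 2) < 4 * ℓ / σ := by rw [lt_div_iff₀ hσpos]; linarith
    have hF3 : Real.exp (-3) * F (σ / 2) ≤ 1 / 16 * (4 * ℓ / σ) :=
      mul_le_mul hexp hF2.le
        (tsum_nonneg fun m => div_nonneg (hr m) (by positivity)) (by norm_num)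
    have e1 : ℓ / 2 / σ = ℓ / 12 * Real.log z := by rw [hσdef]; field_simp; norm_num
    have e2 : 1 / 16 * (4 * ℓ / σ) = ℓ / 24 * Real.log z := by rw [hσdef]; field_simp; norm_num
    linarith
  obtain ⟨c, hc, h⟩ : ∃ c : ℝ, 0 < c ∧ ∀ z : ℕ, 1 ≤ z →
      c * Real.log z ≤ ∑ m ∈ Icc 1 z, r m / m := by
    refine ⟨min (ℓ / 24) (σ₀ / 6), by positivity, fun z hz => ?_⟩
    have hlog0 : 0 ≤ Real.log z := Real.log_natCast_nonneg z
    by_cases h : 6 / σ₀ < Real.log z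
    · exact (mul_le_mul_of_nonneg_right (min_le_left _ _) hlog0).trans (hbig z hz h)
    · refine le_trans ?_ (hone z hz)
      refine (mul_le_mul_of_nonneg_right (min_le_right _ _) hlog0).trans ?_
      rw [not_lt, le_div_iff₀ hσ₀'] at h
      linarith
  refine ⟨c / (1 + c), by positivity, fun z hz => ?_⟩
  have hz' : (1 : ℝ) ≤ z := by exact_mod_cast hz
  have hlog : Real.log (z + 1) ≤ Real.log z + 1 := by
    calc Real.log (z + 1) ≤ Real.log (z * Real.exp 1) := by
          refine Real.log_le_log (by positivity) ?_
          nlinarith [Real.add_one_le_exp (1 : ℝ)]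
      _ = Real.log z + 1 := by rw [Real.log_mul (by positivity) (by positivity), Real.log_exp]
  have h1 := h z hz
  have h2 := hone z hz
  rw [div_mul_eq_mul_div, div_le_iff₀ (by positivity)]
  nlinarith

/-- The logarithmic partial sums of `1 * χ` grow at least logarithmically. -/
theorem exists_log_le_sum_zetaMul {q : ℕ} [NeZero q] (χ : DirichletCharacter ℂ q)
    (hχ2 : χ ^ 2 = 1) (hχ : χ ≠ 1) :
    ∃ c : ℝ, 0 < c ∧ ∀ z : ℕ, 1 ≤ z →
      c * Real.log (z + 1) ≤ ∑ m ∈ Icc 1 z, (χ.zetaMul m).re / m := by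
  obtain ⟨ℓ, hℓ, hsum, hlim⟩ := tendsto_mul_tsum_zetaMul χ hχ2 hχ
  refine exists_log_le_sum_div _ (fun m => ?_) ?_ ℓ hℓ hsum hlim
  · exact (Complex.le_def.1 (DirichletCharacter.zetaMul_nonneg hχ2 m)).1
  · simp [χ.isMultiplicative_zetaMul.map_one]

end LSeries

section Counting

open Finset

theorem zetaMul_prime_pow_re {q : ℕ} (χ : DirichletCharacter ℂ q) {p : ℕ} (hp : p.Prime) {e : ℤ}
    (he : χ p = (e : ℂ)) (k : ℕ) :
    (χ.zetaMul (p ^ k)).re = ∑ i ∈ range (k + 1), (e : ℝ) ^ i := by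
  have h : χ.zetaMul (p ^ k) = ((∑ i ∈ range (k + 1), (e : ℝ) ^ i : ℝ) : ℂ) := by
    rw [DirichletCharacter.zetaMul, ArithmeticFunction.coe_zeta_mul_apply,
      Nat.sum_divisors_prime_pow hp]
    push_cast
    refine sum_congr rfl fun i _ => ?_
    rw [← χ.apply_eq_toArithmeticFunction_apply (pow_ne_zero i hp.ne_zero), Nat.cast_pow, map_pow,
      he]
  rw [h, Complex.ofReal_re]

theorem sum_Icc_geom_le {t : ℝ} (h0 : 0 ≤ t) (h1 : t < 1) (K : ℕ) :
    ∑ k ∈ Icc 1 K, t ^ k ≤ t / (1 - t) := by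
  have h : ∑ k ∈ Icc 1 K, t ^ k = t * ∑ k ∈ range K, t ^ k := by
    rw [mul_sum, ← Ico_add_one_right_eq_Icc, sum_Ico_eq_sum_range]
    exact sum_congr (by simp) fun k _ => by rw [add_comm, pow_succ']
  rw [h, div_eq_mul_inv]
  exact mul_le_mul_of_nonneg_left
    (sum_le_hasSum _ (fun _ _ => by positivity) (hasSum_geometric_of_lt_one h0 h1)) h0

theorem sum_local_factor_le_of_ne_neg_one {p : ℕ} (hp : 2 < p) {e : ℤ} (he : e = 0 ∨ e = 1)
    (K : ℕ) :
    ∑ k ∈ Icc 1 K, (∑ i ∈ range (k + 1), (e : ℝ) ^ i) / (p : ℝ) ^ k ≤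
      (1 + e : ℝ) / (p - (1 + e)) := by
  have hp' : (2 : ℝ) < p := by exact_mod_cast hp
  have hρ0 : (0 : ℝ) ≤ 1 + e := by rcases he with rfl | rfl <;> norm_num
  have hρ2 : (1 + e : ℝ) ≤ 2 := by rcases he with rfl | rfl <;> norm_num
  have hp0 : (0 : ℝ) < p := by linarith
  have hle : ∀ k ∈ Icc 1 K, (∑ i ∈ range (k + 1), (e : ℝ) ^ i) / (p : ℝ) ^ k ≤
      ((1 + e) / p : ℝ) ^ k := by
    intro k _
    rw [div_pow]
    gcongr
    rcases he with rfl | rfl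
    · simp [zero_pow_eq]
    · have : k + 1 ≤ 2 ^ k := Nat.lt_two_pow_self
      norm_num
      exact_mod_cast this
  refine (sum_le_sum hle).trans ((sum_Icc_geom_le (by positivity) ?_ K).trans (le_of_eq ?_))
  · rw [div_lt_one hp0]; linarith
  · rw [one_sub_div hp0.ne', div_div_div_cancel_right₀ hp0.ne']

theorem sum_local_factor_le {p : ℕ} (hp : 2 ≤ p) {e : ℤ} (he : e = 0 ∨ e = 1 ∨ e = -1) (K : ℕ) :
    ∑ k ∈ range (K + 1), (∑ i ∈ range (k + 1), (e : ℝ) ^ i) / (p : ℝ) ^ k ≤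
      (1 - (p : ℝ)⁻¹)⁻¹ ^ 2 := by
  have hp' : (2 : ℝ) ≤ p := by exact_mod_cast hp
  have hp0 : (0 : ℝ) < p := by linarith
  have h1 : (p : ℝ)⁻¹ < 1 := inv_lt_one_of_one_lt₀ (by linarith)
  have hs := hasSum_choose_mul_geometric_of_norm_lt_one 1
    (show ‖(p : ℝ)⁻¹‖ < 1 by rwa [Real.norm_of_nonneg (by positivity)])
  rw [one_div, ← inv_pow] at hs
  refine le_trans (sum_le_sum fun k _ => ?_)
    (sum_le_hasSum (range (K + 1)) (fun _ _ => by positivity) hs)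
  rw [Nat.choose_one_right, inv_pow, ← div_eq_mul_inv]
  gcongr
  calc ∑ i ∈ range (k + 1), (e : ℝ) ^ i ≤ ∑ i ∈ range (k + 1), 1 := by
        refine sum_le_sum fun i _ => ?_
        rcases he with rfl | rfl | rfl
        · simp [zero_pow_eq]; split_ifs <;> norm_num
        · simp
        · rcases neg_one_pow_eq_or ℝ i with h | h <;> simp [h]
    _ = _ := by simp

theorem sum_local_factor_neg_one_le {p : ℕ} (hp : 2 ≤ p) (K : ℕ) :
    ∑ k ∈ range (K + 1), (∑ i ∈ range (k + 1), (-1 : ℝ) ^ i) / (p : ℝ) ^ k ≤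
      (1 - ((p : ℝ) ^ 2)⁻¹)⁻¹ := by
  have hp' : (2 : ℝ) ≤ p := by exact_mod_cast hp
  have hp0 : (0 : ℝ) < p := by linarith
  have h1 : (p : ℝ)⁻¹ < 1 := inv_lt_one_of_one_lt₀ (by linarith)
  have h0 : 0 < (p : ℝ)⁻¹ := by positivity
  have hs := ((hasSum_geometric_of_lt_one h0.le h1).add
    (hasSum_geometric_of_abs_lt_one (r := -(p : ℝ)⁻¹)
      (by rwa [abs_neg, abs_of_pos h0]))).mul_left (1 / 2)
  have e : 1 / 2 * ((1 - (p : ℝ)⁻¹)⁻¹ + (1 - -(p : ℝ)⁻¹)⁻¹) = (1 - ((p : ℝ) ^ 2)⁻¹)⁻¹ := by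
    have a1 : (1 - (p : ℝ)⁻¹) ≠ 0 := by linarith
    have a2 : (1 + (p : ℝ)⁻¹) ≠ 0 := by linarith
    have a3 : 1 - ((p : ℝ) ^ 2)⁻¹ = (1 - (p : ℝ)⁻¹) * (1 + (p : ℝ)⁻¹) := by ring
    rw [a3, sub_neg_eq_add]
    generalize (p : ℝ)⁻¹ = t at a1 a2
    field_simp
    ring
  rw [e] at hs
  have hterm : ∀ k : ℕ, (∑ i ∈ range (k + 1), (-1 : ℝ) ^ i) / (p : ℝ) ^ k =
      1 / 2 * ((p : ℝ)⁻¹ ^ k + (-(p : ℝ)⁻¹) ^ k) := by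
    intro k
    rw [neg_one_geom_sum, neg_pow]
    rcases Nat.even_or_odd k with h | h
    · have : ¬ Even (k + 1) := by simpa [Nat.even_add_one] using h
      simp [this, h.neg_one_pow]
      ring
    · have : Even (k + 1) := by simpa [Nat.even_add_one] using h
      simp [this, h.neg_one_pow]
  simp_rw [hterm]
  refine sum_le_hasSum _ (fun k _ => ?_) hs
  rw [← hterm, neg_one_geom_sum]
  split_ifs <;> positivity

theorem prod_le_prod_of_subset_of_one_le_real {ι : Type*} {s t : Finset ι} (hst : s ⊆ t)
    {f : ι → ℝ} (hf : ∀ i ∈ t, 1 ≤ f i) : ∏ i ∈ s, f i ≤ ∏ i ∈ t, f i := by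
  classical
  rw [← prod_sdiff hst]
  refine le_mul_of_one_le_left (prod_nonneg fun i hi => zero_le_one.trans (hf i (hst hi))) ?_
  exact prod_induction f (1 ≤ ·) (fun _ _ => one_le_mul_of_one_le_of_one_le) le_rfl
    fun i hi => hf i (mem_sdiff.1 hi).1

theorem prod_Icc_inv_one_sub_inv_sq_le_two (z : ℕ) :
    ∏ k ∈ Icc 2 z, (1 - ((k : ℝ) ^ 2)⁻¹)⁻¹ ≤ 2 := by
  rcases Nat.lt_or_ge z 1 with hz | hz
  · rw [Icc_eq_empty (by omega)]; norm_num
  · have h : ∏ k ∈ Icc 2 z, (1 - ((k : ℝ) ^ 2)⁻¹)⁻¹ = 2 * z / (z + 1) := by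
      induction z, hz using Nat.le_induction with
      | base => norm_num
      | succ n hn ih =>
        rw [← insert_Icc_right_eq_Icc_add_one (by omega), prod_insert (by simp), ih]
        have : (0 : ℝ) < n := by exact_mod_cast hn
        have e : 1 - (((n + 1 : ℕ) : ℝ) ^ 2)⁻¹ = n * (n + 2) / (n + 1) ^ 2 := by
          push_cast
          field_simp
          ring
        rw [e]
        push_cast
        field_simp
        ring
    rw [h, div_le_iff₀ (by positivity)]
    linarith

theorem prod_primeFactors_inv_one_sub_inv (D : ℕ) (hD : D ≠ 0) :
    ∏ p ∈ D.primeFactors, (1 - (p : ℝ)⁻¹)⁻¹ = D / D.totient := by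
  have h := congrArg (Rat.cast : ℚ → ℝ) (Nat.totient_eq_mul_prod_factors D)
  push_cast at h
  have hφ : (D.totient : ℝ) ≠ 0 := by
    exact_mod_cast (Nat.totient_pos.2 (Nat.pos_of_ne_zero hD)).ne'
  have hD' : (D : ℝ) ≠ 0 := by exact_mod_cast hD
  rw [prod_inv_distrib, eq_div_iff hφ, h, mul_left_comm, inv_mul_cancel₀, mul_one]
  intro h0
  rw [h0, mul_zero] at h
  exact hφ h

theorem exists_roots_mod_prime {Δ n b Y : ℤ} (h : b ^ 2 - 4 * n = Y ^ 2 * Δ) {p : ℕ}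
    (hp : p.Prime) (hpD : ¬ p ∣ (2 * n * |Y|).natAbs) (hJ : jacobiSym Δ p ≠ -1) :
    ∃ A : Finset (ZMod p), (#A : ℤ) = 1 + jacobiSym Δ p ∧
      ∀ s ∈ A, (n : ZMod p) * s ^ 2 + b * s + 1 = 0 := by
  have := Fact.mk hp
  have hne : (2 * n * Y : ZMod p) ≠ 0 := by
    intro h0
    refine hpD ?_
    have : ((2 * n * Y : ℤ) : ZMod p) = 0 := by push_cast; exact h0
    rw [ZMod.intCast_zmod_eq_zero_iff_dvd] at this
    rw [Int.natAbs_mul, Int.natAbs_abs, ← Int.natAbs_mul]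
    exact Int.natCast_dvd.1 this
  have h2n : (2 * n : ZMod p) ≠ 0 := left_ne_zero_of_mul hne
  have hY : (Y : ZMod p) ≠ 0 := right_ne_zero_of_mul hne
  have h2 : (2 : ZMod p) ≠ 0 := left_ne_zero_of_mul h2n
  have hn : (n : ZMod p) ≠ 0 := right_ne_zero_of_mul h2n
  have hdisc : (b : ZMod p) ^ 2 - 4 * n = Y ^ 2 * Δ := by exact_mod_cast congrArg (Int.cast) h
  have hroot : ∀ t : ZMod p, t ^ 2 = Δ → (n : ZMod p) * ((-b + Y * t) / (2 * n)) ^ 2 +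
      b * ((-b + Y * t) / (2 * n)) + 1 = 0 := by
    intro t ht
    field_simp
    linear_combination Y ^ 2 * ht - hdisc
  rcases jacobiSym.trichotomy Δ p with h0 | h1 | h1
  · rw [← jacobiSym.legendreSym.to_jacobiSym, legendreSym.eq_zero_iff] at h0
    refine ⟨({(-(b : ZMod p) + Y * 0) / (2 * n)} : Finset (ZMod p)), ?_, ?_⟩
    · rw [← jacobiSym.legendreSym.to_jacobiSym, (legendreSym.eq_zero_iff p Δ).2 h0]
      simp
    · intro s hs
      rw [mem_singleton.1 hs]
      exact hroot 0 (by rw [h0]; ring)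
  · have hΔ0 : (Δ : ZMod p) ≠ 0 := by
      intro h0
      rw [← legendreSym.eq_zero_iff, jacobiSym.legendreSym.to_jacobiSym, h1] at h0
      exact one_ne_zero h0
    have h1' := h1
    rw [← jacobiSym.legendreSym.to_jacobiSym, legendreSym.eq_one_iff p hΔ0] at h1'
    obtain ⟨t, ht⟩ := h1'
    have ht0 : t ≠ 0 := by rintro rfl; exact hΔ0 (by simpa using ht)
    refine ⟨({(-(b : ZMod p) + Y * t) / (2 * n), (-(b : ZMod p) + Y * (-t)) / (2 * n)} :
      Finset (ZMod p)), ?_, ?_⟩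
    · rw [h1, card_pair]
      · norm_num
      · intro heq
        rw [div_left_inj' h2n, add_right_inj] at heq
        have : 2 * (Y * t) = 0 := by linear_combination heq
        exact mul_ne_zero h2 (mul_ne_zero hY ht0) this
    · intro s hs
      rcases mem_insert.1 hs with rfl | hs
      · exact hroot t (by rw [ht]; ring)
      · rw [mem_singleton.1 hs]
        exact hroot (-t) (by rw [ht]; ring)
  · exact absurd h1 hJ

theorem card_le_of_pairwise_abs_sub_le (s : Finset ℤ) (m : ℕ)
    (h : ∀ a ∈ s, ∀ b ∈ s, |a - b| ≤ m) : #s ≤ m + 1 := by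
  rcases s.eq_empty_or_nonempty with rfl | hs
  · simp
  · have hsub : s ⊆ Icc (s.min' hs) (s.min' hs + m) := fun a ha => by
      have := (abs_le.1 (h a ha _ (s.min'_mem hs))).2
      exact mem_Icc.2 ⟨s.min'_le a ha, by linarith⟩
    refine (card_le_card hsub).trans ?_
    simp
    lia

open scoped ComplexOrder in
/-- The Selberg sieve sum attached to the roots of a quadratic polynomial of discriminant
`Y ^ 2 * Δ` grows at least like `log z`, up to the factor `(D / φ(D)) ^ 2`. -/
theorem exists_log_le_sieve_sum (Δ : ℤ) (hΔ : Δ < 0) :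
    ∃ c : ℝ, 0 < c ∧ ∀ D : ℕ, D ≠ 0 → 2 ∣ D → ∀ z : ℕ, 1 ≤ z →
      c * Real.log (z + 1) ≤ (D / D.totient : ℝ) ^ 2 *
        ∑ T ∈ {p ∈ {p ∈ Icc 2 z | p.Prime} | ¬ p ∣ D ∧ jacobiSym Δ p ≠ -1}.powerset with
          ∏ p ∈ T, p ≤ z, ∏ p ∈ T, (1 + jacobiSym Δ p : ℝ) / (p - (1 + jacobiSym Δ p)) := by
  obtain ⟨q, _, χ, hχ2, hχ, hχp⟩ := exists_quadratic_dirichletCharacter Δ hΔ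
  obtain ⟨c, hc, hM⟩ := exists_log_le_sum_zetaMul χ hχ2 hχ
  refine ⟨c / 2, by positivity, fun D hD h2D z hz => ?_⟩
  set r : ℕ → ℝ := fun m => (χ.zetaMul m).re with hrdef
  have hnonneg : ∀ m, 0 ≤ χ.zetaMul m := DirichletCharacter.zetaMul_nonneg hχ2
  have hre : ∀ m, χ.zetaMul m = (r m : ℂ) := fun m =>
    Complex.eq_re_of_ofReal_le (r := 0) (by simpa using hnonneg m)
  have hr0 : ∀ m, 0 ≤ r m := fun m => (Complex.le_def.1 (hnonneg m)).1
  have hr1 : r 1 = 1 := by simp [hrdef, χ.isMultiplicative_zetaMul.map_one]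
  have hmul : ∀ m n : ℕ, m.Coprime n → r (m * n) = r m * r n := by
    intro m n hmn
    have h := χ.isMultiplicative_zetaMul.map_mul_of_coprime hmn
    rw [hre, hre m, hre n] at h
    exact_mod_cast h
  have hval : ∀ p : ℕ, p.Prime → ∃ e : ℤ, χ p = (e : ℂ) ∧ (e = 0 ∨ e = 1 ∨ e = -1) := by
    intro p _
    rcases (MulChar.isQuadratic_iff_sq_eq_one.2 hχ2) p with h | h | h
    · exact ⟨0, by simpa using h, by simp⟩
    · exact ⟨1, by simpa using h, by simp⟩
    · exact ⟨-1, by simpa using h, by simp⟩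
  set E : ℝ := D / D.totient with hE
  set Q : Finset ℕ := {p ∈ Icc 2 z | p.Prime} with hQ
  set a : ℕ → ℝ := fun p =>
    (if p ∣ D then (1 - (p : ℝ)⁻¹)⁻¹ ^ 2 else 1) * (1 - ((p : ℝ) ^ 2)⁻¹)⁻¹ with ha
  have hone : ∀ p : ℕ, 2 ≤ p → 1 ≤ (1 - (p : ℝ)⁻¹)⁻¹ := by
    intro p hp
    have hp' : (2 : ℝ) ≤ p := by exact_mod_cast hp
    have : (p : ℝ)⁻¹ < 1 := inv_lt_one_of_one_lt₀ (by linarith)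
    have : 0 < (p : ℝ)⁻¹ := by positivity
    exact (one_le_inv₀ (by linarith)).2 (by linarith)
  have hone2 : ∀ p : ℕ, 2 ≤ p → 1 ≤ (1 - ((p : ℝ) ^ 2)⁻¹)⁻¹ := by
    intro p hp
    have := hone (p ^ 2) (hp.trans (Nat.le_self_pow two_ne_zero p))
    exact_mod_cast this
  have hgood : ∀ p ∈ Q, ¬ p ∣ D ∧ jacobiSym Δ p ≠ -1 →
      2 < p ∧ χ p = (jacobiSym Δ p : ℂ) ∧ (jacobiSym Δ p = 0 ∨ jacobiSym Δ p = 1) := by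
    rintro p hp ⟨hpD, hJ⟩
    have hp2 : p ≠ 2 := by rintro rfl; exact hpD h2D
    have hpp := (mem_filter.1 hp).2
    refine ⟨lt_of_le_of_ne hpp.two_le hp2.symm, hχp p hpp hp2, ?_⟩
    rcases jacobiSym.trichotomy Δ p with h | h | h
    · exact Or.inl h
    · exact Or.inr h
    · exact absurd h hJ
  have hg0 : ∀ p ∈ Q, ¬ p ∣ D ∧ jacobiSym Δ p ≠ -1 →
      0 ≤ (1 + jacobiSym Δ p : ℝ) / (p - (1 + jacobiSym Δ p)) := by
    intro p hp hg
    obtain ⟨h2p, -, hJ⟩ := hgood p hp hg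
    have h2p' : (2 : ℝ) < p := by exact_mod_cast h2p
    rcases hJ with h | h <;> rw [h] <;> push_cast <;>
      exact div_nonneg (by norm_num) (by linarith)
  have key := sum_primeFactors_subset_le r hr0 hr1 hmul
    (fun p => ¬ p ∣ D ∧ jacobiSym Δ p ≠ -1)
    (fun p => (1 + jacobiSym Δ p : ℝ) / (p - (1 + jacobiSym Δ p))) a Q
    (fun p hp => (mem_filter.1 hp).2)
    hg0
    (fun p hp hg K => by
      obtain ⟨h2p, hχJ, hJ⟩ := hgood p hp hg
      simp_rw [hrdef, zetaMul_prime_pow_re χ (mem_filter.1 hp).2 hχJ]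
      exact sum_local_factor_le_of_ne_neg_one h2p hJ K)
    (fun p hp _ => by
      have h2p := (mem_filter.1 hp).2.two_le
      have h1 := hone p h2p
      have h2 := hone2 p h2p
      simp only [ha]
      split_ifs <;> positivity)
    (fun p hp hb K => by
      have hpp := (mem_filter.1 hp).2
      have h2p := hpp.two_le
      have h1 := hone p h2p
      have h2 := hone2 p h2p
      simp only [ha, hrdef]
      by_cases hpD : p ∣ D
      · obtain ⟨e, he, he'⟩ := hval p hpp
        simp_rw [if_pos hpD, zetaMul_prime_pow_re χ hpp he]
        exact (sum_local_factor_le h2p he' K).trans (le_mul_of_one_le_right (by positivity) h2)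
      · have hp2 : p ≠ 2 := by rintro rfl; exact hpD h2D
        have hJ : jacobiSym Δ p = -1 := by
          by_contra hJ
          exact hb ⟨hpD, hJ⟩
        simp_rw [if_neg hpD, zetaMul_prime_pow_re χ hpp (hχp p hpp hp2), one_mul, hJ]
        simpa using sum_local_factor_neg_one_le h2p K) z
  have hall : {m ∈ Icc 1 z | m.primeFactors ⊆ Q} = Icc 1 z := by
    refine filter_true_of_mem fun m hm p hp => ?_
    have hpp := Nat.prime_of_mem_primeFactors hp
    rw [mem_Icc] at hm
    exact mem_filter.2 ⟨mem_Icc.2 ⟨hpp.two_le,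
      (Nat.le_of_mem_primeFactors hp).trans hm.2⟩, hpp⟩
  rw [hall] at key
  have hbad : ∏ p ∈ Q with ¬ (¬ p ∣ D ∧ jacobiSym Δ p ≠ -1), a p ≤ E ^ 2 * 2 := by
    rw [ha, prod_mul_distrib]
    have hsub : {p ∈ Q | ¬ (¬ p ∣ D ∧ jacobiSym Δ p ≠ -1)} ⊆ Icc 2 z :=
      (filter_subset _ _).trans (filter_subset _ _)
    refine mul_le_mul ?_ ?_ (prod_nonneg fun p hp =>
      zero_le_one.trans (hone2 p (mem_Icc.1 (hsub hp)).1)) (by positivity)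
    · rw [← prod_filter, prod_pow, hE, ← prod_primeFactors_inv_one_sub_inv D hD]
      refine pow_le_pow_left₀ (prod_nonneg fun p hp =>
        zero_le_one.trans (hone p (mem_Icc.1 (hsub (mem_filter.1 hp).1)).1)) ?_ 2
      refine prod_le_prod_of_subset_of_one_le_real (fun p hp => ?_)
        fun p hp => hone p (Nat.prime_of_mem_primeFactors hp).two_le
      rw [mem_filter, mem_filter, hQ, mem_filter] at hp
      exact Nat.mem_primeFactors.2 ⟨hp.1.1.2, hp.2, hD⟩
    · exact (prod_le_prod_of_subset_of_one_le_real hsub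
        fun p hp => hone2 p (mem_Icc.1 hp).1).trans (prod_Icc_inv_one_sub_inv_sq_le_two z)
  have hS : 0 ≤ ∑ T ∈ {p ∈ Q | ¬ p ∣ D ∧ jacobiSym Δ p ≠ -1}.powerset with ∏ p ∈ T, p ≤ z,
      ∏ p ∈ T, (1 + jacobiSym Δ p : ℝ) / (p - (1 + jacobiSym Δ p)) := by
    refine sum_nonneg fun T hT => prod_nonneg fun p hp => ?_
    obtain ⟨hpQ, hg⟩ := mem_filter.1 (mem_powerset.1 (mem_filter.1 hT).1 hp)
    exact hg0 p hpQ hg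
  have := (hM z hz).trans (key.trans (mul_le_mul_of_nonneg_right hbad hS))
  linarith

theorem card_quadratic_le_le {n b : ℤ} (hn : 1 ≤ n) (hdisc : b ^ 2 - 4 * n < 0) (z : ℕ)
    (s : Finset ℤ) (hs : ∀ d ∈ s, n * d ^ 2 + b * d + 1 ≤ z) : #s ≤ 2 * z + 1 := by
  refine card_le_of_pairwise_abs_sub_le s (2 * z) fun a ha d hd => ?_
  have h1 : (2 * n * a + b) ^ 2 ≤ 4 * n * z := by nlinarith [hs a ha]
  have h2 : (2 * n * d + b) ^ 2 ≤ 4 * n * z := by nlinarith [hs d hd]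
  have h3 : n * (n * (a - d) ^ 2) ≤ n * (4 * z) := by
    nlinarith [sq_nonneg ((2 * n * a + b) + (2 * n * d + b))]
  have h4 : n * (a - d) ^ 2 ≤ 4 * z := le_of_mul_le_mul_left h3 (by linarith)
  have h5 : (a - d) ^ 2 ≤ 4 * z := by nlinarith [sq_nonneg (a - d)]
  have hz : (0 : ℤ) ≤ z := Int.natCast_nonneg z
  push_cast
  refine abs_le_of_sq_le_sq ?_ (by positivity)
  rcases hz.eq_or_lt with h | h
  · rw [← h] at h5 ⊢; linarith
  · nlinarith

/-- The Selberg sieve applied to the roots of `n * d ^ 2 + b * d + 1` modulo small primes. -/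
theorem card_prime_values_le {Δ n b Y : ℤ} (hΔ : Δ < 0) (hn : 1 ≤ n) (hY : Y ≠ 0)
    (h : b ^ 2 - 4 * n = Y ^ 2 * Δ) {u v : ℤ} (huv : u ≤ v) {z : ℕ} (hz : 1 ≤ z) :
    (#{d ∈ Ioc u v | Prime (n * d ^ 2 + b * d + 1)} : ℝ) ≤
      (v - u) / (∑ T ∈ {p ∈ {p ∈ Icc 2 z | p.Prime} | ¬ p ∣ (2 * n * |Y|).natAbs ∧
          jacobiSym Δ p ≠ -1}.powerset with ∏ p ∈ T, p ≤ z,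
            ∏ p ∈ T, (1 + jacobiSym Δ p : ℝ) / (p - (1 + jacobiSym Δ p))) +
        z ^ 6 + (2 * z + 1) := by
  set P : Finset ℕ := {p ∈ {p ∈ Icc 2 z | p.Prime} | ¬ p ∣ (2 * n * |Y|).natAbs ∧
    jacobiSym Δ p ≠ -1} with hP
  have hmem : ∀ p ∈ P, p.Prime ∧ p ≤ z ∧ ¬ p ∣ (2 * n * |Y|).natAbs ∧ jacobiSym Δ p ≠ -1 := by
    intro p hp
    rw [hP, mem_filter, mem_filter, mem_Icc] at hp
    exact ⟨hp.1.2, hp.1.1.2, hp.2⟩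
  have hdisc : b ^ 2 - 4 * n < 0 := by
    rw [h]
    exact mul_neg_of_pos_of_neg (by positivity) hΔ
  have hex : ∀ p : ℕ, ∃ A : Finset (ZMod p), p ∈ P → (#A : ℤ) = 1 + jacobiSym Δ p ∧
      ∀ s ∈ A, (n : ZMod p) * s ^ 2 + b * s + 1 = 0 := by
    intro p
    by_cases hp : p ∈ P
    · obtain ⟨hpp, -, hpD, hJ⟩ := hmem p hp
      obtain ⟨A, hA⟩ := exists_roots_mod_prime h hpp hpD hJ
      exact ⟨A, fun _ => hA⟩
    · exact ⟨∅, fun hp' => absurd hp' hp⟩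
  choose A hA using hex
  have hcard : ∀ p ∈ P, 0 < #(A p) ∧ #(A p) < p := by
    intro p hp
    obtain ⟨hpp, -, hpD, hJ⟩ := hmem p hp
    have hc := (hA p hp).1
    have hp2 : p ≠ 2 := by
      rintro rfl
      refine hpD (Int.natCast_dvd.1 ?_)
      rw [mul_assoc]
      exact dvd_mul_right _ _
    have := hpp.two_le
    rcases jacobiSym.trichotomy Δ p with h0 | h0 | h0
    · lia
    · lia
    · exact absurd h0 hJ
  have hsieve := selberg_sieve u v huv P (fun p hp => (hmem p hp).1) A
    (fun p hp => (hcard p hp).1) (fun p hp => (hcard p hp).2) z hz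
  have hsum : ∑ T ∈ P.powerset with ∏ p ∈ T, p ≤ z, ∏ p ∈ T, (#(A p) : ℝ) / (p - #(A p)) =
      ∑ T ∈ P.powerset with ∏ p ∈ T, p ≤ z,
        ∏ p ∈ T, (1 + jacobiSym Δ p : ℝ) / (p - (1 + jacobiSym Δ p)) := by
    refine sum_congr rfl fun T hT => prod_congr rfl fun p hp => ?_
    have hc := (hA p (mem_powerset.1 (mem_filter.1 hT).1 hp)).1
    have hc' : (#(A p) : ℝ) = 1 + jacobiSym Δ p := by exact_mod_cast hc
    rw [hc']
  rw [hsum] at hsieve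
  have hsmall : #{d ∈ Ioc u v | n * d ^ 2 + b * d + 1 ≤ z} ≤ 2 * z + 1 :=
    card_quadratic_le_le hn hdisc z _ fun d hd => (mem_filter.1 hd).2
  have hsub : {d ∈ Ioc u v | Prime (n * d ^ 2 + b * d + 1)} ⊆
      {d ∈ Ioc u v | ∀ p ∈ P, (d : ZMod p) ∉ A p} ∪
        {d ∈ Ioc u v | n * d ^ 2 + b * d + 1 ≤ z} := by
    intro d hd
    obtain ⟨hd, hprime⟩ := mem_filter.1 hd
    by_cases hav : ∀ p ∈ P, (d : ZMod p) ∉ A p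
    · exact mem_union_left _ (mem_filter.2 ⟨hd, hav⟩)
    · push Not at hav
      obtain ⟨p, hp, hdA⟩ := hav
      have hdvd : (p : ℤ) ∣ n * d ^ 2 + b * d + 1 := by
        rw [← ZMod.intCast_zmod_eq_zero_iff_dvd]
        push_cast
        exact (hA p hp).2 _ hdA
      have hpos : 0 < n * d ^ 2 + b * d + 1 := by
        by_contra hneg
        nlinarith [sq_nonneg (2 * n * d + b)]
      have hpp := Nat.prime_iff_prime_int.1 (hmem p hp).1
      have heq := Int.eq_of_associated_of_nonneg (hpp.associated_of_dvd hprime hdvd)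
        (Int.natCast_nonneg p) hpos.le
      refine mem_union_right _ (mem_filter.2 ⟨hd, ?_⟩)
      rw [← heq]
      exact_mod_cast (hmem p hp).2.1
  have hle : (#{d ∈ Ioc u v | Prime (n * d ^ 2 + b * d + 1)} : ℝ) ≤
      #{d ∈ Ioc u v | ∀ p ∈ P, (d : ZMod p) ∉ A p} +
        #{d ∈ Ioc u v | n * d ^ 2 + b * d + 1 ≤ z} := by
    exact_mod_cast (card_le_card hsub).trans (card_union_le _ _)
  have hsmall' : (#{d ∈ Ioc u v | n * d ^ 2 + b * d + 1 ≤ z} : ℝ) ≤ 2 * z + 1 := by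
    exact_mod_cast hsmall
  linarith

/-- A sieving level whose sixth power is negligible against `N / log x`. -/
theorem exists_sieve_level {x N : ℝ} (hx : 3 ≤ x) (hxN : x ^ ((1 : ℝ) / 3) ≤ N) :
    1 ≤ N ∧ ∃ z : ℕ, 1 ≤ z ∧ Real.log x ≤ 36 * Real.log (z + 1) ∧
      (z : ℝ) ^ 6 + (2 * z + 1) ≤ 24 * N / Real.log x := by
  have hx0 : (0 : ℝ) < x := by linarith
  have hlogx : 0 < Real.log x := Real.log_pos (by linarith)
  have hN1 : 1 ≤ N := (Real.one_le_rpow (by linarith) (by norm_num)).trans hxN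
  have hN0 : 0 < N := by linarith
  set y : ℝ := N ^ ((1 : ℝ) / 12) with hy
  have hy1 : 1 ≤ y := Real.one_le_rpow hN1 (by norm_num)
  have hy0 : 0 < y := by linarith
  have hyN : y ^ 12 = N := by
    rw [hy, ← Real.rpow_natCast, ← Real.rpow_mul hN0.le]
    norm_num
  have hlogN : Real.log N = 12 * Real.log y := by
    rw [← hyN, Real.log_pow]; norm_num
  have hlog : Real.log x ≤ 36 * Real.log y := by
    have := Real.log_le_log (by positivity) hxN
    rw [Real.log_rpow hx0] at this
    linarith
  have hz1 : 1 ≤ ⌊y⌋₊ := Nat.le_floor (by simpa using hy1)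
  have hzy : (⌊y⌋₊ : ℝ) ≤ y := Nat.floor_le hy0.le
  refine ⟨hN1, ⌊y⌋₊, hz1, ?_, ?_⟩
  · refine hlog.trans (mul_le_mul_of_nonneg_left ?_ (by norm_num))
    exact Real.log_le_log hy0 (Nat.lt_floor_add_one y).le
  · have h6 : Real.log x ≤ 6 * y ^ 6 := by
      have := Real.log_le_sub_one_of_pos (pow_pos hy0 6)
      rw [Real.log_pow] at this
      push_cast at this
      linarith
    have h1y : 1 ≤ y ^ 6 := one_le_pow₀ hy1
    have hyy : y ≤ y ^ 6 := le_self_pow₀ hy1 (by norm_num)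
    have hz6 : (⌊y⌋₊ : ℝ) ^ 6 ≤ y ^ 6 := pow_le_pow_left₀ (by positivity) hzy 6
    rw [le_div_iff₀ hlogx]
    calc ((⌊y⌋₊ : ℝ) ^ 6 + (2 * ⌊y⌋₊ + 1)) * Real.log x ≤ (4 * y ^ 6) * (6 * y ^ 6) := by
          gcongr; linarith
      _ = 24 * N := by rw [← hyN]; ring

/-- The sieve bound for every negative `Δ`, with no fundamentality assumption. -/
theorem exists_card_prime_values_le {Δ : ℤ} (hΔ : Δ < 0) :
    ∃ C : ℝ, 0 < C ∧ ∀ n b Y : ℤ, 1 ≤ n → Y ≠ 0 → b ^ 2 - 4 * n = Y ^ 2 * Δ →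
      ∀ x N : ℝ, 3 ≤ x → x ^ ((1 : ℝ) / 3) ≤ N → N ≤ x →
        (Set.ncard {d : ℤ | N < (d : ℝ) ∧ (d : ℝ) ≤ 2 * N ∧
            Prime (n * d ^ 2 + b * d + 1)} : ℝ) ≤
          C * ((2 * n * |Y| : ℤ) / (Nat.totient (2 * n * |Y| : ℤ).natAbs : ℝ)) ^ 2 *
            N / Real.log x := by
  obtain ⟨c, hc, hS⟩ := exists_log_le_sieve_sum Δ hΔ
  refine ⟨72 / c + 24, by positivity, fun n b Y hn hY h x N hx hxN _ => ?_⟩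
  obtain ⟨hN1, z, hz, hlogz, herr⟩ := exists_sieve_level hx hxN
  have hlogx : 0 < Real.log x := Real.log_pos (by linarith)
  set D : ℕ := (2 * n * |Y|).natAbs with hD
  have hDpos : 0 < 2 * n * |Y| := by positivity
  have hD0 : D ≠ 0 := Int.natAbs_ne_zero.2 hDpos.ne'
  have hDcast : ((2 * n * |Y| : ℤ) : ℝ) = D := by
    rw [hD, Nat.cast_natAbs, abs_of_pos hDpos]
  have h2D : 2 ∣ D := by
    rw [hD, ← Int.natCast_dvd, mul_assoc]
    exact dvd_mul_right _ _
  have hSz := hS D hD0 h2D z hz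
  rw [hDcast]
  set E : ℝ := D / D.totient with hE
  have hE1 : 1 ≤ E := by
    have : (0 : ℝ) < D.totient := by exact_mod_cast Nat.totient_pos.2 (Nat.pos_of_ne_zero hD0)
    rw [hE, one_le_div this]
    exact_mod_cast Nat.totient_le D
  have huv : ⌊N⌋ ≤ ⌊2 * N⌋ := Int.floor_le_floor (by linarith)
  have hcount := card_prime_values_le hΔ hn hY h huv hz
  set S : ℝ := ∑ T ∈ {p ∈ {p ∈ Icc 2 z | p.Prime} | ¬ p ∣ D ∧ jacobiSym Δ p ≠ -1}.powerset with
    ∏ p ∈ T, p ≤ z, ∏ p ∈ T, (1 + jacobiSym Δ p : ℝ) / (p - (1 + jacobiSym Δ p))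
  have hSlow : c * Real.log x ≤ 36 * (E ^ 2 * S) := by nlinarith
  have hSpos : 0 < S := by
    have : 0 < 36 * (E ^ 2 * S) := (mul_pos hc hlogx).trans_le hSlow
    by_contra hneg
    nlinarith [mul_nonneg (sq_nonneg E) (not_lt.1 hneg |> neg_nonneg.2)]
  have hmain : ((⌊2 * N⌋ : ℝ) - ⌊N⌋) / S ≤ 72 / c * E ^ 2 * N / Real.log x := by
    have hlen : (⌊2 * N⌋ : ℝ) - ⌊N⌋ ≤ 2 * N := by
      linarith [Int.floor_le (2 * N), Int.lt_floor_add_one N]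
    calc ((⌊2 * N⌋ : ℝ) - ⌊N⌋) / S ≤ 2 * N / S := by gcongr
      _ ≤ 72 / c * E ^ 2 * N / Real.log x := by
        rw [div_le_div_iff₀ hSpos hlogx, div_mul_eq_mul_div, div_mul_eq_mul_div,
          div_mul_eq_mul_div, le_div_iff₀ hc]
        nlinarith
  have herr' : 24 * N / Real.log x ≤ 24 * E ^ 2 * N / Real.log x := by
    gcongr
    nlinarith
  have hset : {d : ℤ | N < (d : ℝ) ∧ (d : ℝ) ≤ 2 * N ∧ Prime (n * d ^ 2 + b * d + 1)} =
      ({d ∈ Ioc ⌊N⌋ ⌊2 * N⌋ | Prime (n * d ^ 2 + b * d + 1)} : Finset ℤ) := by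
    ext d
    simp [Int.floor_lt, Int.le_floor, and_assoc]
  rw [hset, Set.ncard_coe_finset]
  calc _ ≤ _ := hcount
    _ ≤ 72 / c * E ^ 2 * N / Real.log x + 24 * E ^ 2 * N / Real.log x := by linarith
    _ = (72 / c + 24) * E ^ 2 * N / Real.log x := by ring

end Counting

end QuadraticSieve

/-- Let `Δ < 0` be the discriminant of an imaginary quadratic number field. There is a
constant `C > 0`, depending only on `Δ`, such that for all integers `n ≥ 1`, `b`, `Y ≠ 0`
with `b² − 4n = Y²·Δ`, setting `D = 2·n·|Y|`, for every real `x ≥ 3` and every real `N` with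
`x^(1/3) ≤ N ≤ x`, the number of integers `d` with `N < d ≤ 2N` for which `n·d² + b·d + 1`
is prime is at most `C·(D/φ(D))²·N/log x`. -/
theorem sieve_bound_prime_values (Δ : ℤ)
    (hΔ : ∃ g : ℤ, g < 0 ∧ Squarefree g ∧
      ((g % 4 = 1 ∧ Δ = g) ∨ ((g % 4 = 2 ∨ g % 4 = 3) ∧ Δ = 4 * g))) :
    ∃ C : ℝ, 0 < C ∧ ∀ n b Y : ℤ, 1 ≤ n → Y ≠ 0 → b ^ 2 - 4 * n = Y ^ 2 * Δ →
      ∀ x N : ℝ, 3 ≤ x → x ^ ((1 : ℝ) / 3) ≤ N → N ≤ x →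
        (Set.ncard {d : ℤ | N < (d : ℝ) ∧ (d : ℝ) ≤ 2 * N ∧
            Prime (n * d ^ 2 + b * d + 1)} : ℝ) ≤
          C * ((2 * n * |Y| : ℤ) / (Nat.totient (2 * n * |Y| : ℤ).natAbs : ℝ)) ^ 2 *
            N / Real.log x := by
  refine QuadraticSieve.exists_card_prime_values_le ?_
  obtain ⟨g, hg, -, ⟨-, rfl⟩ | ⟨-, rfl⟩⟩ := hΔ <;> linarith
end
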